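/- arXiv:math/0212097 — 10 statements merged into one kernel-verified Lean document; each statement's English description precedes it below -/
import Mathlib

section
/- Let d ≥ 1 and let W be a totally positive d×d real matrix, viewed as a linear map ℝ^d → ℝ^d. Then for each i ∈ {1,…,d}: (a) for every x ∈ [−1,1]^d with x_i = (−1)^{d+i} and every z ∈ [−1,1]^d such that (Wz)_j = (Wx)_j for all 1 ≤ j ≤ d−1, one has (Wz)_d ≤ (Wx)_d; and (b) for every x ∈ [−1,1]^d with x_i = (−1)^{d+i+1} and every z ∈ [−1,1]^d such that (Wz)_j = (Wx)_j for all 1 ≤ j ≤ d−1, one has (Wz)_d ≥ (Wx)_d. (That is, the upper facets of the image W([−1,1]^d) are the images of the facets {x ∈ [−1,1]^d : x_i = (−1)^{d+i}} and the lower facets are the images of the facets {x ∈ [−1,1]^d : x_i = (−1)^{d+i+1}}.) -/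
/-- A real matrix is totally positive if every square submatrix (given by strictly
increasing choices of rows and columns) has positive determinant. -/
def TotallyPositive {m n : ℕ} (A : Matrix (Fin m) (Fin n) ℝ) : Prop :=
  ∀ (k : ℕ) (r : Fin k → Fin m) (c : Fin k → Fin n),
    StrictMono r → StrictMono c → 0 < (A.submatrix r c).det

theorem key_aux (n : ℕ) (W : Matrix (Fin (n+1)) (Fin (n+1)) ℝ)
    (hW : TotallyPositive W) (i : Fin (n+1)) (x z : Fin (n+1) → ℝ)
    (h : ∀ j : Fin (n+1), j.val + 1 < n + 1 → W.mulVec z j = W.mulVec x j) :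
    ∃ a b : ℝ, 0 < a ∧ 0 < b ∧
      a * (z i - x i) = (-1) ^ (n + i.val) * b *
        (W.mulVec z (Fin.last n) - W.mulVec x (Fin.last n)) := by
  refine ⟨W.det, (W.submatrix (Fin.last n).succAbove i.succAbove).det, ?_, ?_, ?_⟩
  · have := hW (n+1) id id strictMono_id strictMono_id
    simpa using this
  · exact hW n _ _ (Fin.strictMono_succAbove _) (Fin.strictMono_succAbove _)
  · have h1 : W.adjugate.mulVec (W.mulVec (z - x)) i = W.det * (z i - x i) := by
      rw [Matrix.mulVec_mulVec, Matrix.adjugate_mul, Matrix.smul_mulVec, Matrix.one_mulVec]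
      simp
    rw [← h1, Matrix.mulVec, dotProduct, Finset.sum_eq_single (Fin.last n)]
    · rw [Matrix.adjugate_fin_succ_eq_det_submatrix, Matrix.mulVec_sub]
      simp
    · intro j _ hj
      have hlt : j.val + 1 < n + 1 := by
        have := Fin.val_lt_last hj
        omega
      rw [Matrix.mulVec_sub, Pi.sub_apply, h j hlt]
      simp
    · simp

theorem stmt_1 (d : ℕ) (hd : 1 ≤ d) (W : Matrix (Fin d) (Fin d) ℝ)
    (hW : TotallyPositive W) (i : Fin d) :
    (∀ x z : Fin d → ℝ,
      (∀ k, x k ∈ Set.Icc (-1 : ℝ) 1) → x i = (-1) ^ (d + (i.val + 1)) →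
      (∀ k, z k ∈ Set.Icc (-1 : ℝ) 1) →
      (∀ j : Fin d, j.val + 1 < d → W.mulVec z j = W.mulVec x j) →
      W.mulVec z ⟨d - 1, by omega⟩ ≤ W.mulVec x ⟨d - 1, by omega⟩) ∧
    (∀ x z : Fin d → ℝ,
      (∀ k, x k ∈ Set.Icc (-1 : ℝ) 1) → x i = (-1) ^ (d + (i.val + 1) + 1) →
      (∀ k, z k ∈ Set.Icc (-1 : ℝ) 1) →
      (∀ j : Fin d, j.val + 1 < d → W.mulVec z j = W.mulVec x j) →
      W.mulVec x ⟨d - 1, by omega⟩ ≤ W.mulVec z ⟨d - 1, by omega⟩) := by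
  obtain ⟨n, rfl⟩ : ∃ n, d = n + 1 := ⟨d - 1, by omega⟩
  have hl : (⟨n + 1 - 1, by omega⟩ : Fin (n+1)) = Fin.last n := by
    ext; simp
  constructor
  all_goals
    intro x z hx hxi hz h
    obtain ⟨a, b, ha, hb, hab⟩ := key_aux n W hW i x z h
    rw [hl]
    have hzi := hz i
    obtain ⟨hz1, hz2⟩ := hzi
    have e1 : n + 1 + (i.val + 1) = n + i.val + 2 := by ring
    rw [e1] at hxi
    simp only [pow_succ] at hxi
    rcases neg_one_pow_eq_or ℝ (n + i.val) with hs | hs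
    all_goals
      rw [hs] at hxi hab
      norm_num at hxi
      rw [hxi] at hab
      by_contra hc
      push Not at hc
      have hp := mul_pos hb (sub_pos.mpr hc)
      nlinarith [mul_nonneg ha.le (sub_nonneg.mpr hz1), mul_nonneg ha.le (sub_nonneg.mpr hz2)]
end

section
/- Let 0 < c_1 < c_2 < … < c_n be real numbers and let d ≥ 1. Then the d×n real matrix T with entries T_{ij} = c_j^i (1 ≤ i ≤ d, 1 ≤ j ≤ n) is totally positive: every square submatrix of T has positive determinant. -/
open Polynomial in
theorem aux_signVar : ∀ (m : ℕ) (P : ℝ[X]), P ≠ 0 → P.support.card = m →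
    P.signVariations + 1 ≤ m := by
  intro m
  induction m with
  | zero =>
    intro P hP h
    exact absurd (card_support_eq_zero.mp h) hP
  | succ m ih =>
    intro P hP h
    by_cases h0 : P.eraseLead = 0
    · rw [signVariations_eq_eraseLead_add_ite hP, h0]
      simp [hP]
    · have h1 := ih _ h0 (card_support_eraseLead' h)
      have h2 := signVariations_le_eraseLead_succ (P := P)
      omega

open Polynomial in
theorem aux_roots (P : ℝ[X]) (hP : P ≠ 0) (m : ℕ) (hm : P.support.card ≤ m)
    (x : Fin m → ℝ) (hx : Function.Injective x) (hpos : ∀ i, 0 < x i)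
    (hr : ∀ i, P.eval (x i) = 0) : False := by
  classical
  have h1 := aux_signVar _ P hP rfl
  have h2 := roots_countP_pos_le_signVariations (P := P)
  have h3 : (Finset.univ.image x).val ≤ P.roots.filter (0 < ·) := by
    rw [Multiset.le_iff_subset (Finset.nodup _)]
    intro y hy
    simp only [Finset.mem_val, Finset.mem_image, Finset.mem_univ, true_and] at hy
    obtain ⟨i, rfl⟩ := hy
    simp [hP, hpos i, hr i]
  have h4 := Multiset.card_le_card h3
  rw [← Multiset.countP_eq_card_filter, Finset.card_val,
    Finset.card_image_of_injective _ hx, Finset.card_univ, Fintype.card_fin] at h4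
  omega

open Polynomial in
theorem aux_main : ∀ (k : ℕ) (e : Fin k → ℕ) (x : Fin k → ℝ), StrictMono e → StrictMono x →
    (∀ i, 0 < x i) → 0 < (Matrix.of fun i j => x j ^ e i : Matrix (Fin k) (Fin k) ℝ).det := by
  intro k
  induction k with
  | zero => intro e x _ _ _; simp
  | succ k ih =>
    intro e x he hx hpos
    rcases Nat.eq_zero_or_pos k with rfl | hk
    · simp [Matrix.det_fin_one, pow_pos (hpos 0)]
    set y : Fin k → ℝ := fun j => x j.castSucc with hy
    have hymono : StrictMono y := fun a b h => hx (by simpa using h)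
    set a : Fin (k+1) → ℝ := fun i => (-1) ^ (i.val + k) *
      (Matrix.of fun (i' : Fin k) (j : Fin k) => y j ^ e (i.succAbove i')).det with ha
    set P : ℝ[X] := ∑ i, C (a i) * X ^ e i with hPdef
    have heval : ∀ t, P.eval t =
        (Matrix.of fun i j => (Fin.snoc y t : Fin (k+1) → ℝ) j ^ e i :
          Matrix (Fin (k+1)) (Fin (k+1)) ℝ).det := by
      intro t
      rw [Matrix.det_succ_column _ (Fin.last k), hPdef, eval_finset_sum]
      refine Finset.sum_congr rfl fun i _ => ?_
      have : (Matrix.of fun i j => (Fin.snoc y t : Fin (k+1) → ℝ) j ^ e i).submatrix i.succAbove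
          (Fin.last k).succAbove
          = (Matrix.of fun (i' : Fin k) (j : Fin k) => y j ^ e (i.succAbove i')) := by
        ext i' j
        simp
      rw [this]
      simp [ha]
      ring
    have hcoeff : P.coeff (e (Fin.last k)) = a (Fin.last k) := by
      rw [hPdef, finset_sum_coeff, Finset.sum_eq_single (Fin.last k)]
      · simp
      · intro b _ hb
        rw [coeff_C_mul_X_pow, if_neg]
        intro h
        exact hb (he.injective h).symm
      · simp
    have hapos : 0 < a (Fin.last k) := by
      have := ih (fun i => e i.castSucc) y (fun a b h => he (by simpa using h)) hymono
        (fun i => hpos _)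
      simpa [ha, ← two_mul] using this
    have hP0 : P ≠ 0 := by
      intro h
      rw [h] at hcoeff
      simp at hcoeff
      linarith
    have hdeg : P.natDegree = e (Fin.last k) := by
      apply le_antisymm
      · apply natDegree_sum_le_of_forall_le
        intro i _
        exact (natDegree_C_mul_X_pow_le _ _).trans (he.monotone (Fin.le_last i))
      · apply le_natDegree_of_ne_zero
        rw [hcoeff]; exact hapos.ne'
    have hepos : 0 < e (Fin.last k) := by
      have : e 0 < e (Fin.last k) := he (by simp [Fin.lt_def]; omega)
      omega
    have hsupp : P.support.card ≤ k + 1 := by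
      have : P.support ⊆ Finset.univ.image e := by
        intro m hm
        by_contra hcon
        apply mem_support_iff.mp hm
        rw [hPdef, finset_sum_coeff]
        apply Finset.sum_eq_zero
        intro i _
        rw [coeff_C_mul_X_pow, if_neg]
        rintro rfl
        exact hcon (by simp)
      exact (Finset.card_le_card this).trans (Finset.card_image_le.trans (by simp))
    have hne : ∀ t, x (Fin.last k) ≤ t → P.eval t ≠ 0 := by
      intro t ht h0
      have hlt : ∀ j, y j < t := fun j => (hx (Fin.castSucc_lt_last j)).trans_le ht
      refine aux_roots P hP0 (k+1) hsupp (Fin.snoc y t) ?_ ?_ ?_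
      · rw [Fin.snoc_injective_iff]
        refine ⟨hymono.injective, ?_⟩
        rintro ⟨j, hj⟩
        exact (hlt j).ne hj
      · intro i
        refine Fin.lastCases ?_ (fun j => ?_) i
        · simpa using (hpos _).trans_le ht
        · simpa using hpos _
      · intro i
        refine Fin.lastCases ?_ (fun j => ?_) i
        · simpa using h0
        · rw [heval]
          apply Matrix.det_zero_of_column_eq (i := j.castSucc) (j := Fin.last k)
          · exact (Fin.castSucc_lt_last j).ne
          · intro i; simp
    have hfin : 0 < P.eval (x (Fin.last k)) := by
      by_contra hcon
      have htend := tendsto_atTop_of_leadingCoeff_nonneg P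
        (natDegree_pos_iff_degree_pos.mp (hdeg ▸ hepos))
        (by rw [leadingCoeff, hdeg, hcoeff]; exact hapos.le)
      obtain ⟨z, hz1, hz2⟩ := ((htend.eventually_ge_atTop 0).and
        (Filter.eventually_ge_atTop (x (Fin.last k)))).exists
      obtain ⟨w, hw, hw0⟩ := intermediate_value_Icc hz2 P.continuous.continuousOn
        ⟨not_lt.mp hcon, hz1⟩
      exact hne w hw.1 hw0
    rw [heval] at hfin
    have hs : (Fin.snoc y (x (Fin.last k)) : Fin (k+1) → ℝ) = x := by
      ext i
      refine Fin.lastCases ?_ (fun j => ?_) i <;> simp [hy]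
    rwa [hs] at hfin

theorem stmt_2 (n d : ℕ) (hd : 1 ≤ d) (c : Fin n → ℝ)
    (hpos : ∀ j, 0 < c j) (hmono : StrictMono c) :
    TotallyPositive (Matrix.of fun (i : Fin d) (j : Fin n) => c j ^ (i.val + 1)) := by
  intro k r s hr hs
  exact aux_main k (fun i => (r i).val + 1) (fun j => c (s j))
    (fun a b h => Nat.succ_lt_succ (hr h)) (hmono.comp hs) (fun i => hpos _)
end

section
/- Let T be a totally positive (d+1)×n real matrix and let x ∈ ℝ^n be a nonzero vector with Tx = 0. Then x has at least d+2 nonzero coordinates. Moreover, if x has exactly d+2 nonzero coordinates, occurring at positions a_1 < a_2 < … < a_{d+2}, then consecutive nonzero coordinates alternate in sign: x_{a_k}·x_{a_{k+1}} < 0 for all 1 ≤ k ≤ d+1. -/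
theorem stmt_3 (d n : ℕ) (T : Matrix (Fin (d + 1)) (Fin n) ℝ)
    (hT : TotallyPositive T) (x : Fin n → ℝ) (hx : x ≠ 0)
    (hker : T.mulVec x = 0) :
    d + 2 ≤ {i | x i ≠ 0}.ncard ∧
    ∀ a : Fin (d + 2) → Fin n, StrictMono a →
      (∀ i, x i ≠ 0 ↔ i ∈ Set.range a) →
      ∀ k : Fin (d + 1), x (a k.castSucc) * x (a k.succ) < 0 := by
  classical
  have key : ∀ (m : ℕ) (a : Fin m → Fin n), StrictMono a →
      (∀ i, x i ≠ 0 ↔ i ∈ Set.range a) → ∀ r, ∑ j, T r (a j) * x (a j) = 0 := by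
    intro m a ha hr r
    have h := congrFun hker r
    simp only [Matrix.mulVec, dotProduct, Pi.zero_apply] at h
    rw [← h]
    rw [← Finset.sum_image (s := Finset.univ) (g := a) (f := fun i => T r i * x i)
      (fun _ _ _ _ e => ha.injective e)]
    refine Finset.sum_subset (Finset.subset_univ _) ?_
    intro i _ hi
    have : x i = 0 := by
      by_contra h0
      obtain ⟨j, hj⟩ := (hr i).1 h0
      exact hi (Finset.mem_image.2 ⟨j, Finset.mem_univ _, hj⟩)
    simp [this]
  constructor
  · by_contra hlt
    set s : Finset (Fin n) := Finset.univ.filter (fun i => x i ≠ 0) with hs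
    have hcard : {i | x i ≠ 0}.ncard = s.card := by
      rw [← Set.ncard_coe_finset]; congr 1; ext i; simp [hs]
    rw [hcard] at hlt
    have hle : s.card ≤ d + 1 := by omega
    have hmono : StrictMono (s.orderEmbOfFin rfl) := (s.orderEmbOfFin rfl).strictMono
    have hr : ∀ i, x i ≠ 0 ↔ i ∈ Set.range (s.orderEmbOfFin rfl) := by
      intro i; rw [Finset.range_orderEmbOfFin]; simp [hs]
    have hk := key _ _ hmono hr
    have hdet := hT s.card (Fin.castLE hle) (s.orderEmbOfFin rfl) (Fin.strictMono_castLE hle) hmono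
    have hz := Matrix.eq_zero_of_mulVec_eq_zero hdet.ne'
      (v := fun j => x (s.orderEmbOfFin rfl j)) (by
        ext r; exact hk (Fin.castLE hle r))
    apply hx
    ext i
    by_contra hi
    obtain ⟨j, hj⟩ := (hr i).1 hi
    exact hi (by rw [← hj]; exact congrFun hz j)
  · intro a ha hr k
    have hk := key _ a ha hr
    set A := T.submatrix id (a ∘ k.succ.succAbove) with hA
    have hA1 : 0 < A.det := hT _ id _ strictMono_id (ha.comp (Fin.strictMono_succAbove _))
    have hA2 : 0 < (T.submatrix id (a ∘ k.castSucc.succAbove)).det :=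
      hT _ id _ strictMono_id (ha.comp (Fin.strictMono_succAbove _))
    set v : Fin (d+1) → ℝ := fun j => x (a (k.succ.succAbove j)) with hv
    have h1 : A.mulVec v = (-x (a k.succ)) • fun r => T r (a k.succ) := by
      ext r
      have := hk r
      rw [Fin.sum_univ_succAbove _ k.succ] at this
      simp only [Matrix.mulVec, dotProduct, hA, hv, Matrix.submatrix_apply, Function.comp, id,
        Pi.smul_apply, smul_eq_mul]
      linarith
    have h2 : A.updateCol k (fun r => T r (a k.succ)) =
        T.submatrix id (a ∘ k.castSucc.succAbove) := by
      ext r j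
      rw [Matrix.updateCol_apply]
      split_ifs with h
      · subst h; simp
      · simp only [hA, Matrix.submatrix_apply, Function.comp, id]
        congr 2
        have : (j : ℕ) ≠ k := fun h' => h (Fin.ext h')
        ext
        simp only [Fin.succAbove, Fin.lt_def, Fin.val_castSucc, Fin.val_succ]
        split_ifs <;> simp <;> omega
    have h3 : A.det * v k = -x (a k.succ) * (T.submatrix id (a ∘ k.castSucc.succAbove)).det := by
      have e1 : A.cramer (A.mulVec v) = A.det • v := by
        rw [Matrix.cramer_eq_adjugate_mulVec, Matrix.mulVec_mulVec, Matrix.adjugate_mul,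
          Matrix.smul_mulVec, Matrix.one_mulVec]
      have e2 := congrFun e1 k
      rw [h1, map_smul] at e2
      simp only [Pi.smul_apply, smul_eq_mul, Matrix.cramer_apply, h2] at e2
      exact e2.symm
    have h4 : v k = x (a k.castSucc) := by simp [hv]
    rw [h4] at h3
    have h5 : x (a k.succ) ≠ 0 := (hr _).2 ⟨_, rfl⟩
    have h6 : A.det * (x (a k.castSucc) * x (a k.succ)) < 0 := by
      rw [← mul_assoc, h3]
      have := mul_pos (mul_self_pos.2 h5) hA2
      linarith
    exact (pos_iff_neg_of_mul_neg h6).1 hA1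
end

section
/- Let T be a totally positive (d+1)×n real matrix with n ≥ d+2, and let A be any set of d+2 indices in {1,…,n}. Then there exists a vector x ∈ ℝ^n with Tx = 0 whose set of nonzero coordinates is exactly A, i.e., x_i ≠ 0 if and only if i ∈ A. -/
theorem stmt_4 (d n : ℕ) (hn : d + 2 ≤ n) (T : Matrix (Fin (d + 1)) (Fin n) ℝ)
    (hT : TotallyPositive T) (A : Finset (Fin n)) (hA : A.card = d + 2) :
    ∃ x : Fin n → ℝ, T.mulVec x = 0 ∧ ∀ i, x i ≠ 0 ↔ i ∈ A := by
  classical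
  set e := A.orderEmbOfFin hA with he
  let M : Matrix (Fin (d + 1)) (Fin (d + 2)) ℝ := T.submatrix id e
  obtain ⟨v, hv, hv0⟩ : ∃ v, M.mulVecLin v = 0 ∧ v ≠ 0 := by
    have := LinearMap.ker_ne_bot_of_finrank_lt (f := M.mulVecLin) (by simp)
    obtain ⟨v, hv, h0⟩ := (Submodule.ne_bot_iff _).1 this
    exact ⟨v, hv, h0⟩
  have hnz : ∀ j, v j ≠ 0 := by
    intro j hj
    have hdet := hT (d + 1) id (e ∘ j.succAbove) strictMono_id
      (e.strictMono.comp (Fin.strictMono_succAbove j))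
    have hz : (T.submatrix id (e ∘ j.succAbove)).mulVec (v ∘ j.succAbove) = 0 := by
      ext i
      have := congrFun hv i
      simp only [Matrix.mulVecLin_apply, Matrix.mulVec, dotProduct] at this
      rw [Fin.sum_univ_succAbove _ j, hj, mul_zero, zero_add] at this
      simpa [Matrix.mulVec, dotProduct, M] using this
    have h2 := Matrix.eq_zero_of_mulVec_eq_zero hdet.ne' hz
    apply hv0
    ext k
    rcases Fin.eq_self_or_eq_succAbove j k with h | ⟨l, h⟩
    · rw [h, hj]; rfl
    · rw [h]; exact congrFun h2 l
  refine ⟨Function.extend e v 0, ?_, ?_⟩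
  · ext i
    have := congrFun hv i
    simp only [Matrix.mulVecLin_apply, Matrix.mulVec, dotProduct] at this
    simp only [Matrix.mulVec, dotProduct]
    rw [← this]
    symm
    apply Fintype.sum_of_injective e e.injective
    · intro k hk
      rw [Function.extend_apply' _ _ _ (by simpa using hk)]
      simp
    · intro k
      rw [e.injective.extend_apply]
      rfl
  · intro i
    have hr : i ∈ A ↔ ∃ j, e j = i := by
      have := Finset.range_orderEmbOfFin A hA
      rw [← Finset.mem_coe, ← this]; rfl
    rw [hr]
    constructor
    · intro h
      by_contra hc
      exact h (by rw [Function.extend_apply' _ _ _ hc]; rfl)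
    · rintro ⟨j, rfl⟩
      rw [e.injective.extend_apply]
      exact hnz j
end

section
/- Let d ≥ 2 and let W be an affinely positive linear map ℝ^{d+1} → ℝ^d; let x_k = W(e_k) for k = 1,…,d+1 be the images of the standard basis vectors. Then for each k ∈ {1,…,d+1}: the vertex x_k lies strictly below the affine span of the remaining points {x_j : j ≠ k} with respect to the last coordinate (i.e., there exists a point y in that affine span with y_j = (x_k)_j for all 1 ≤ j ≤ d−1 and y_d > (x_k)_d) if and only if k ≡ d (mod 2); and x_k lies strictly above that affine span (such a point y exists with y_d < (x_k)_d) if and only if k ≢ d (mod 2). (Equivalently, the upper facets of the simplex conv{x_1,…,x_{d+1}} are exactly those omitting a vertex x_k with k of the same parity as d, and the lower facets are those omitting a vertex of opposite parity.) -/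
/-- The matrix obtained from `W` by adding a first row of all ones. -/
def affExt {d n : ℕ} (W : Matrix (Fin d) (Fin n) ℝ) :
    Matrix (Fin (d + 1)) (Fin n) ℝ :=
  Matrix.of fun i j => Fin.cases (motive := fun _ => ℝ) 1 (fun i' => W i' j) i

/-- A linear map `ℝ^n → ℝ^d` (given by its matrix) is affinely positive if the
matrix obtained by adding a first row of all ones is totally positive. -/
def AffinelyPositive {d n : ℕ} (W : Matrix (Fin d) (Fin n) ℝ) : Prop :=
  TotallyPositive (affExt W)

theorem key_aux_s5 (n : ℕ) (W : Matrix (Fin (n+1)) (Fin (n+2)) ℝ) (k : Fin (n+2)) (y : Fin (n+1) → ℝ)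
    (hy : y ∈ affineSpan ℝ ((fun j => fun i => W i j) '' {j | j ≠ k}))
    (he : ∀ i : Fin (n+1), i.val + 1 < n+1 → y i = W i k) :
    (affExt W).adjugate k (Fin.last _) * (W (Fin.last n) k - y (Fin.last n)) = (affExt W).det := by
  set B := (affExt W).adjugate with hB
  have hBA : ∀ j, B k 0 + ∑ i : Fin (n+1), B k i.succ * W i j
      = if k = j then (affExt W).det else 0 := by
    intro j
    have := congrFun (congrFun (Matrix.adjugate_mul (affExt W)) k) j
    rw [Matrix.mul_apply, Fin.sum_univ_succ] at this
    have e0 : affExt W 0 j = 1 := rfl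
    have e1 : ∀ i : Fin (n+1), affExt W i.succ j = W i j := fun i => rfl
    simpa [e0, e1, ← hB, Matrix.one_apply] using this
  have hf : B k 0 + ∑ i : Fin (n+1), B k i.succ * y i = 0 := by
    refine affineSpan_induction (p := fun y => B k 0 + ∑ i : Fin (n+1), B k i.succ * y i = 0) hy ?_ ?_
    · rintro _ ⟨j, hj, rfl⟩
      have := hBA j
      rw [if_neg (fun h => hj h.symm)] at this
      exact this
    · intro c u v w hu hv hw
      have : ∑ i : Fin (n+1), B k i.succ * (c • (u -ᵥ v) +ᵥ w) i
        = c * (∑ i : Fin (n+1), B k i.succ * u i) - c * (∑ i : Fin (n+1), B k i.succ * v i)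
          + ∑ i : Fin (n+1), B k i.succ * w i := by
        rw [Finset.mul_sum, Finset.mul_sum, ← Finset.sum_sub_distrib, ← Finset.sum_add_distrib]
        refine Finset.sum_congr rfl fun i _ => ?_
        simp
        ring
      rw [this]
      linear_combination c * hu - c * hv + hw
  have h1 := hBA k
  rw [if_pos rfl] at h1
  rw [Fin.sum_univ_castSucc] at h1 hf
  have h2 : ∑ i : Fin n, B k i.castSucc.succ * y i.castSucc
      = ∑ i : Fin n, B k i.castSucc.succ * W i.castSucc k :=
    Finset.sum_congr rfl fun i _ => by rw [he _ (by simp)]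
  rw [h2] at hf
  rw [Fin.succ_last] at h1 hf
  linear_combination h1 - hf

theorem ex_aux (n : ℕ) (W : Matrix (Fin (n+1)) (Fin (n+2)) ℝ) (k : Fin (n+2))
    (hne : (affExt W).adjugate k (Fin.last _) ≠ 0) :
    ∃ y, y ∈ affineSpan ℝ ((fun j => fun i => W i j) '' {j | j ≠ k}) ∧
    (∀ i : Fin (n+1), i.val + 1 < n+1 → y i = W i k) := by
  set B := (affExt W).adjugate with hB
  set b := B k (Fin.last _) with hb
  let c : Fin (n+2) → ℝ := fun j => (if j = k then 1 else 0) - B j (Fin.last _) / b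
  have hAc : ∀ i, i ≠ Fin.last _ → ∑ j, c j * affExt W i j = affExt W i k := by
    intro i hi
    have h0 : ∑ j, affExt W i j * B j (Fin.last _) = 0 := by
      have := congrFun (congrFun (Matrix.mul_adjugate (affExt W)) i) (Fin.last _)
      rw [Matrix.mul_apply] at this
      simpa [Matrix.one_apply, hi] using this
    have : ∑ j, c j * affExt W i j
        = ∑ j, (if j = k then affExt W i j else 0) - (∑ j, affExt W i j * B j (Fin.last _)) / b := by
      rw [Finset.sum_div, ← Finset.sum_sub_distrib]
      refine Finset.sum_congr rfl fun j _ => ?_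
      simp only [c]
      split_ifs <;> ring
    rw [this, h0]
    simp
  have hc1 : ∑ j, c j = 1 := by
    have := hAc 0 (by simp [Fin.ext_iff])
    simpa [affExt] using this
  refine ⟨Finset.univ.affineCombination ℝ (fun j => fun i => W i j) c, ?_, ?_⟩
  · refine affineCombination_mem_affineSpan_image hc1 ?_ _
    intro i _ hi
    have : i = k := by simpa using hi
    subst this
    simp [c, ← hb, hne]
  · intro i hi
    rw [Finset.affineCombination_eq_linear_combination _ _ _ hc1]
    have := hAc i.succ (by simp [Fin.ext_iff]; omega)
    simpa [affExt] using this

theorem stmt_5 (d : ℕ) (hd : 2 ≤ d) (W : Matrix (Fin d) (Fin (d + 1)) ℝ)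
    (hW : AffinelyPositive W) (k : Fin (d + 1)) :
    ((∃ y, y ∈ affineSpan ℝ ((fun j => fun i => W i j) '' {j | j ≠ k}) ∧
        (∀ i : Fin d, i.val + 1 < d → y i = W i k) ∧
        W ⟨d - 1, by omega⟩ k < y ⟨d - 1, by omega⟩) ↔
      (k.val + 1) % 2 = d % 2) ∧
    ((∃ y, y ∈ affineSpan ℝ ((fun j => fun i => W i j) '' {j | j ≠ k}) ∧
        (∀ i : Fin d, i.val + 1 < d → y i = W i k) ∧
        y ⟨d - 1, by omega⟩ < W ⟨d - 1, by omega⟩ k) ↔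
      ¬((k.val + 1) % 2 = d % 2)) := by
  obtain ⟨n, rfl⟩ : ∃ n, d = n + 1 := ⟨d - 1, by omega⟩
  have hdet : 0 < (affExt W).det := by
    simpa using hW _ id id strictMono_id strictMono_id
  have hM := hW _ (Fin.succAbove (Fin.last (n+1))) k.succAbove
    (Fin.strictMono_succAbove _) (Fin.strictMono_succAbove _)
  have hadj := Matrix.adjugate_fin_succ_eq_det_submatrix (affExt W) k (Fin.last (n+1))
  have key := key_aux_s5 n W k
  have ex := ex_aux n W k
  have hl : ∀ h : n + 1 - 1 < n + 1, (⟨n + 1 - 1, h⟩ : Fin (n+1)) = Fin.last n := fun h => rfl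
  simp only [hl]
  generalize (affExt W).adjugate k (Fin.last (n+1)) = b at *
  generalize ((affExt W).submatrix (Fin.last (n+1)).succAbove k.succAbove).det = M at *
  generalize (affExt W).det = D at *
  have hb : ((k.val + 1) % 2 = (n+1) % 2 ∧ b < 0) ∨ (¬ (k.val + 1) % 2 = (n+1) % 2 ∧ 0 < b) := by
    rcases Nat.even_or_odd ((Fin.last (n+1)).val + k.val) with h | h
    · right
      rw [h.neg_one_pow] at hadj
      refine ⟨?_, by linarith⟩
      rw [Nat.even_iff, Fin.val_last] at h
      omega
    · left
      rw [h.neg_one_pow] at hadj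
      refine ⟨?_, by linarith⟩
      rw [Nat.odd_iff, Fin.val_last] at h
      omega
  obtain ⟨y, hy, he⟩ := ex (by rcases hb with h | h; exacts [h.2.ne, h.2.ne'])
  rcases hb with ⟨hp, hb⟩ | ⟨hp, hb⟩
  · have hs : ∀ y, y ∈ affineSpan ℝ ((fun j => fun i => W i j) '' {j | j ≠ k}) →
        (∀ i : Fin (n+1), i.val + 1 < n+1 → y i = W i k) →
        W (Fin.last n) k < y (Fin.last n) := by
      intro y hy he
      have := key y hy he
      by_contra! h
      nlinarith
    refine ⟨iff_of_true ⟨y, hy, he, hs y hy he⟩ hp, iff_of_false ?_ (not_not.2 hp)⟩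
    rintro ⟨z, hz, hze, h⟩
    exact lt_asymm h (hs z hz hze)
  · have hs : ∀ y, y ∈ affineSpan ℝ ((fun j => fun i => W i j) '' {j | j ≠ k}) →
        (∀ i : Fin (n+1), i.val + 1 < n+1 → y i = W i k) →
        y (Fin.last n) < W (Fin.last n) k := by
      intro y hy he
      have := key y hy he
      by_contra! h
      nlinarith
    refine ⟨iff_of_false ?_ hp, iff_of_true ⟨y, hy, he, hs y hy he⟩ hp⟩
    rintro ⟨z, hz, hze, h⟩
    exact lt_asymm h (hs z hz hze)
end

section
/- Let 1 ≤ d ≤ n and let π be an admissible linear order on the d-element subsets of [n] = {1,…,n}, with inversion set I(π). For each d-subset X of [n], define the d-face F_X of the cube [−1,1]^n by F_X = {x ∈ [−1,1]^n : for every i ∈ [n]∖X, x_i = p(i,X) if X∪{i} ∈ I(π), and x_i = −p(i,X) if X∪{i} ∉ I(π)}, where p(i,X) = (−1)^{#{a ∈ X : a < i}}. Then for every totally positive d×n real matrix T (viewed as a linear map ℝ^n → ℝ^d), the images T(F_X) over all d-subsets X of [n] tile T([−1,1]^n): their union equals T([−1,1]^n) and their interiors are pairwise disjoint. -/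
/-- Lexicographic comparison of finite sets via their increasingly sorted lists. -/
def lexLt {n : ℕ} (A B : Finset (Fin n)) : Prop :=
  List.Lex (· < ·) (A.sort (· ≤ ·)) (B.sort (· ≤ ·))

/-- A ranking function `rank` (modelling a linear order on the `d`-element subsets
of `[n]`) is admissible if every `d`-packet occurs in lexicographic order or in
reverse lexicographic order. -/
def Admissible (n d : ℕ) (rank : Finset (Fin n) → ℕ) : Prop :=
  ∀ P : Finset (Fin n), P.card = d + 1 →
    (∀ X ∈ P.powersetCard d, ∀ Y ∈ P.powersetCard d, lexLt X Y → rank X < rank Y) ∨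
    (∀ X ∈ P.powersetCard d, ∀ Y ∈ P.powersetCard d, lexLt X Y → rank Y < rank X)

/-- The inversion set: the `(d+1)`-subsets whose `d`-packet occurs in reverse
lexicographic order. -/
def InvSet (n d : ℕ) (rank : Finset (Fin n) → ℕ) : Set (Finset (Fin n)) :=
  {P | P.card = d + 1 ∧
    ∀ X ∈ P.powersetCard d, ∀ Y ∈ P.powersetCard d, lexLt X Y → rank Y < rank X}

/-- `p(i, X) = (-1) ^ #{a ∈ X : a < i}`. -/
def pSign {n : ℕ} (i : Fin n) (X : Finset (Fin n)) : ℝ :=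
  (-1) ^ (X.filter (fun a => a < i)).card

/-- The standard cube `[-1,1]^n`. -/
def cube (n : ℕ) : Set (Fin n → ℝ) := {x | ∀ k, x k ∈ Set.Icc (-1 : ℝ) 1}

/-- The `d`-face `F_X` of the cube associated to a `d`-subset `X` by the
admissible order with ranking `rank` and inversion set `InvSet n d rank`. -/
def bruhatFace (n d : ℕ) (rank : Finset (Fin n) → ℕ) (X : Finset (Fin n)) :
    Set (Fin n → ℝ) :=
  {x ∈ cube n | ∀ i ∉ X,
    (insert i X ∈ InvSet n d rank ∧ x i = pSign i X) ∨
    (insert i X ∉ InvSet n d rank ∧ x i = -pSign i X)}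

lemma pS_cases {n : ℕ} (i : Fin n) (X : Finset (Fin n)) : pSign i X = 1 ∨ pSign i X = -1 := by
  unfold pSign; exact neg_one_pow_eq_or ℝ _

lemma pS_insert {n : ℕ} (l a : Fin n) (X : Finset (Fin n)) (ha : a ∉ X) :
    pSign l (insert a X) = pSign l X * (if a < l then -1 else 1) := by
  unfold pSign
  rw [Finset.filter_insert]
  split_ifs with h
  · rw [Finset.card_insert_of_notMem (by simp [ha]), pow_succ]
  · simp

lemma pS_self {n : ℕ} (i : Fin n) (X : Finset (Fin n)) (ha : i ∉ X) :
    pSign i (insert i X) = pSign i X := by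
  rw [pS_insert _ _ _ ha]; simp

lemma pS_orderEmb {n k : ℕ} (S : Finset (Fin n)) (h : S.card = k) (j : Fin k) :
    pSign (S.orderEmbOfFin h j) S = (-1) ^ (j : ℕ) := by
  unfold pSign
  have : S.filter (fun a => a < S.orderEmbOfFin h j)
      = (Finset.univ.filter (fun a : Fin k => a < j)).map (S.orderEmbOfFin h).toEmbedding := by
    ext a
    simp only [Finset.mem_filter, Finset.mem_map, Finset.mem_univ, true_and]
    constructor
    · rintro ⟨ha, hl⟩
      have : a ∈ Set.range (S.orderEmbOfFin h) := by rw [Finset.range_orderEmbOfFin]; exact ha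
      obtain ⟨b, rfl⟩ := this
      exact ⟨b, by simpa using hl, rfl⟩
    · rintro ⟨b, hb, rfl⟩
      exact ⟨Finset.orderEmbOfFin_mem S h b, by simpa using hb⟩
  have h2 : Finset.univ.filter (fun a : Fin k => a < j) = Finset.Iio j := by ext; simp
  rw [this, Finset.card_map, h2, Fin.card_Iio]

lemma circ_exists {n d : ℕ} (T : Matrix (Fin d) (Fin n) ℝ) (hT : TotallyPositive T)
    (S : Finset (Fin n)) (hS : S.card = d + 1) :
    ∃ c : Fin n → ℝ, T.mulVec c = 0 ∧ (∀ i, i ∉ S → c i = 0) ∧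
      (∀ i ∈ S, 0 < pSign i S * c i) := by
  set s := S.orderEmbOfFin hS with hs
  let D : Fin (d+1) → ℝ := fun k => (-1) ^ (k : ℕ) * (T.submatrix id (s ∘ k.succAbove)).det
  have hval : ∀ k, (∑ j, if s j = s k then D j else 0) = D k := by
    intro k
    simp
  refine ⟨fun i => ∑ k, if s k = i then D k else 0, ?_, ?_, ?_⟩
  · ext r
    simp only [Matrix.mulVec, dotProduct, Pi.zero_apply]
    simp_rw [Finset.mul_sum]
    rw [Finset.sum_comm]
    simp only [mul_ite, mul_zero, Finset.sum_ite_eq, Finset.mem_univ, if_true]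
    let M : Matrix (Fin (d+1)) (Fin (d+1)) ℝ := fun i j => T ((Fin.cons r id : Fin (d+1) → Fin d) i) (s j)
    have h0 : M.det = 0 := by
      apply Matrix.det_zero_of_row_eq (i := 0) (j := r.succ) (Fin.succ_ne_zero r).symm
      ext j; simp [M]
    rw [Matrix.det_succ_row_zero] at h0
    rw [← h0]
    apply Finset.sum_congr rfl
    intro k _
    have : M.submatrix Fin.succ k.succAbove = T.submatrix id (s ∘ k.succAbove) := by
      ext i j; rfl
    rw [this]
    simp only [D, M, Fin.cons_zero]
    ring
  · intro i hi
    apply Finset.sum_eq_zero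
    intro k _
    rw [if_neg]
    rintro rfl
    exact hi (Finset.orderEmbOfFin_mem S hS k)
  · intro i hi
    have : i ∈ Set.range (S.orderEmbOfFin hS) := by rw [Finset.range_orderEmbOfFin]; exact hi
    obtain ⟨k, rfl⟩ := this
    have h1 := hval k
    simp only [hs] at h1 ⊢
    rw [h1, pS_orderEmb]
    simp only [D]
    rw [← mul_assoc, ← mul_pow]
    simp only [mul_neg, mul_one, neg_neg, one_pow, one_mul]
    apply hT _ _ _ strictMono_id
    exact (S.orderEmbOfFin hS).strictMono.comp (Fin.strictMono_succAbove k)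

lemma ker_small {n d : ℕ} (hdn : d ≤ n) (T : Matrix (Fin d) (Fin n) ℝ) (hT : TotallyPositive T)
    (z : Fin n → ℝ) (hz : T.mulVec z = 0) (hc : (Finset.univ.filter (fun i => z i ≠ 0)).card ≤ d) :
    z = 0 := by
  obtain ⟨S, hsub, -, hS⟩ := Finset.exists_subsuperset_card_eq
    (Finset.subset_univ (Finset.univ.filter (fun i => z i ≠ 0))) hc (by simpa using hdn)
  have hdet := hT d id (S.orderEmbOfFin hS) strictMono_id (S.orderEmbOfFin hS).strictMono
  have hoff : ∀ i, i ∉ S → z i = 0 := by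
    intro i hi
    by_contra h
    exact hi (hsub (by simp [h]))
  have h0 : (T.submatrix id (S.orderEmbOfFin hS)).mulVec (z ∘ S.orderEmbOfFin hS) = 0 := by
    ext r
    have := congrFun hz r
    simp only [Matrix.mulVec, dotProduct, Pi.zero_apply, Matrix.submatrix_apply, id,
      Function.comp] at this ⊢
    rw [← this]
    have h2 : ∑ i, T r i * z i = ∑ i ∈ S, T r i * z i := by
      symm
      apply Finset.sum_subset (Finset.subset_univ _)
      intro i _ hi
      rw [hoff i hi, mul_zero]
    rw [h2]
    conv_rhs => rw [← Finset.map_orderEmbOfFin_univ S hS]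
    rw [Finset.sum_map]
    rfl
  have h1 := Matrix.eq_zero_of_mulVec_eq_zero hdet.ne' h0
  ext i
  by_cases hi : i ∈ S
  · have : i ∈ Set.range (S.orderEmbOfFin hS) := by rw [Finset.range_orderEmbOfFin]; exact hi
    obtain ⟨k, rfl⟩ := this
    exact congrFun h1 k
  · exact hoff i hi

lemma ker_alt {n d : ℕ} (hdn : d ≤ n) (T : Matrix (Fin d) (Fin n) ℝ) (hT : TotallyPositive T)
    (m : ℕ) : ∀ z : Fin n → ℝ, T.mulVec z = 0 → z ≠ 0 →
    (Finset.univ.filter (fun i => z i ≠ 0)).card = m →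
    ∃ P : Finset (Fin n), P.card = d + 1 ∧ ∃ e : ℝ, (e = 1 ∨ e = -1) ∧
      ∀ i ∈ P, 0 < e * pSign i P * z i := by
  induction m using Nat.strong_induction_on with
  | _ m ih =>
  intro z hz hz0 hm
  have hcard : d + 1 ≤ (Finset.univ.filter (fun i => z i ≠ 0)).card := by
    by_contra h
    exact hz0 (ker_small hdn T hT z hz (by omega))
  obtain ⟨S, hsub, hS⟩ := Finset.exists_subset_card_eq hcard
  obtain ⟨c, hc, hcoff, hcS⟩ := circ_exists T hT S hS
  have hne : S.Nonempty := by rw [← Finset.card_pos]; omega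
  obtain ⟨i0, hi0, hmin⟩ := Finset.exists_min_image S (fun i => |z i / c i|) hne
  have hcn : ∀ i ∈ S, c i ≠ 0 := by
    intro i hi h
    have := hcS i hi
    rw [h] at this; simp at this
  have hzn : ∀ i ∈ S, z i ≠ 0 := by
    intro i hi
    have := hsub hi
    simpa using this
  set t := z i0 / c i0 with ht
  have ht0 : t ≠ 0 := div_ne_zero (hzn _ hi0) (hcn _ hi0)
  let z' := z - t • c
  have hz' : T.mulVec z' = 0 := by
    simp only [z']
    rw [Matrix.mulVec_sub, Matrix.mulVec_smul, hz, hc]; simp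
  by_cases h0 : z' = 0
  · refine ⟨S, hS, ?_⟩
    have hzt : ∀ i, z i = t * c i := by
      intro i
      have := congrFun h0 i
      simp [z'] at this
      linarith
    rcases lt_or_gt_of_ne ht0 with h | h
    · refine ⟨-1, Or.inr rfl, fun i hi => ?_⟩
      rw [hzt]
      have := mul_pos_of_neg_of_neg h (neg_neg_of_pos (hcS i hi))
      nlinarith
    · refine ⟨1, Or.inl rfl, fun i hi => ?_⟩
      rw [hzt]
      have := mul_pos h (hcS i hi)
      nlinarith
  · have hconf : ∀ i, z' i ≠ 0 → 0 < z i * z' i := by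
      intro i hi
      by_cases hiS : i ∈ S
      · have h1 := hmin i hiS
        have h2 : |t * c i| ≤ |z i| := by
          simp only [abs_div (z i)] at h1
          rw [abs_mul]
          have h3 : 0 < |c i| := abs_pos.mpr (hcn i hiS)
          rwa [le_div_iff₀ h3] at h1
        have h4 : z' i = z i - t * c i := by simp [z']
        rw [h4] at hi ⊢
        have h5 := abs_le.mp h2
        rcases lt_or_gt_of_ne (hzn i hiS) with h | h
        · rw [abs_of_neg h] at h5
          apply mul_pos_of_neg_of_neg h
          apply lt_of_le_of_ne _ hi
          linarith
        · rw [abs_of_pos h] at h5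
          apply mul_pos h
          apply lt_of_le_of_ne _ hi.symm
          linarith
      · have h4 : z' i = z i := by simp [z', hcoff i hiS]
        rw [h4] at hi ⊢
        exact mul_self_pos.mpr hi
    have hlt : (Finset.univ.filter (fun i => z' i ≠ 0)).card < m := by
      rw [← hm]
      apply Finset.card_lt_card
      rw [Finset.ssubset_iff_of_subset]
      · refine ⟨i0, by simpa using hzn i0 hi0, ?_⟩
        have := hcn i0 hi0
        simp [z', ht]
        field_simp
        simp
      · intro i hi
        simp only [Finset.mem_filter, Finset.mem_univ, true_and] at hi ⊢
        intro h
        have := hconf i hi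
        rw [h] at this; simp at this
    obtain ⟨P, hP, e, he, hall⟩ := ih _ hlt z' hz' h0 rfl
    refine ⟨P, hP, e, he, fun i hi => ?_⟩
    have h1 := hall i hi
    have h2 : z' i ≠ 0 := by
      intro h; rw [h] at h1; simp at h1
    have h3 := hconf i h2
    by_contra h
    push Not at h
    have h6 : 0 < (e * pSign i P * z' i) * (z i * z' i) := mul_pos h1 h3
    have h7 : (e * pSign i P * z' i) * (z i * z' i) = (e * pSign i P * z i) * (z' i * z' i) := by ring
    rw [h7] at h6
    have := mul_nonpos_of_nonpos_of_nonneg h (mul_self_nonneg (z' i))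
    linarith

lemma list_lex {n : ℕ} (a b : Fin n) (hab : a < b) (l : List (Fin n)) :
    l.Pairwise (· < ·) → a ∈ l → b ∈ l → List.Lex (· < ·) (l.erase b) (l.erase a) := by
  induction l with
  | nil => intro _ h; simp at h
  | cons h t ih =>
    intro hp ha hb
    rw [List.pairwise_cons] at hp
    by_cases h1 : h = a
    · subst h1
      have hbt : b ∈ t := by
        rcases List.mem_cons.mp hb with h2 | h2
        · exact absurd h2 hab.ne'
        · exact h2
      rw [List.erase_cons_head, List.erase_cons_tail (by simpa using hab.ne)]
      cases t with
      | nil => simp at hbt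
      | cons u v => exact List.Lex.rel (hp.1 u (by simp))
    · have hat : a ∈ t := by
        rcases List.mem_cons.mp ha with h2 | h2
        · exact absurd h2.symm h1
        · exact h2
      have hlt := hp.1 a hat
      have hhb : h ≠ b := (hlt.trans hab).ne
      have hbt : b ∈ t := by
        rcases List.mem_cons.mp hb with h2 | h2
        · exact absurd h2.symm hhb
        · exact h2
      rw [List.erase_cons_tail (by simpa using hhb), List.erase_cons_tail (by simpa using h1)]
      exact List.Lex.cons (ih hp.2 hat hbt)

lemma sort_erase_eq {n : ℕ} (P : Finset (Fin n)) (a : Fin n) :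
    (P.erase a).sort (· ≤ ·) = (P.sort (· ≤ ·)).erase a := by
  apply List.Perm.eq_of_pairwise' (r := (· ≤ ·))
  · exact Finset.pairwise_sort _ _
  · exact (Finset.pairwise_sort P (· ≤ ·)).sublist List.erase_sublist
  · rw [List.perm_ext_iff_of_nodup (Finset.sort_nodup _ _) ((Finset.sort_nodup _ _).erase _)]
    intro x
    rw [(Finset.sort_nodup _ _).mem_erase_iff]
    simp

lemma lex_erase {n : ℕ} (P : Finset (Fin n)) (a b : Fin n) (hab : a < b) (ha : a ∈ P)
    (hb : b ∈ P) : lexLt (P.erase b) (P.erase a) := by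
  unfold lexLt
  rw [sort_erase_eq, sort_erase_eq]
  apply list_lex a b hab
  · exact (Finset.sortedLT_sort P).pairwise
  · simpa using ha
  · simpa using hb

open Classical in
noncomputable def chi (n d : ℕ) (rank : Finset (Fin n) → ℕ) (P : Finset (Fin n)) : ℝ :=
  if P ∈ InvSet n d rank then 1 else -1

lemma chi_cases {n d : ℕ} (rank : Finset (Fin n) → ℕ) (P : Finset (Fin n)) :
    chi n d rank P = 1 ∨ chi n d rank P = -1 := by
  unfold chi; split_ifs <;> simp

lemma chi_ne {n d : ℕ} (rank : Finset (Fin n) → ℕ) (P Q : Finset (Fin n))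
    (h : chi n d rank P ≠ chi n d rank Q) : chi n d rank P = - chi n d rank Q := by
  rcases chi_cases (d := d) rank P with h1 | h1 <;>
  rcases chi_cases (d := d) rank Q with h2 | h2 <;> rw [h1, h2] at h ⊢
  · exact absurd rfl h
  · norm_num
  · exact absurd rfl h

lemma chi_one {n d : ℕ} (rank : Finset (Fin n) → ℕ) (P : Finset (Fin n))
    (h : chi n d rank P = 1) (a b : Fin n) (hab : a < b) (ha : a ∈ P) (hb : b ∈ P) :
    rank (P.erase a) < rank (P.erase b) := by
  unfold chi at h
  split_ifs at h with h1
  · obtain ⟨hc, h2⟩ := h1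
    refine h2 _ ?_ _ ?_ (lex_erase P a b hab ha hb)
    · rw [Finset.mem_powersetCard]
      exact ⟨Finset.erase_subset _ _, by rw [Finset.card_erase_of_mem hb, hc]; rfl⟩
    · rw [Finset.mem_powersetCard]
      exact ⟨Finset.erase_subset _ _, by rw [Finset.card_erase_of_mem ha, hc]; rfl⟩
  · norm_num at h

lemma chi_neg {n d : ℕ} (rank : Finset (Fin n) → ℕ) (hadm : Admissible n d rank)
    (P : Finset (Fin n)) (hc : P.card = d + 1)
    (h : chi n d rank P = -1) (a b : Fin n) (hab : a < b) (ha : a ∈ P) (hb : b ∈ P) :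
    rank (P.erase b) < rank (P.erase a) := by
  unfold chi at h
  split_ifs at h with h1
  · norm_num at h
  · rcases hadm P hc with h2 | h2
    · refine h2 _ ?_ _ ?_ (lex_erase P a b hab ha hb)
      · rw [Finset.mem_powersetCard]
        exact ⟨Finset.erase_subset _ _, by rw [Finset.card_erase_of_mem hb, hc]; rfl⟩
      · rw [Finset.mem_powersetCard]
        exact ⟨Finset.erase_subset _ _, by rw [Finset.card_erase_of_mem ha, hc]; rfl⟩
    · exact absurd ⟨hc, h2⟩ h1

lemma chi_consistent {n d : ℕ} (rank : Finset (Fin n) → ℕ) (hadm : Admissible n d rank)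
    (Q : Finset (Fin n)) (hQ : Q.card = d + 2) (i j k : Fin n) (hij : i < j) (hjk : j < k)
    (hi : i ∈ Q) (hj : j ∈ Q) (hk : k ∈ Q)
    (h : chi n d rank (Q.erase i) = chi n d rank (Q.erase k)) :
    chi n d rank (Q.erase j) = chi n d rank (Q.erase i) := by
  have hik := hij.trans hjk
  have hci : ∀ x ∈ Q, (Q.erase x).card = d + 1 := fun x hx => by
    rw [Finset.card_erase_of_mem hx, hQ]; rfl
  have e1 : (Q.erase j).erase i = (Q.erase i).erase j := Finset.erase_right_comm
  have e2 : (Q.erase k).erase i = (Q.erase i).erase k := Finset.erase_right_comm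
  have e3 : (Q.erase k).erase j = (Q.erase j).erase k := Finset.erase_right_comm
  have mij : j ∈ Q.erase i := by simp [hj, hij.ne']
  have mik : k ∈ Q.erase i := by simp [hk, hik.ne']
  have mji : i ∈ Q.erase j := by simp [hi, hij.ne]
  have mjk : k ∈ Q.erase j := by simp [hk, hjk.ne']
  have mki : i ∈ Q.erase k := by simp [hi, hik.ne]
  have mkj : j ∈ Q.erase k := by simp [hj, hjk.ne]
  rcases chi_cases (d := d) rank (Q.erase i) with h1 | h1 <;>
  rcases chi_cases (d := d) rank (Q.erase j) with h2 | h2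
  · rw [h1, h2]
  · exfalso
    rw [h1] at h
    have a1 := chi_one rank _ h1 j k hjk mij mik
    have a2 := chi_neg rank hadm _ (hci j hj) h2 i k hik mji mjk
    have a3 := chi_one rank _ h.symm i j hij mki mkj
    rw [e1] at a2
    rw [e2, e3] at a3
    omega
  · exfalso
    rw [h1] at h
    have a1 := chi_neg rank hadm _ (hci i hi) h1 j k hjk mij mik
    have a2 := chi_one rank _ h2 i k hik mji mjk
    have a3 := chi_neg rank hadm _ (hci k hk) h.symm i j hij mki mkj
    rw [e1] at a2
    rw [e2, e3] at a3
    omega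
  · rw [h1, h2]

lemma claimA {n d : ℕ} (rank : Finset (Fin n) → ℕ) (hadm : Admissible n d rank)
    (X : Finset (Fin n)) (hX : X.card = d) (k : ℕ) :
    ∀ P : Finset (Fin n), P.card = d + 1 → (P \ X).card = k →
    (∀ i ∈ P \ X, chi n d rank (insert i X) * pSign i X = -(chi n d rank P * pSign i P)) →
    False := by
  induction k with
  | zero =>
    intro P hP hk _
    have := Finset.card_le_card_sdiff_add_card (s := P) (t := X)
    omega
  | succ k ih =>
    intro P hP hk h
    by_cases hk0 : k = 0
    · subst hk0
      obtain ⟨i, hi⟩ := Finset.card_eq_one.mp hk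
      have hiP : i ∈ P \ X := by rw [hi]; simp
      have hiX := (Finset.mem_sdiff.mp hiP).2
      have hPX : P = insert i X := by
        apply Finset.eq_of_subset_of_card_le
        · intro l hl
          by_cases hlX : l ∈ X
          · simp [hlX]
          · have : l ∈ P \ X := by simp [hl, hlX]
            rw [hi] at this
            simp at this
            simp [this]
        · rw [Finset.card_insert_of_notMem hiX]; omega
      have h1 := h i hiP
      rw [hPX, pS_self _ _ hiX] at h1
      rcases chi_cases (d := d) rank (insert i X) with h2 | h2 <;>
      rcases pS_cases i X with h3 | h3 <;> rw [h2, h3] at h1 <;> norm_num at h1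
    · have hXP : (X \ P).Nonempty := by
        rw [← Finset.card_pos]
        have h1 := Finset.card_sdiff_add_card_inter P X
        have h2 := Finset.card_sdiff_add_card_inter X P
        rw [Finset.inter_comm] at h2
        omega
      obtain ⟨a, ha⟩ := hXP
      obtain ⟨haX, haP⟩ := Finset.mem_sdiff.mp ha
      set Q := insert a P with hQdef
      have hQ : Q.card = d + 2 := by rw [Finset.card_insert_of_notMem haP]; omega
      have hQa : Q.erase a = P := Finset.erase_insert haP
      have step : ∀ i ∈ P \ X, (∀ l ∈ P \ X, l ≠ i → chi n d rank P =
          chi n d rank (Q.erase i) * (if i < l then -1 else 1) * (if a < l then -1 else 1)) →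
          False := by
        intro i hi hl
        obtain ⟨hiP, hiX⟩ := Finset.mem_sdiff.mp hi
        have hai : a ≠ i := by rintro rfl; exact haP hiP
        have hdiff : (Q.erase i) \ X = (P \ X).erase i := by
          ext l
          simp only [hQdef, Finset.mem_sdiff, Finset.mem_erase, Finset.mem_insert]
          constructor
          · rintro ⟨⟨h1, h2 | h2⟩, h3⟩
            · subst h2; exact absurd haX h3
            · exact ⟨h1, h2, h3⟩
          · rintro ⟨h1, h2, h3⟩; exact ⟨⟨h1, Or.inr h2⟩, h3⟩
        apply ih (Q.erase i)
        · rw [Finset.card_erase_of_mem (by simp [hQdef, hiP]), hQ]; rfl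
        · rw [hdiff, Finset.card_erase_of_mem hi, hk]; rfl
        · intro l hlm
          rw [hdiff, Finset.mem_erase] at hlm
          have h1 := h l hlm.2
          have h2 := hl l hlm.2 hlm.1
          rw [h1, h2]
          have h3 : pSign l Q = pSign l (Q.erase i) * (if i < l then -1 else 1) := by
            rw [← pS_insert l i (Q.erase i) (by simp), Finset.insert_erase (by simp [hQdef, hiP])]
          have h4 : pSign l Q = pSign l P * (if a < l then -1 else 1) := pS_insert l a P haP
          rw [h3] at h4
          have h5 : pSign l P = pSign l (Q.erase i) * (if i < l then -1 else 1) * (if a < l then -1 else 1) := by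
            rw [h4]; split_ifs <;> ring
          rw [h5]
          split_ifs <;> ring
      have hMne : (P \ X).Nonempty := by rw [← Finset.card_pos]; omega
      have haQ : a ∈ Q := by simp [hQdef]
      have hMQ : ∀ l ∈ P \ X, l ∈ Q := fun l hl => by
        simp [hQdef, (Finset.mem_sdiff.mp hl).1]
      have hMa : ∀ l ∈ P \ X, l ≠ a := by
        rintro l hl rfl
        exact haP (Finset.mem_sdiff.mp hl).1
      have h2card : 1 < (P \ X).card := by omega
      by_cases hlow : ((P \ X).filter (fun l => l < a)).Nonempty
      · by_cases hup : ((P \ X).filter (fun l => a < l)).Nonempty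
        · -- both sides
          obtain ⟨i, hi, himax⟩ := Finset.exists_max_image _ id hlow
          obtain ⟨j, hj, hjmin⟩ := Finset.exists_min_image _ id hup
          simp only [Finset.mem_filter, id] at hi hj hjmin himax
          by_cases hci : chi n d rank (Q.erase i) = chi n d rank P
          · refine step i hi.1 fun l hl hli => ?_
            rw [hci]
            by_cases hla : a < l
            · rw [if_pos hla, if_pos (hi.2.trans hla)]; ring
            · have : l < a := lt_of_le_of_ne (not_lt.mp hla) (hMa l hl)
              have := himax l ⟨hl, this⟩
              rw [if_neg hla, if_neg (not_lt.mpr this)]; ring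
          · by_cases hcj : chi n d rank (Q.erase j) = chi n d rank P
            · refine step j hj.1 fun l hl hli => ?_
              rw [hcj]
              by_cases hla : a < l
              · have := hjmin l ⟨hl, hla⟩
                rw [if_pos hla, if_pos (lt_of_le_of_ne this hli.symm)]; ring
              · have : l < a := lt_of_le_of_ne (not_lt.mp hla) (hMa l hl)
                rw [if_neg hla, if_neg (this.trans hj.2).asymm]; ring
            · have := chi_consistent rank hadm Q hQ i a j hi.2 hj.2 (hMQ i hi.1) haQ (hMQ j hj.1) (by
                rw [chi_ne rank _ _ hci, chi_ne rank _ _ hcj])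
              rw [hQa] at this
              exact hci this.symm
        · -- all below
          have hall : ∀ l ∈ P \ X, l < a := by
            intro l hl
            by_contra h'
            exact hup ⟨l, by
              simp only [Finset.mem_filter]
              exact ⟨hl, lt_of_le_of_ne (not_lt.mp h') (hMa l hl).symm⟩⟩
          obtain ⟨i, hi, hmin⟩ := Finset.exists_min_image _ id hMne
          obtain ⟨j, hj, hmax⟩ := Finset.exists_max_image _ id hMne
          simp only [id] at hmin hmax
          have hij : i < j := by
            obtain ⟨x, hx, y, hy, hxy⟩ := Finset.one_lt_card.mp h2card
            rcases lt_or_gt_of_ne hxy with h' | h'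
            · exact (hmin x hx).trans_lt (h'.trans_le (hmax y hy))
            · exact (hmin y hy).trans_lt (h'.trans_le (hmax x hx))
          by_cases hcj : chi n d rank (Q.erase j) = chi n d rank P
          · refine step j hj fun l hl hli => ?_
            rw [hcj, if_neg (not_lt.mpr (hmax l hl)), if_neg (hall l hl).asymm]; ring
          · refine step i hi fun l hl hli => ?_
            rw [if_pos (lt_of_le_of_ne (hmin l hl) hli.symm), if_neg (hall l hl).asymm]
            have hc := chi_consistent rank hadm Q hQ i j a hij (hall j hj) (hMQ i hi) (hMQ j hj) haQ
            rw [hQa] at hc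
            have hne : chi n d rank P ≠ chi n d rank (Q.erase i) :=
              fun h' => hcj ((hc h'.symm).trans h'.symm)
            rw [chi_ne rank _ _ hne]; ring
      · have hall : ∀ l ∈ P \ X, a < l := by
          intro l hl
          by_contra h'
          exact hlow ⟨l, by
            simp only [Finset.mem_filter]
            exact ⟨hl, lt_of_le_of_ne (not_lt.mp h') (hMa l hl)⟩⟩
        obtain ⟨i, hi, hmin⟩ := Finset.exists_min_image _ id hMne
        obtain ⟨j, hj, hmax⟩ := Finset.exists_max_image _ id hMne
        simp only [id] at hmin hmax
        have hij : i < j := by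
          obtain ⟨x, hx, y, hy, hxy⟩ := Finset.one_lt_card.mp h2card
          rcases lt_or_gt_of_ne hxy with h' | h'
          · exact (hmin x hx).trans_lt (h'.trans_le (hmax y hy))
          · exact (hmin y hy).trans_lt (h'.trans_le (hmax x hx))
        by_cases hci : chi n d rank (Q.erase i) = chi n d rank P
        · refine step i hi fun l hl hli => ?_
          rw [hci, if_pos (lt_of_le_of_ne (hmin l hl) hli.symm), if_pos (hall l hl)]; ring
        · refine step j hj fun l hl hli => ?_
          rw [if_neg (not_lt.mpr (hmax l hl)), if_pos (hall l hl)]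
          have hc := chi_consistent rank hadm Q hQ a i j (hall i hi) hij haQ (hMQ i hi) (hMQ j hj)
          rw [hQa] at hc
          have hne : chi n d rank P ≠ chi n d rank (Q.erase j) :=
            fun h' => hci (hc h')
          rw [chi_ne rank _ _ hne]; ring

lemma face_val {n d : ℕ} (rank : Finset (Fin n) → ℕ) (X : Finset (Fin n)) (x : Fin n → ℝ) :
    x ∈ bruhatFace n d rank X ↔
      x ∈ cube n ∧ ∀ i, i ∉ X → x i = chi n d rank (insert i X) * pSign i X := by
  unfold bruhatFace
  simp only [Set.mem_ofPred_eq]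
  refine and_congr_right fun _ => forall_congr' fun i => forall_congr' fun _ => ?_
  unfold chi
  split_ifs with h <;> simp [h]

lemma face_hit {n d : ℕ} (rank : Finset (Fin n) → ℕ) (hadm : Admissible n d rank)
    (X : Finset (Fin n)) (hX : X.card = d) (P : Finset (Fin n)) (hP : P.card = d + 1)
    (x : Fin n → ℝ) (hx : x ∈ bruhatFace n d rank X) :
    ∃ i ∈ P, x i = chi n d rank P * pSign i P := by
  by_contra hcon
  push Not at hcon
  rw [face_val] at hx
  apply claimA rank hadm X hX _ P hP rfl
  intro i hi
  obtain ⟨hiP, hiX⟩ := Finset.mem_sdiff.mp hi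
  have h1 := hcon i hiP
  rw [hx.2 i hiX] at h1
  rcases chi_cases (d := d) rank (insert i X) with h2 | h2 <;>
  rcases pS_cases i X with h3 | h3 <;>
  rcases chi_cases (d := d) rank P with h4 | h4 <;>
  rcases pS_cases i P with h5 | h5 <;> rw [h2, h3, h4, h5] at h1 ⊢ <;> first | (norm_num; done) | (exfalso; apply h1; norm_num)

lemma face_inj {n d : ℕ} (hdn : d ≤ n) (rank : Finset (Fin n) → ℕ) (hadm : Admissible n d rank)
    (T : Matrix (Fin d) (Fin n) ℝ) (hT : TotallyPositive T)
    (X Y : Finset (Fin n)) (hX : X.card = d) (hY : Y.card = d)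
    (x y : Fin n → ℝ) (hx : x ∈ bruhatFace n d rank X) (hy : y ∈ bruhatFace n d rank Y)
    (h : T.mulVec x = T.mulVec y) : x = y := by
  by_contra hne
  obtain ⟨P, hP, e, he, hall⟩ := ker_alt hdn T hT _ (x - y)
    (by rw [Matrix.mulVec_sub, h, sub_self]) (sub_ne_zero.mpr hne) rfl
  obtain ⟨i, hi, hxi⟩ := face_hit rank hadm X hX P hP x hx
  obtain ⟨j, hj, hyj⟩ := face_hit rank hadm Y hY P hP y hy
  have h1 := hall i hi
  have h2 := hall j hj
  have b1 := hy.1 i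
  have b2 := hx.1 j
  simp only [Pi.sub_apply, Set.mem_Icc] at h1 h2 b1 b2
  rw [hxi] at h1
  rw [hyj] at h2
  rcases chi_cases (d := d) rank P with h4 | h4 <;> rcases he with rfl | rfl <;>
  rcases pS_cases i P with h5 | h5 <;> rcases pS_cases j P with h6 | h6 <;>
  rw [h4, h5] at h1 <;> rw [h4, h6] at h2 <;> linarith

def degen (n d : ℕ) : Set (Fin n → ℝ) :=
  {x | x ∈ cube n ∧ (Finset.univ.filter (fun i => x i ≠ 1 ∧ x i ≠ -1)).card < d}

def gface {n : ℕ} (s : Fin n → ℝ) (X : Finset (Fin n)) : Set (Fin n → ℝ) :=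
  {x | x ∈ cube n ∧ ∀ i, i ∉ X → x i = s i}

lemma cube_pi (n : ℕ) : cube n = Set.pi Set.univ (fun _ => Set.Icc (-1 : ℝ) 1) := by
  ext x; simp only [cube, Set.mem_ofPred_eq, Set.mem_pi, Set.mem_univ, true_imp_iff]

lemma cube_compact (n : ℕ) : IsCompact (cube n) := by
  rw [cube_pi]; exact isCompact_univ_pi fun _ => isCompact_Icc

lemma gface_compact {n : ℕ} (s : Fin n → ℝ) (X : Finset (Fin n)) : IsCompact (gface s X) := by
  have : gface s X = cube n ∩ ⋂ i, ⋂ (_ : i ∉ X), {x : Fin n → ℝ | x i = s i} := by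
    ext x; simp [gface]
  rw [this]
  apply (cube_compact n).inter_right
  exact isClosed_iInter fun i => isClosed_iInter fun _ =>
    isClosed_eq (continuous_apply i) continuous_const

lemma mulVec_cont {n d : ℕ} (T : Matrix (Fin d) (Fin n) ℝ) : Continuous T.mulVec :=
  Continuous.matrix_mulVec continuous_const continuous_id

lemma degen_null {n d : ℕ} (T : Matrix (Fin d) (Fin n) ℝ) :
    MeasureTheory.volume (T.mulVec '' degen n d) = 0 := by
  classical
  let W : Finset (Fin n) → Submodule ℝ (Fin d → ℝ) := fun S =>
    Submodule.span ℝ ((S.image (fun i => (fun r => T r i : Fin d → ℝ)) : Finset (Fin d → ℝ)) : Set (Fin d → ℝ))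
  let v : (Fin n → Bool) → (Fin n → ℝ) := fun e i => if e i then 1 else -1
  have hsub : T.mulVec '' degen n d ⊆ ⋃ S : {S : Finset (Fin n) // S.card < d}, ⋃ e : Fin n → Bool,
      (fun y => T.mulVec (v e) + y) '' (W S.1 : Set (Fin d → ℝ)) := by
    rintro _ ⟨x, ⟨hx, hc⟩, rfl⟩
    rw [Set.mem_iUnion]
    refine ⟨⟨_, hc⟩, ?_⟩
    rw [Set.mem_iUnion]
    refine ⟨fun i => decide (x i = 1), T.mulVec (x - v fun i => decide (x i = 1)), ?_, ?_⟩
    · have : T.mulVec (x - v fun i => decide (x i = 1)) =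
          ∑ i, (x - v fun i => decide (x i = 1)) i • (fun r => T r i : Fin d → ℝ) := by
        ext r
        simp [Matrix.mulVec, dotProduct, mul_comm]
      rw [this]
      apply Submodule.sum_mem
      intro i _
      by_cases hi : x i ≠ 1 ∧ x i ≠ -1
      · apply Submodule.smul_mem
        apply Submodule.subset_span
        rw [Finset.mem_coe, Finset.mem_image]
        exact ⟨i, by simpa using hi, rfl⟩
      · have : (x - v fun i => decide (x i = 1)) i = 0 := by
          simp only [Pi.sub_apply, v]
          by_cases h1 : x i = 1
          · simp [h1]
          · have h2 : x i = -1 := by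
              by_contra h2
              exact hi ⟨h1, h2⟩
            simp [h2]; norm_num
        rw [this, zero_smul]
        exact Submodule.zero_mem _
    · simp [Matrix.mulVec_sub]
  apply MeasureTheory.measure_mono_null hsub
  rw [MeasureTheory.measure_iUnion_null_iff]
  intro S
  rw [MeasureTheory.measure_iUnion_null_iff]
  intro e
  rw [Set.image_add_left, MeasureTheory.measure_preimage_add]
  apply MeasureTheory.Measure.addHaar_submodule
  intro htop
  have h1 := finrank_span_finset_le_card (R := ℝ) (S.1.image (fun i => (fun r => T r i : Fin d → ℝ)))
  have h2 : Set.finrank ℝ ((S.1.image (fun i => (fun r => T r i : Fin d → ℝ)) : Finset (Fin d → ℝ)) : Set (Fin d → ℝ)) = d := by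
    unfold Set.finrank
    have : Submodule.span ℝ ((S.1.image (fun i => (fun r => T r i : Fin d → ℝ)) : Finset (Fin d → ℝ)) : Set (Fin d → ℝ)) = ⊤ := htop
    rw [this]
    simp
  rw [h2] at h1
  have h3 := h1.trans Finset.card_image_le
  have := S.2
  omega

lemma vol_gface {n d : ℕ} (T : Matrix (Fin d) (Fin n) ℝ) (s : Fin n → ℝ) (X : Finset (Fin n))
    (hs : ∀ i, s i ∈ Set.Icc (-1 : ℝ) 1) :
    MeasureTheory.volume (T.mulVec '' gface s X) = MeasureTheory.volume (T.mulVec '' gface 0 X) := by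
  classical
  let u : Fin n → ℝ := fun i => if i ∈ X then 0 else s i
  have : T.mulVec '' gface s X = (fun y => T.mulVec u + y) '' (T.mulVec '' gface 0 X) := by
    ext y
    constructor
    · rintro ⟨x, ⟨hx, hx2⟩, rfl⟩
      refine ⟨_, ⟨x - u, ⟨?_, ?_⟩, rfl⟩, ?_⟩
      · intro i
        by_cases hi : i ∈ X
        · simpa [u, hi] using hx i
        · simp [u, hi, hx2 i hi]
      · intro i hi
        simp [u, hi, hx2 i hi]
      · simp [Matrix.mulVec_sub]
    · rintro ⟨_, ⟨x, ⟨hx, hx2⟩, rfl⟩, rfl⟩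
      refine ⟨u + x, ⟨?_, ?_⟩, ?_⟩
      · intro i
        by_cases hi : i ∈ X
        · simpa [u, hi] using hx i
        · simpa [u, hi, hx2 i hi] using hs i
      · intro i hi
        simp [u, hi, hx2 i hi]
      · simp [Matrix.mulVec_add]
  rw [this, Set.image_add_left, MeasureTheory.measure_preimage_add]

lemma move {n : ℕ} (x c : Fin n → ℝ) (hx : x ∈ cube n)
    (h1 : ∀ i, -1 < x i ∨ 0 ≤ c i) (h2 : ∀ i, x i < 1 ∨ c i ≤ 0) :
    ∃ t : ℝ, 0 < t ∧ x + t • c ∈ cube n := by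
  have key : ∀ᶠ t : ℝ in nhdsWithin 0 (Set.Ioi 0), ∀ i, x i + t * c i ∈ Set.Icc (-1 : ℝ) 1 := by
    rw [Filter.eventually_all]
    intro i
    have hc : Filter.Tendsto (fun t : ℝ => x i + t * c i) (nhdsWithin 0 (Set.Ioi 0)) (nhds (x i)) := by
      have : Continuous (fun t : ℝ => x i + t * c i) := by fun_prop
      have h := this.tendsto 0
      simp only [zero_mul, add_zero] at h
      exact h.mono_left nhdsWithin_le_nhds
    have hpos : ∀ᶠ t : ℝ in nhdsWithin 0 (Set.Ioi 0), 0 < t := self_mem_nhdsWithin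
    have a1 : ∀ᶠ t : ℝ in nhdsWithin 0 (Set.Ioi 0), -1 ≤ x i + t * c i := by
      rcases h1 i with h | h
      · filter_upwards [hc.eventually (lt_mem_nhds h)] with t ht using ht.le
      · filter_upwards [hpos] with t ht
        have := (hx i).1
        have := mul_nonneg ht.le h
        linarith
    have a2 : ∀ᶠ t : ℝ in nhdsWithin 0 (Set.Ioi 0), x i + t * c i ≤ 1 := by
      rcases h2 i with h | h
      · filter_upwards [hc.eventually (gt_mem_nhds h)] with t ht using ht.le
      · filter_upwards [hpos] with t ht
        have := (hx i).2
        have := mul_nonpos_of_nonneg_of_nonpos ht.le h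
        linarith
    filter_upwards [a1, a2] with t b1 b2 using ⟨b1, b2⟩
  have hpos : ∀ᶠ t : ℝ in nhdsWithin 0 (Set.Ioi 0), 0 < t := self_mem_nhdsWithin
  obtain ⟨t, ht, ht2⟩ := (hpos.and key).exists
  exact ⟨t, ht, fun i => by simpa using ht2 i⟩

lemma lp_cover {n d : ℕ} (T : Matrix (Fin d) (Fin n) ℝ) (hT : TotallyPositive T) :
    ∃ s : Finset (Fin n) → Fin n → ℝ, (∀ X i, s X i ∈ Set.Icc (-1 : ℝ) 1) ∧
      ∀ x ∈ cube n, ∃ x', T.mulVec x' = T.mulVec x ∧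
        (x' ∈ degen n d ∨ ∃ X : Finset (Fin n), X.card = d ∧ x' ∈ gface (s X) X) := by
  classical
  have hC : ∀ S : {S : Finset (Fin n) // S.card = d + 1}, ∃ c : Fin n → ℝ, T.mulVec c = 0 ∧
      (∀ i, i ∉ S.1 → c i = 0) ∧ (∀ i ∈ S.1, 0 < pSign i S.1 * c i) :=
    fun S => circ_exists T hT S.1 S.2
  choose c hc0 hcoff hcS using hC
  have hcn : ∀ S, ∀ i ∈ S.1, c S i ≠ 0 := by
    intro S i hi h
    have := hcS S i hi
    rw [h] at this; simp at this
  obtain ⟨w, hw⟩ : ∃ w : Fin n → ℝ, ∀ S, w ⬝ᵥ c S ≠ 0 := by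
    by_contra hcon
    push Not at hcon
    let p : {S : Finset (Fin n) // S.card = d + 1} → Subspace ℝ (Fin n → ℝ) := fun S =>
      { carrier := {w | w ⬝ᵥ c S = 0}
        add_mem' := by
          intro a b ha hb
          simp only [Set.mem_ofPred_eq] at ha hb ⊢
          rw [add_dotProduct, ha, hb, add_zero]
        zero_mem' := by simp
        smul_mem' := by
          intro r a ha
          simp only [Set.mem_ofPred_eq] at ha ⊢
          rw [smul_dotProduct, ha, smul_zero] }
    have hp : ∀ S w, w ∈ p S ↔ w ⬝ᵥ c S = 0 := by
      intro S w
      exact Iff.rfl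
    obtain ⟨S, hS⟩ := Subspace.exists_eq_top_of_iUnion_eq_univ (p := p) (by
      rw [Set.eq_univ_iff_forall]
      intro w
      obtain ⟨S, hS⟩ := hcon w
      rw [Set.mem_iUnion]
      exact ⟨S, (hp S w).2 hS⟩)
    have hne : S.1.Nonempty := by rw [← Finset.card_pos, S.2]; omega
    obtain ⟨i, hi⟩ := hne
    have : Pi.single i (1 : ℝ) ∈ p S := by rw [hS]; trivial
    rw [hp] at this
    simp at this
    exact hcn S i hi this
  let s : Finset (Fin n) → Fin n → ℝ := fun X i =>
    if h : (insert i X).card = d + 1 then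
      if 0 < (w ⬝ᵥ c ⟨insert i X, h⟩) * c ⟨insert i X, h⟩ i then -1 else 1
    else 1
  refine ⟨s, ?_, ?_⟩
  · intro X i
    simp only [s]
    split_ifs <;> norm_num
  intro x hx
  have hcomp : IsCompact (cube n ∩ {y | T.mulVec y = T.mulVec x}) :=
    (cube_compact n).inter_right (isClosed_eq (mulVec_cont T) continuous_const)
  obtain ⟨x', ⟨hx', hTx'⟩, hmin⟩ := hcomp.exists_isMinOn ⟨x, hx, rfl⟩
    (f := fun y => w ⬝ᵥ y) (by
      apply Continuous.continuousOn
      simp only [dotProduct]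
      fun_prop)
  refine ⟨x', hTx', ?_⟩
  -- no improving direction
  have noimp : ∀ S, ∀ r : ℝ, r * (w ⬝ᵥ c S) < 0 →
      (∀ i, -1 < x' i ∨ 0 ≤ r * c S i) → (∀ i, x' i < 1 ∨ r * c S i ≤ 0) → False := by
    intro S r hr h1 h2
    obtain ⟨t, ht, htm⟩ := move x' (r • c S) hx' (by simpa using h1) (by simpa using h2)
    have h3 := hmin ⟨htm, by
      show T.mulVec _ = _
      rw [Matrix.mulVec_add, Matrix.mulVec_smul, Matrix.mulVec_smul, hc0]
      simpa using hTx'⟩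
    simp only [Set.mem_ofPred_eq, dotProduct_add, dotProduct_smul, smul_eq_mul] at h3
    have := mul_neg_of_pos_of_neg ht hr
    linarith
  set X := Finset.univ.filter (fun i => x' i ≠ 1 ∧ x' i ≠ -1) with hXdef
  have hfree : ∀ i ∈ X, -1 < x' i ∧ x' i < 1 := by
    intro i hi
    simp only [hXdef, Finset.mem_filter, Finset.mem_univ, true_and] at hi
    have := hx' i
    exact ⟨lt_of_le_of_ne this.1 (Ne.symm hi.2), lt_of_le_of_ne this.2 hi.1⟩
  rcases lt_trichotomy X.card d with hlt | heq | hgt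
  · left
    exact ⟨hx', hlt⟩
  · right
    refine ⟨X, heq, hx', ?_⟩
    intro i hi
    have hcard : (insert i X).card = d + 1 := by rw [Finset.card_insert_of_notMem hi, heq]
    have hval : x' i = 1 ∨ x' i = -1 := by
      by_contra h
      push Not at h
      exact hi (by simp [hXdef, h])
    simp only [s, dif_pos hcard]
    set S : {S : Finset (Fin n) // S.card = d + 1} := ⟨insert i X, hcard⟩ with hS
    have hother : ∀ l, l ≠ i → l ∉ X → c S l = 0 := by
      intro l h1 h2
      apply hcoff
      simp [hS, h1, h2]
    have hci := hcn S i (by simp [hS])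
    have hwS := hw S
    split_ifs with hpos
    · rcases hval with h | h
      · exfalso
        apply noimp S (-(w ⬝ᵥ c S))
        · nlinarith [mul_self_pos.mpr hwS]
        · intro l
          by_cases hli : l = i
          · subst hli; left; rw [h]; norm_num
          · by_cases hlX : l ∈ X
            · exact Or.inl (hfree l hlX).1
            · right; rw [hother l hli hlX]; simp
        · intro l
          by_cases hli : l = i
          · subst hli; right; linarith
          · by_cases hlX : l ∈ X
            · exact Or.inl (hfree l hlX).2
            · right; rw [hother l hli hlX]; simp
      · exact h
    · rcases hval with h | h
      · exact h
      · exfalso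
        push Not at hpos
        apply noimp S (-(w ⬝ᵥ c S))
        · nlinarith [mul_self_pos.mpr hwS]
        · intro l
          by_cases hli : l = i
          · subst hli; right; linarith
          · by_cases hlX : l ∈ X
            · exact Or.inl (hfree l hlX).1
            · right; rw [hother l hli hlX]; simp
        · intro l
          by_cases hli : l = i
          · subst hli; left; rw [h]; norm_num
          · by_cases hlX : l ∈ X
            · exact Or.inl (hfree l hlX).2
            · right; rw [hother l hli hlX]; simp
  · exfalso
    obtain ⟨S, hSX, hS⟩ := Finset.exists_subset_card_eq (show d + 1 ≤ X.card by omega)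
    have hwS := hw ⟨S, hS⟩
    apply noimp ⟨S, hS⟩ (-(w ⬝ᵥ c ⟨S, hS⟩))
    · nlinarith [mul_self_pos.mpr hwS]
    · intro l
      by_cases hlX : l ∈ S
      · exact Or.inl (hfree l (hSX hlX)).1
      · right; rw [hcoff ⟨S, hS⟩ l hlX]; simp
    · intro l
      by_cases hlX : l ∈ S
      · exact Or.inl (hfree l (hSX hlX)).2
      · right; rw [hcoff ⟨S, hS⟩ l hlX]; simp

lemma mulVec_surj {n d : ℕ} (hdn : d ≤ n) (T : Matrix (Fin d) (Fin n) ℝ) (hT : TotallyPositive T) :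
    Function.Surjective T.mulVecLin := by
  obtain ⟨S, -, hS⟩ := Finset.exists_subset_card_eq
    (show d ≤ (Finset.univ : Finset (Fin n)).card by simpa using hdn)
  have hdet := hT d id (S.orderEmbOfFin hS) strictMono_id (S.orderEmbOfFin hS).strictMono
  intro y
  set A := T.submatrix id (S.orderEmbOfFin hS) with hA
  have hu : IsUnit A.det := isUnit_iff_ne_zero.mpr hdet.ne'
  let u := A⁻¹.mulVec y
  have hu2 : A.mulVec u = y := by
    simp only [u]
    rw [Matrix.mulVec_mulVec, Matrix.mul_nonsing_inv _ hu, Matrix.one_mulVec]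
  refine ⟨fun i => ∑ k, if S.orderEmbOfFin hS k = i then u k else 0, ?_⟩
  rw [← hu2]
  ext r
  simp only [Matrix.mulVecLin_apply, Matrix.mulVec, dotProduct, Finset.mul_sum]
  rw [Finset.sum_comm]
  simp [hA]

lemma face_gface {n d : ℕ} (rank : Finset (Fin n) → ℕ) (X : Finset (Fin n)) :
    bruhatFace n d rank X = gface (fun i => chi n d rank (insert i X) * pSign i X) X := by
  ext x; rw [face_val]; rfl

lemma inter_degen {n d : ℕ} (hdn : d ≤ n) (rank : Finset (Fin n) → ℕ) (hadm : Admissible n d rank)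
    (T : Matrix (Fin d) (Fin n) ℝ) (hT : TotallyPositive T)
    (X Y : Finset (Fin n)) (hX : X.card = d) (hY : Y.card = d) (hne : X ≠ Y) :
    T.mulVec '' bruhatFace n d rank X ∩ T.mulVec '' bruhatFace n d rank Y
      ⊆ T.mulVec '' degen n d := by
  rintro _ ⟨⟨x, hx, rfl⟩, ⟨y, hy, hxy⟩⟩
  have := face_inj hdn rank hadm T hT X Y hX hY x y hx hy hxy.symm
  subst this
  refine ⟨x, ⟨hx.1, ?_⟩, rfl⟩
  have hpm : ∀ Z : Finset (Fin n), x ∈ bruhatFace n d rank Z → ∀ i, i ∉ Z → x i = 1 ∨ x i = -1 := by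
    intro Z hZ i hi
    rw [face_val] at hZ
    rw [hZ.2 i hi]
    rcases chi_cases (d := d) rank (insert i Z) with h1 | h1 <;>
    rcases pS_cases i Z with h2 | h2 <;> rw [h1, h2] <;> norm_num
  have hsub : Finset.univ.filter (fun i => x i ≠ 1 ∧ x i ≠ -1) ⊆ X ∩ Y := by
    intro i hi
    simp only [Finset.mem_filter, Finset.mem_univ, true_and] at hi
    rw [Finset.mem_inter]
    constructor
    · by_contra h
      rcases hpm X hx i h with h | h
      · exact hi.1 h
      · exact hi.2 h
    · by_contra h
      rcases hpm Y hy i h with h | h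
      · exact hi.1 h
      · exact hi.2 h
  refine (Finset.card_le_card hsub).trans_lt ?_
  rw [← hX]
  apply Finset.card_lt_card
  rw [Finset.ssubset_iff_subset_ne]
  refine ⟨Finset.inter_subset_left, fun h => hne ?_⟩
  exact Finset.eq_of_subset_of_card_le (Finset.inter_eq_left.mp h) (by omega)

theorem stmt_8 (n d : ℕ) (hd : 1 ≤ d) (hdn : d ≤ n)
    (rank : Finset (Fin n) → ℕ)
    (hinj : ∀ A B : Finset (Fin n), A.card = d → B.card = d →
      rank A = rank B → A = B)
    (hadm : Admissible n d rank)
    (T : Matrix (Fin d) (Fin n) ℝ) (hT : TotallyPositive T) :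
    (⋃ X ∈ {X : Finset (Fin n) | X.card = d},
      T.mulVec '' bruhatFace n d rank X) = T.mulVec '' cube n ∧
    ∀ X Y : Finset (Fin n), X.card = d → Y.card = d → X ≠ Y →
      interior (T.mulVec '' bruhatFace n d rank X) ∩
        interior (T.mulVec '' bruhatFace n d rank Y) = ∅ := by
  classical
  have hnull := degen_null (n := n) T
  have hint := inter_degen hdn rank hadm T hT
  have hcompF : ∀ X, IsCompact (T.mulVec '' bruhatFace n d rank X) := fun X => by
    rw [face_gface]; exact (gface_compact _ _).image (mulVec_cont T)
  constructor
  · have hU : (⋃ X ∈ {X : Finset (Fin n) | X.card = d}, T.mulVec '' bruhatFace n d rank X)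
        = ⋃ X ∈ (Finset.univ : Finset (Fin n)).powersetCard d, T.mulVec '' bruhatFace n d rank X := by
      ext y; simp [Finset.mem_powersetCard]
    rw [hU]
    set I := (Finset.univ : Finset (Fin n)).powersetCard d with hI
    have hIc : ∀ X ∈ I, X.card = d := fun X hX => (Finset.mem_powersetCard.mp hX).2
    set U := ⋃ X ∈ I, T.mulVec '' bruhatFace n d rank X with hUdef
    have hUcomp : IsCompact U := I.isCompact_biUnion fun X _ => hcompF X
    have hsub : U ⊆ T.mulVec '' cube n := by
      apply Set.iUnion₂_subset
      intro X _
      exact Set.image_mono fun x hx => hx.1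
    apply Set.Subset.antisymm hsub
    have hUvol : MeasureTheory.volume U
        = ∑ X ∈ I, MeasureTheory.volume (T.mulVec '' bruhatFace n d rank X) := by
      apply MeasureTheory.measure_biUnion_finset₀
      · intro X hX Y hY hXY
        exact MeasureTheory.measure_mono_null (hint X Y (hIc X hX) (hIc Y hY) hXY) hnull
      · intro X _
        exact (hcompF X).measurableSet.nullMeasurableSet
    obtain ⟨s, hs, hcov⟩ := lp_cover T hT
    have hZ : MeasureTheory.volume (T.mulVec '' cube n) ≤ MeasureTheory.volume U := by
      have h1 : T.mulVec '' cube n ⊆ (T.mulVec '' degen n d) ∪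
          ⋃ X ∈ I, T.mulVec '' gface (s X) X := by
        rintro _ ⟨x, hx, rfl⟩
        obtain ⟨x', hx', h | ⟨X, hX, h⟩⟩ := hcov x hx
        · left; exact ⟨x', h, hx'⟩
        · right
          rw [Set.mem_iUnion₂]
          exact ⟨X, by simp [hI, Finset.mem_powersetCard, hX], x', h, hx'⟩
      calc MeasureTheory.volume (T.mulVec '' cube n)
          ≤ _ := MeasureTheory.measure_mono h1
        _ ≤ _ := MeasureTheory.measure_union_le _ _
        _ ≤ 0 + ∑ X ∈ I, MeasureTheory.volume (T.mulVec '' gface (s X) X) := by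
            rw [hnull]
            gcongr
            exact MeasureTheory.measure_biUnion_finset_le _ _
        _ = MeasureTheory.volume U := by
            rw [hUvol, zero_add]
            apply Finset.sum_congr rfl
            intro X _
            rw [vol_gface T _ X (hs X), face_gface, vol_gface T (fun i => chi n d rank (insert i X) * pSign i X) X]
            intro i
            rcases chi_cases (d := d) rank (insert i X) with h1 | h1 <;>
            rcases pS_cases i X with h2 | h2 <;> simp only [h1, h2] <;> norm_num
    have hdiff : MeasureTheory.volume (T.mulVec '' cube n \ U) = 0 := by
      rw [MeasureTheory.measure_sdiff hsub hUcomp.measurableSet.nullMeasurableSet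
        hUcomp.measure_lt_top.ne]
      exact tsub_eq_zero_of_le hZ
    rintro _ ⟨x, hx, rfl⟩
    by_contra hxU
    have hopen : IsOpenMap T.mulVecLin :=
      LinearMap.isOpenMap_of_finiteDimensional _ (mulVec_surj hdn T hT)
    have hV : IsOpen (T.mulVec ⁻¹' Uᶜ) := hUcomp.isClosed.isOpen_compl.preimage (mulVec_cont T)
    have hxc : x ∈ closure (Set.pi Set.univ (fun _ : Fin n => Set.Ioo (-1 : ℝ) 1)) := by
      rw [closure_pi_set]
      intro i _
      rw [closure_Ioo (by norm_num)]
      exact hx i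
    obtain ⟨y, hy1, hy2⟩ := mem_closure_iff.mp hxc _ hV hxU
    have hO : IsOpen (T.mulVec ⁻¹' Uᶜ ∩ Set.pi Set.univ (fun _ : Fin n => Set.Ioo (-1 : ℝ) 1)) :=
      hV.inter (isOpen_set_pi Set.finite_univ fun _ _ => isOpen_Ioo)
    have hO2 := hopen _ hO
    have h0 := hO2.eq_empty_of_measure_zero (μ := MeasureTheory.volume)
      (MeasureTheory.measure_mono_null (by
        rintro _ ⟨z, ⟨hz1, hz2⟩, rfl⟩
        exact ⟨⟨z, fun i => Set.Ioo_subset_Icc_self (hz2 i trivial), rfl⟩, hz1⟩) hdiff)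
    have : T.mulVecLin y ∈ (∅ : Set (Fin d → ℝ)) := by
      rw [← h0]; exact ⟨y, ⟨hy1, hy2⟩, rfl⟩
    exact this
  · intro X Y hX hY hXY
    apply (isOpen_interior.inter isOpen_interior).eq_empty_of_measure_zero
      (μ := MeasureTheory.volume)
    exact MeasureTheory.measure_mono_null
      ((Set.inter_subset_inter interior_subset interior_subset).trans (hint X Y hX hY hXY)) hnull
end

section
/- Let 1 ≤ d < n and let S be a collection of (d+1)-element subsets of [n] = {1,…,n}. Suppose there exists an affinely positive linear map W: ℝ^n → ℝ^d such that the simplices conv{W(e_a) : a ∈ A} for A ∈ S tile the polytope W(Δ_{n−1}) = conv{W(e_1),…,W(e_n)} (their union equals the polytope and their interiors are pairwise disjoint). Then for every affinely positive linear map V: ℝ^n → ℝ^d, the simplices conv{V(e_a) : a ∈ A} for A ∈ S tile conv{V(e_1),…,V(e_n)}. -/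
open Classical in
noncomputable def sg (r : ℝ) : ℤ := if 0 < r then 1 else -1

lemma sg_div {a b : ℝ} (ha : a ≠ 0) (hb : b ≠ 0) : sg (a / b) = sg a * sg b := by
  unfold sg
  rcases lt_or_gt_of_ne ha with h | h <;> rcases lt_or_gt_of_ne hb with h' | h'
  · simp [div_pos_of_neg_of_neg h h', h.le.not_gt, h'.le.not_gt]
  · simp [(div_neg_of_neg_of_pos h h').le.not_gt, h.le.not_gt, h']
  · simp [(div_neg_of_pos_of_neg h h').le.not_gt, h, h'.le.not_gt]
  · simp [div_pos h h', h, h']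

open Classical in
lemma real_key {ι : Type*} (A : Finset ι) (α β : ι → ℝ)
    (hβ : ∀ i ∈ A, β i ≠ 0) (hα : ∀ i ∈ A, α i ≠ 0)
    (hne : ∀ i ∈ A, ∀ a ∈ A, a ≠ i → α a - α i / β i * β a ≠ 0)
    (hpos : ∃ i ∈ A, 0 < β i) :
    (if ∀ i ∈ A, 0 < α i then (1 : ℤ) else 0) =
      ∑ i ∈ A, sg (β i) * (if 0 < α i / β i ∧ ∀ a ∈ A, a ≠ i → 0 < α a - α i / β i * β a
        then (1 : ℤ) else 0) := by
  obtain ⟨τ, hτ⟩ : ∃ τ : ι → ℝ, ∀ i, τ i = α i / β i := ⟨_, fun i => rfl⟩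
  have hατ : ∀ i ∈ A, α i = τ i * β i := fun i hi => by
    rw [hτ, div_mul_cancel₀ _ (hβ i hi)]
  simp only [← hτ] at hne ⊢
  have hτ0 : ∀ i ∈ A, τ i ≠ 0 := fun i hi => by rw [hτ]; exact div_ne_zero (hα i hi) (hβ i hi)
  have hinj : ∀ i ∈ A, ∀ a ∈ A, a ≠ i → τ a ≠ τ i := by
    intro i hi a ha hai h
    apply hne i hi a ha hai
    rw [hατ a ha, h]; ring
  have hQp : ∀ i, ∀ a ∈ A, 0 < β a → (0 < α a - τ i * β a ↔ τ i < τ a) := by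
    intro i a ha hb
    rw [hατ a ha, ← sub_mul, mul_pos_iff_of_pos_right hb, sub_pos]
  have hQn : ∀ i, ∀ a ∈ A, β a < 0 → (0 < α a - τ i * β a ↔ τ a < τ i) := by
    intro i a ha hb
    rw [hατ a ha, ← sub_mul]
    constructor
    · intro h; by_contra h'
      nlinarith
    · intro h; nlinarith
  set P := A.filter (fun i => 0 < β i) with hP
  set N := A.filter (fun i => β i < 0) with hN
  obtain ⟨p, hpP, hpmin⟩ := P.exists_min_image τ (by
    obtain ⟨i, hi, h⟩ := hpos; exact ⟨i, by simp [hP, hi, h]⟩)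
  have hpA : p ∈ A := (Finset.mem_filter.1 hpP).1
  have hpb : 0 < β p := (Finset.mem_filter.1 hpP).2
  have hpmin' : ∀ a ∈ A, 0 < β a → a ≠ p → τ p < τ a := fun a ha hb hap =>
    lt_of_le_of_ne (hpmin a (by simp [hP, ha, hb])) (hinj a ha p hpA (Ne.symm hap))
  have hsgn : ∀ i ∈ A, ¬ 0 < β i → β i < 0 := fun i hi h =>
    lt_of_le_of_ne (not_lt.1 h) (hβ i hi)
  by_cases hall : ∀ i ∈ A, β i < 0 → τ i < 0
  · rw [Finset.sum_eq_single_of_mem p hpA]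
    · have : (∀ i ∈ A, 0 < α i) ↔ (0 < τ p ∧ ∀ a ∈ A, a ≠ p → 0 < α a - τ p * β a) := by
        constructor
        · intro h
          have h0 : 0 < τ p := by rw [hτ]; exact div_pos (h p hpA) hpb
          refine ⟨h0, fun a ha hap => ?_⟩
          by_cases hb : 0 < β a
          · rw [hQp _ _ ha hb]; exact hpmin' a ha hb hap
          · rw [hQn _ _ ha (hsgn a ha hb)]; exact (hall a ha (hsgn a ha hb)).trans h0
        · rintro ⟨h0, -⟩ i hi
          rw [hατ i hi]
          by_cases hb : 0 < β i
          · by_cases hip : i = p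
            · subst hip; positivity
            · exact mul_pos (h0.trans (hpmin' i hi hb hip)) hb
          · exact mul_pos_of_neg_of_neg (hall i hi (hsgn i hi hb)) (hsgn i hi hb)
      simp only [this, sg, hpb, if_true, one_mul]
    · intro b hb hbp
      rw [if_neg, mul_zero]
      rintro ⟨h0, h⟩
      by_cases hbb : 0 < β b
      · have := (hQp b p hpA hpb).1 (h p hpA (Ne.symm hbp))
        exact absurd (hpmin' b hb hbb hbp) this.not_gt
      · exact absurd (hall b hb (hsgn b hb hbb)) h0.not_gt
  · push Not at hall
    obtain ⟨k, hkA, hkb, hk0⟩ := hall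
    obtain ⟨q, hqN, hqmax⟩ := N.exists_max_image τ ⟨k, by simp [hN, hkA, hkb]⟩
    have hqA : q ∈ A := (Finset.mem_filter.1 hqN).1
    have hqb : β q < 0 := (Finset.mem_filter.1 hqN).2
    have hqmax' : ∀ a ∈ A, β a < 0 → a ≠ q → τ a < τ q := fun a ha hb hap =>
      lt_of_le_of_ne (hqmax a (by simp [hN, ha, hb])) (hinj q hqA a ha hap)
    have hq0 : 0 < τ q := lt_of_lt_of_le (lt_of_le_of_ne hk0 (hτ0 k hkA).symm)
      (hqmax k (by simp [hN, hkA, hkb]))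
    have hpq : p ≠ q := by rintro rfl; exact absurd hpb hqb.not_gt
    rw [if_neg (by
      intro h; have := h q hqA; rw [hατ q hqA] at this; nlinarith)]
    rw [← Finset.sum_subset (s₁ := {p, q}) (by
      intro a ha; simp at ha; rcases ha with rfl | rfl <;> assumption)]
    · rw [Finset.sum_pair hpq]
      have e1 : (0 < τ p ∧ ∀ a ∈ A, a ≠ p → 0 < α a - τ p * β a) ↔ τ q < τ p := by
        constructor
        · rintro ⟨_, h⟩; exact (hQn _ _ hqA hqb).1 (h q hqA hpq.symm)
        · intro h
          refine ⟨hq0.trans h, fun a ha hap => ?_⟩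
          by_cases hb : 0 < β a
          · rw [hQp _ _ ha hb]; exact hpmin' a ha hb hap
          · rw [hQn _ _ ha (hsgn a ha hb)]
            exact (hqmax a (by simp [hN, ha, hsgn a ha hb])).trans_lt h
      have e2 : (0 < τ q ∧ ∀ a ∈ A, a ≠ q → 0 < α a - τ q * β a) ↔ τ q < τ p := by
        constructor
        · rintro ⟨_, h⟩; exact (hQp _ _ hpA hpb).1 (h p hpA hpq)
        · intro h
          refine ⟨hq0, fun a ha hap => ?_⟩
          by_cases hb : 0 < β a
          · rw [hQp _ _ ha hb]; exact h.trans_le (hpmin a (by simp [hP, ha, hb]))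
          · rw [hQn _ _ ha (hsgn a ha hb)]
            exact hqmax' a ha (hsgn a ha hb) hap
      simp only [e1, e2, sg, hpb, hqb.le.not_gt, if_true, if_false]
      ring
    · intro b hb hbp
      simp only [Finset.mem_insert, Finset.mem_singleton, not_or] at hbp
      rw [if_neg, mul_zero]
      rintro ⟨h0, h⟩
      by_cases hbb : 0 < β b
      · have := (hQp b p hpA hpb).1 (h p hpA (Ne.symm hbp.1))
        exact absurd (hpmin' b hb hbb hbp.1) this.not_gt
      · have := (hQn b q hqA hqb).1 (h q hqA (Ne.symm hbp.2))
        exact absurd (hqmax' b hb (hsgn b hb hbb) hbp.2) this.not_gt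

lemma ite_congr' {p q : Prop} {hp : Decidable p} {hq : Decidable q} (h : p ↔ q) :
    (if p then (1 : ℤ) else 0) = if q then 1 else 0 := if_congr h rfl rfl

structure Cfg (d n : ℕ) where
  v : Fin n → (Fin (d + 1) → ℝ)
  D : Finset (Fin n) → ((Fin (d + 1) → ℝ) →ₗ[ℝ] ℝ)
  hD0 : ∀ F, F.card = d → ∀ a ∈ F, D F (v a) = 0
  hD1 : ∀ F, F.card = d → ∀ a ∉ F, D F (v a) ≠ 0
  h1 : ∀ a, v a 0 = 1

namespace Cfg
variable {d n : ℕ} (K : Cfg d n)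

noncomputable def co (A : Finset (Fin n)) (a : Fin n) (x : Fin (d + 1) → ℝ) : ℝ :=
  K.D (A.erase a) x / K.D (A.erase a) (K.v a)

def In (A : Finset (Fin n)) (x : Fin (d + 1) → ℝ) : Prop := ∀ a ∈ A, 0 < K.co A a x

def Gen (x : Fin (d + 1) → ℝ) : Prop := ∀ F : Finset (Fin n), F.card = d → K.D F x ≠ 0

lemma card_erase {A : Finset (Fin n)} (hA : A.card = d + 1) {a : Fin n} (ha : a ∈ A) :
    (A.erase a).card = d := by
  rw [Finset.card_erase_of_mem ha, hA]; rfl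

lemma D_ne {A : Finset (Fin n)} (hA : A.card = d + 1) {a : Fin n} (ha : a ∈ A) :
    K.D (A.erase a) (K.v a) ≠ 0 :=
  K.hD1 _ (card_erase hA ha) _ (Finset.notMem_erase a A)

lemma D_sum {A : Finset (Fin n)} (hA : A.card = d + 1) (g : Fin n → ℝ) {b : Fin n} (hb : b ∈ A) :
    K.D (A.erase b) (∑ a ∈ A, g a • K.v a) = g b * K.D (A.erase b) (K.v b) := by
  rw [map_sum, Finset.sum_eq_single_of_mem b hb]
  · simp
  · intro a ha hab
    rw [map_smul, K.hD0 _ (card_erase hA hb) a (Finset.mem_erase.2 ⟨hab, ha⟩), smul_zero]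

lemma expand {A : Finset (Fin n)} (hA : A.card = d + 1) (x : Fin (d + 1) → ℝ) :
    x = ∑ a ∈ A, K.co A a x • K.v a := by
  have hli : LinearIndependent ℝ (fun a : A => K.v a) := by
    have := (linearIndepOn_finset_iff (R := ℝ) (v := K.v) (s := A)).2 (by
      intro g hg b hb
      have := K.D_sum hA g hb
      rw [hg, map_zero] at this
      exact (mul_eq_zero.1 this.symm).resolve_right (K.D_ne hA hb))
    exact this
  have hsp := hli.span_eq_top_of_card_eq_finrank' (by simp [hA])
  have hx : x ∈ Submodule.span ℝ (Set.range fun a : A => K.v a) := by rw [hsp]; trivial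
  obtain ⟨g, hg⟩ := (Submodule.mem_span_range_iff_exists_fun ℝ).1 hx
  classical
  obtain ⟨g', hg'⟩ : ∃ g' : Fin n → ℝ, ∀ a : A, g' a = g a :=
    ⟨fun a => if h : a ∈ A then g ⟨a, h⟩ else 0, fun a => by simp⟩
  have hx2 : x = ∑ a ∈ A, g' a • K.v a := by
    rw [← hg, ← Finset.sum_coe_sort A]
    exact Finset.sum_congr rfl fun a _ => by rw [hg']
  have : ∀ a ∈ A, K.co A a x = g' a := by
    intro a ha
    unfold co
    rw [div_eq_iff (K.D_ne hA ha)]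
    conv_lhs => rw [hx2]
    exact K.D_sum hA g' ha
  conv_lhs => rw [hx2]
  exact Finset.sum_congr rfl fun a ha => by rw [this a ha]

lemma expand0 {A : Finset (Fin n)} (hA : A.card = d + 1) (x : Fin (d + 1) → ℝ) :
    x 0 = ∑ a ∈ A, K.co A a x := by
  conv_lhs => rw [K.expand hA x]
  simp [Finset.sum_apply, K.h1]

lemma card_exch {A : Finset (Fin n)} (hA : A.card = d + 1) {i j : Fin n} (hi : i ∈ A)
    (hj : j ∉ A) : (insert j (A.erase i)).card = d + 1 := by
  rw [Finset.card_insert_of_notMem (fun h => hj (Finset.mem_of_mem_erase h)), card_erase hA hi]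

lemma co_exch_new {A : Finset (Fin n)} (hA : A.card = d + 1) {i j : Fin n} (hi : i ∈ A)
    (hj : j ∉ A) (x) :
    K.co (insert j (A.erase i)) j x = K.co A i x / K.co A i (K.v j) := by
  have hj' : j ∉ A.erase i := fun h => hj (Finset.mem_of_mem_erase h)
  have h2 := K.hD1 _ (card_erase hA hi) _ hj'
  have h3 := K.D_ne hA hi
  unfold co
  rw [Finset.erase_insert hj']
  field_simp

lemma co_v_ne {A : Finset (Fin n)} (hA : A.card = d + 1) {i j : Fin n} (hi : i ∈ A)
    (hj : j ∉ A) : K.co A i (K.v j) ≠ 0 :=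
  div_ne_zero (K.hD1 _ (card_erase hA hi) _ fun h => hj (Finset.mem_of_mem_erase h)) (K.D_ne hA hi)

lemma co_gen_ne {A : Finset (Fin n)} (hA : A.card = d + 1) {i : Fin n} (hi : i ∈ A) {x}
    (hx : K.Gen x) : K.co A i x ≠ 0 :=
  div_ne_zero (hx _ (card_erase hA hi)) (K.D_ne hA hi)

lemma co_exch_old {A : Finset (Fin n)} (hA : A.card = d + 1) {i j a : Fin n} (hi : i ∈ A)
    (hj : j ∉ A) (ha : a ∈ A) (hai : a ≠ i) (x) :
    K.co (insert j (A.erase i)) a x =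
      K.co A a x - K.co A i x / K.co A i (K.v j) * K.co A a (K.v j) := by
  set A' := insert j (A.erase i) with hA'
  have hc : A'.card = d + 1 := card_exch hA hi hj
  have haA' : a ∈ A' := by simp [hA', ha, hai]
  have hja : j ≠ a := by rintro rfl; exact hj ha
  have key : ∀ y, K.D (A'.erase a) y = K.co A a y * K.D (A'.erase a) (K.v a) +
      K.co A i y * K.D (A'.erase a) (K.v i) := by
    intro y
    conv_lhs => rw [K.expand hA y]
    rw [map_sum, ← Finset.sum_subset (s₁ := {a, i}) (by
      intro b hb; simp at hb; rcases hb with rfl | rfl <;> assumption)]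
    · rw [Finset.sum_pair hai]; simp
    · intro b hb hbn
      simp at hbn
      rw [map_smul, K.hD0 _ (card_erase hc haA') b (by simp [hA', hb, hbn]), smul_zero]
  have h1 := key x
  have h2 := key (K.v j)
  rw [K.hD0 _ (card_erase hc haA') j (by simp [hA', hja])] at h2
  have h3 := K.D_ne hc haA'
  have h4 := K.co_v_ne hA hi hj
  conv_lhs => unfold co
  rw [h1, div_eq_iff h3]
  have h5 : K.D (A'.erase a) (K.v i) = - (K.co A a (K.v j) * K.D (A'.erase a) (K.v a)) / K.co A i (K.v j) := by
    field_simp; linarith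
  rw [h5]; ring

open Classical in
noncomputable def ind (A : Finset (Fin n)) (x : Fin (d + 1) → ℝ) : ℤ := if K.In A x then 1 else 0

lemma In_exch {A : Finset (Fin n)} (hA : A.card = d + 1) {i j : Fin n} (hi : i ∈ A)
    (hj : j ∉ A) (x) : K.In (insert j (A.erase i)) x ↔
     (0 < K.co A i x / K.co A i (K.v j) ∧ ∀ a ∈ A, a ≠ i →
      0 < K.co A a x - K.co A i x / K.co A i (K.v j) * K.co A a (K.v j)) := by
  unfold In
  rw [Finset.forall_mem_insert, K.co_exch_new hA hi hj]
  refine and_congr Iff.rfl ?_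
  constructor
  · intro h a ha hai
    rw [← K.co_exch_old hA hi hj ha hai]
    exact h a (Finset.mem_erase.2 ⟨hai, ha⟩)
  · intro h a ha
    obtain ⟨hai, ha⟩ := Finset.mem_erase.1 ha
    rw [K.co_exch_old hA hi hj ha hai]
    exact h a ha hai

lemma exch_sum {A : Finset (Fin n)} (hA : A.card = d + 1) {j : Fin n} (hj : j ∉ A) {x}
    (hx : K.Gen x) :
    K.ind A x = ∑ i ∈ A, sg (K.co A i (K.v j)) * K.ind (insert j (A.erase i)) x := by
  have := real_key A (fun i => K.co A i x) (fun i => K.co A i (K.v j))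
    (fun i hi => K.co_v_ne hA hi hj) (fun i hi => K.co_gen_ne hA hi hx)
    (fun i hi a ha hai => by
      rw [← K.co_exch_old hA hi hj ha hai]
      exact K.co_gen_ne (card_exch hA hi hj) (by simp [ha, hai]) hx)
    (by
      by_contra h
      push Not at h
      have h0 := K.expand0 hA (K.v j)
      rw [K.h1] at h0
      have := Finset.sum_nonpos h
      linarith)
  unfold ind
  refine Eq.trans (ite_congr' Iff.rfl) (this.trans (Finset.sum_congr rfl fun i hi => ?_))
  congr 1
  exact ite_congr' (K.In_exch hA hi hj x).symm

/-- exchange step -/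
lemma exch {A : Finset (Fin n)} (hA : A.card = d + 1) {j : Fin n} (hj : j ∉ A) {x}
    (hx : K.Gen x) (hin : K.In A x) :
    ∃ i ∈ A, 0 < K.co A i (K.v j) ∧ K.In (insert j (A.erase i)) x := by
  by_contra h
  push Not at h
  have := K.exch_sum hA hj hx
  have h2 : ∑ i ∈ A, sg (K.co A i (K.v j)) * K.ind (insert j (A.erase i)) x ≤ 0 := by
    apply Finset.sum_nonpos
    intro i hi
    unfold ind sg
    split_ifs with h1 h2
    · exact absurd h2 (h i hi h1)
    all_goals norm_num
  rw [← this] at h2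
  simp [ind, hin] at h2

noncomputable def f (c : Finset (Fin n) → ℤ) (x : Fin (d + 1) → ℝ) : ℤ :=
  ∑ A ∈ Finset.powersetCard (d + 1) Finset.univ, c A * K.ind A x

noncomputable def bd (c : Finset (Fin n) → ℤ) (F : Finset (Fin n)) : ℤ :=
  ∑ j ∈ Fᶜ, sg (K.D F (K.v j)) * c (insert j F)

lemma sg_sq (r : ℝ) : sg r * sg r = 1 := by unfold sg; split_ifs <;> norm_num

lemma f_eq (c : Finset (Fin n) → ℤ) (m : Fin n) {x} (hx : K.Gen x) :
    K.f c x = ∑ F ∈ (Finset.powersetCard d Finset.univ).filter (fun F => m ∉ F),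
      sg (K.D F (K.v m)) * K.ind (insert m F) x * K.bd c F := by
  classical
  have hR : ∀ F ∈ (Finset.powersetCard d Finset.univ).filter (fun F : Finset (Fin n) => m ∉ F),
      sg (K.D F (K.v m)) * K.ind (insert m F) x * K.bd c F =
      c (insert m F) * K.ind (insert m F) x +
      ∑ j ∈ (insert m F)ᶜ, c (insert j F) *
        (sg (K.D F (K.v m)) * sg (K.D F (K.v j)) * K.ind (insert m F) x) := by
    intro F hF
    have hm : m ∉ F := (Finset.mem_filter.1 hF).2
    have e : Fᶜ = insert m (insert m F)ᶜ := by
      ext a; by_cases h : a = m <;> simp [h, hm]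
    unfold bd
    rw [e, Finset.sum_insert (by simp), mul_add, Finset.mul_sum]
    congr 1
    · linear_combination (c (insert m F) * K.ind (insert m F) x) * sg_sq (K.D F (K.v m))
    · exact Finset.sum_congr rfl fun j _ => by ring
  rw [Finset.sum_congr rfl hR, Finset.sum_add_distrib]
  unfold f
  rw [← Finset.sum_filter_add_sum_filter_not _ (fun A : Finset (Fin n) => m ∈ A)]
  congr 1
  · refine Finset.sum_bij' (fun A _ => A.erase m) (fun F _ => insert m F) ?_ ?_ ?_ ?_ ?_
    · intro A hA
      simp only [Finset.mem_filter, Finset.mem_powersetCard_univ] at hA ⊢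
      exact ⟨card_erase hA.1 hA.2, Finset.notMem_erase _ _⟩
    · intro F hF
      simp only [Finset.mem_filter, Finset.mem_powersetCard_univ] at hF ⊢
      exact ⟨by rw [Finset.card_insert_of_notMem hF.2, hF.1], Finset.mem_insert_self _ _⟩
    · intro A hA
      exact Finset.insert_erase (Finset.mem_filter.1 hA).2
    · intro F hF
      exact Finset.erase_insert (Finset.mem_filter.1 hF).2
    · intro A hA
      rw [Finset.insert_erase (Finset.mem_filter.1 hA).2]
  · have hL : ∀ A ∈ (Finset.powersetCard (d+1) Finset.univ).filter (fun A : Finset (Fin n) => m ∉ A),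
        c A * K.ind A x = ∑ i ∈ A, c A * (sg (K.D (A.erase i) (K.v m)) *
          sg (K.D (A.erase i) (K.v i)) * K.ind (insert m (A.erase i)) x) := by
      intro A hA
      simp only [Finset.mem_filter, Finset.mem_powersetCard_univ] at hA
      rw [K.exch_sum hA.1 hA.2 hx, Finset.mul_sum]
      refine Finset.sum_congr rfl fun i hi => ?_
      unfold co
      rw [sg_div (K.hD1 _ (card_erase hA.1 hi) _ fun h => hA.2 (Finset.mem_of_mem_erase h))
        (K.D_ne hA.1 hi)]
    rw [Finset.sum_congr rfl hL, Finset.sum_sigma', Finset.sum_sigma']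
    refine Finset.sum_bij' (fun p _ => ⟨p.1.erase p.2, p.2⟩) (fun p _ => ⟨insert p.2 p.1, p.2⟩)
      ?_ ?_ ?_ ?_ ?_
    · rintro ⟨A, i⟩ h
      simp only [Finset.mem_sigma, Finset.mem_filter, Finset.mem_powersetCard_univ] at h ⊢
      obtain ⟨⟨hA, hm⟩, hi⟩ := h
      refine ⟨⟨card_erase hA hi, fun h => hm (Finset.mem_of_mem_erase h)⟩, ?_⟩
      have : i ≠ m := by rintro rfl; exact hm hi
      simp [this]
    · rintro ⟨F, j⟩ h
      simp only [Finset.mem_sigma, Finset.mem_filter, Finset.mem_powersetCard_univ,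
        Finset.mem_compl, Finset.mem_insert, not_or] at h ⊢
      obtain ⟨⟨hA, hm⟩, hi⟩ := h
      refine ⟨⟨by rw [Finset.card_insert_of_notMem hi.2, hA], fun h => hi.1 h.symm, hm⟩, by simp⟩
    · rintro ⟨A, i⟩ h
      simp only [Finset.mem_sigma] at h
      simp [Finset.insert_erase h.2]
    · rintro ⟨F, j⟩ h
      simp only [Finset.mem_sigma, Finset.mem_compl, Finset.mem_insert, not_or] at h
      simp [Finset.erase_insert h.2.2]
    · rintro ⟨A, i⟩ h
      simp only [Finset.mem_sigma] at h
      simp [Finset.insert_erase h.2]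

end Cfg

lemma exists_generic {E ι : Type*} [AddCommGroup E] [Module ℝ E] [TopologicalSpace E]
    [ContinuousSMul ℝ E] [IsTopologicalAddGroup E]
    (s : Finset ι) (g : ι → E → ℝ) (hc : ∀ i ∈ s, Continuous (g i))
    (haff : ∀ i ∈ s, ∀ y p, ∀ t : ℝ, g i (y + t • (p - y)) = (1 - t) * g i y + t * g i p)
    (hp : ∀ i ∈ s, ∃ p, g i p ≠ 0) (U : Set E) (hU : IsOpen U) (hne : U.Nonempty) :
    ∃ y ∈ U, ∀ i ∈ s, g i y ≠ 0 := by
  classical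
  induction s using Finset.induction_on generalizing U with
  | empty => obtain ⟨y, hy⟩ := hne; exact ⟨y, hy, by simp⟩
  | insert i s hi ih =>
    obtain ⟨y, hy, h⟩ := ih (fun j hj => hc j (Finset.mem_insert_of_mem hj))
      (fun j hj => haff j (Finset.mem_insert_of_mem hj))
      (fun j hj => hp j (Finset.mem_insert_of_mem hj)) (U ∩ {y | g i y ≠ 0})
      (hU.inter ((hc i (Finset.mem_insert_self _ _)).isOpen_preimage _ isOpen_ne)) (by
        obtain ⟨y, hy⟩ := hne
        by_cases h0 : g i y = 0
        · obtain ⟨p, hp⟩ := hp i (Finset.mem_insert_self _ _)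
          have hcont : Continuous (fun t : ℝ => y + t • (p - y)) := by fun_prop
          have hev : ∀ᶠ t in nhds (0 : ℝ), y + t • (p - y) ∈ U :=
            hcont.continuousAt.eventually_mem (hU.mem_nhds (by simpa using hy))
          obtain ⟨δ, hδ, hd⟩ := Metric.eventually_nhds_iff.1 hev
          refine ⟨y + (δ / 2) • (p - y), hd ?_, ?_⟩
          · rw [Real.dist_eq, sub_zero, abs_of_pos (by positivity)]; linarith
          · simp only [Set.mem_ofPred_eq]
            rw [haff i (Finset.mem_insert_self _ _), h0, mul_zero, zero_add]
            exact mul_ne_zero (by positivity) hp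
        · exact ⟨y, hy, h0⟩)
    refine ⟨y, hy.1, fun j hj => ?_⟩
    rcases Finset.mem_insert.1 hj with rfl | hj
    · exact hy.2
    · exact h j hj

namespace Cfg
variable {d n : ℕ} (K : Cfg d n)

def isT (m : Fin n) (A : Finset (Fin n)) : Prop :=
  m ∈ A ∧ ∀ j ∉ A, sg (K.D (A.erase m) (K.v j)) = sg (K.D (A.erase m) (K.v m))

open Classical in
lemma T_exists (m : Fin n) {x} (hx : K.Gen x) {A0 : Finset (Fin n)} (hA0 : A0.card = d + 1)
    (hin0 : K.In A0 x) : ∃ A, A.card = d + 1 ∧ K.isT m A ∧ K.In A x := by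
  obtain ⟨A, hA, hmax⟩ := ((Finset.powersetCard (d + 1) Finset.univ).filter
    (fun A => K.In A x)).exists_max_image (fun A => if m ∈ A then K.co A m x else 0)
    ⟨A0, by simp [hA0, hin0]⟩
  simp only [Finset.mem_filter, Finset.mem_powersetCard_univ] at hA hmax
  obtain ⟨hA, hin⟩ := hA
  have hm : m ∈ A := by
    by_contra hm
    obtain ⟨i, hi, hb, hin'⟩ := K.exch hA hm hx hin
    have := hmax _ ⟨card_exch hA hi hm, hin'⟩
    rw [if_pos (by simp), if_neg hm] at this
    exact absurd (hin' m (by simp)) this.not_gt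
  refine ⟨A, hA, ⟨hm, fun j hj => ?_⟩, hin⟩
  by_contra hne
  obtain ⟨i, hi, hb, hin'⟩ := K.exch hA hj hx hin
  have hj' : j ∉ A.erase m := fun h => hj (Finset.mem_of_mem_erase h)
  have hneg : K.co A m (K.v j) < 0 := by
    have h1 := sg_div (K.hD1 _ (card_erase hA hm) _ hj') (K.D_ne hA hm)
    by_contra h
    have h2 : 0 < K.co A m (K.v j) := lt_of_le_of_ne (not_lt.1 h) (K.co_v_ne hA hm hj).symm
    have h3 : sg (K.co A m (K.v j)) = 1 := by simp [sg, h2]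
    unfold co at h3
    rw [h1] at h3
    apply hne
    linear_combination sg (K.D (A.erase m) (K.v m)) * h3 - sg (K.D (A.erase m) (K.v j)) * sg_sq (K.D (A.erase m) (K.v m))
  have him : m ≠ i := by rintro rfl; exact absurd hb hneg.not_gt
  have := hmax _ ⟨card_exch hA hi hj, hin'⟩
  rw [if_pos (by simp [him, hm]), if_pos hm, K.co_exch_old hA hi hj hm him] at this
  have h4 := hin i hi
  have h5 : 0 < K.co A i x / K.co A i (K.v j) := div_pos h4 hb
  nlinarith

lemma T_le (m : Fin n) {x} {A B : Finset (Fin n)} (hA : A.card = d + 1)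
    (hB : B.card = d + 1) (hTA : K.isT m A) (hTB : K.isT m B) (hiB : K.In B x) :
    K.co B m x ≤ K.co A m x ∧ (K.co B m x = K.co A m x → B ⊆ A) := by
  have hφ : ∀ b, b ∉ A → 0 < K.co A m (K.v b) := by
    intro b hb
    have hb' : b ∉ A.erase m := fun h => hb (Finset.mem_of_mem_erase h)
    have h1 := sg_div (K.hD1 _ (card_erase hA hTA.1) _ hb') (K.D_ne hA hTA.1)
    rw [hTA.2 b hb, sg_sq] at h1
    unfold co
    by_contra h
    simp [sg, h] at h1
  have hφ0 : ∀ b ∈ A, b ≠ m → K.co A m (K.v b) = 0 := by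
    intro b hb hbm
    unfold co
    rw [K.hD0 _ (card_erase hA hTA.1) b (Finset.mem_erase.2 ⟨hbm, hb⟩), zero_div]
  have hφm : K.co A m (K.v m) = 1 := div_self (K.D_ne hA hTA.1)
  have hexp : K.co A m x = K.co B m x + ∑ b ∈ B.erase m, K.co B b x * K.co A m (K.v b) := by
    have : K.co A m x = ∑ b ∈ B, K.co B b x * K.co A m (K.v b) := by
      conv_lhs => rw [K.expand hB x]
      simp only [co, map_sum, map_smul, Finset.sum_div, smul_eq_mul, mul_div_assoc]
    rw [this, ← Finset.add_sum_erase _ _ hTB.1, hφm, mul_one]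
  have hnn : ∀ b ∈ B.erase m, 0 ≤ K.co B b x * K.co A m (K.v b) := by
    intro b hb
    obtain ⟨hbm, hb⟩ := Finset.mem_erase.1 hb
    by_cases h : b ∈ A
    · rw [hφ0 b h hbm, mul_zero]
    · exact (mul_pos (hiB b hb) (hφ b h)).le
  refine ⟨by have := Finset.sum_nonneg hnn; linarith, fun heq b hb => ?_⟩
  by_contra h
  have hbm : b ≠ m := by rintro rfl; exact h hTA.1
  have h0 : ∑ b ∈ B.erase m, K.co B b x * K.co A m (K.v b) = 0 := by linarith
  have := (Finset.sum_eq_zero_iff_of_nonneg hnn).1 h0 b (Finset.mem_erase.2 ⟨hbm, hb⟩)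
  have := mul_pos (hiB b hb) (hφ b h)
  linarith

lemma T_unique (m : Fin n) {x} {A B : Finset (Fin n)} (hA : A.card = d + 1)
    (hB : B.card = d + 1) (hTA : K.isT m A) (hTB : K.isT m B) (hiA : K.In A x) (hiB : K.In B x) :
    A = B := by
  have h1 := K.T_le m hA hB hTA hTB hiB
  have h2 := K.T_le m hB hA hTB hTA hiA
  exact Finset.Subset.antisymm (h2.2 (le_antisymm h2.1 h1.1)) (h1.2 (le_antisymm h1.1 h2.1))

lemma div_pos_congr {p q r : ℝ} (h : 0 < p * q) : (0 < p / r ↔ 0 < q / r) := by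
  rcases mul_pos_iff.1 h with ⟨h1, h2⟩ | ⟨h1, h2⟩
  · simp [div_pos_iff, h1, h2, h1.le.not_gt, h2.le.not_gt]
  · simp [div_pos_iff, h1, h2, h1.le.not_gt, h2.le.not_gt]

lemma bd_zero (hdn : d < n) (c : Finset (Fin n) → ℤ) (hf : ∀ x, K.Gen x → K.f c x = 0)
    (F : Finset (Fin n)) (hF : F.card = d) : K.bd c F = 0 := by
  classical
  have hcont : ∀ G, Continuous (K.D G) := fun G => LinearMap.continuous_of_finiteDimensional _
  obtain ⟨m, hm⟩ : ∃ m, m ∉ F := by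
    by_contra h
    push Not at h
    have : F = Finset.univ := Finset.eq_univ_iff_forall.2 h
    rw [this, Finset.card_univ, Fintype.card_fin] at hF
    omega
  obtain ⟨l, hl, hlG⟩ := exists_generic ((Finset.powersetCard d Finset.univ).erase F)
    (fun G (l : Fin n → ℝ) => K.D G (∑ a ∈ F, l a • K.v a))
    (fun G _ => (hcont G).comp (by fun_prop))
    (fun G _ y p t => by
      simp only [map_sum, map_smul, Pi.add_apply, Pi.smul_apply, Pi.sub_apply, smul_eq_mul,
        Finset.mul_sum, ← Finset.sum_add_distrib]
      exact Finset.sum_congr rfl fun a _ => by ring)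
    (fun G hG => by
      simp only [Finset.mem_erase, Finset.mem_powersetCard_univ] at hG
      obtain ⟨a, haF, haG⟩ : ∃ a ∈ F, a ∉ G := by
        by_contra h
        push Not at h
        exact hG.1 (Finset.eq_of_subset_of_card_le h (by omega)).symm
      refine ⟨Pi.single a 1, ?_⟩
      rw [Finset.sum_eq_single_of_mem a haF]
      · simpa using K.hD1 G hG.2 a haG
      · intro b _ hb; simp [hb])
    {l | ∀ a, 0 < l a} (by
      have : {l : Fin n → ℝ | ∀ a, 0 < l a} = Set.univ.pi fun _ => Set.Ioi 0 := by
        ext l; simp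
      rw [this]
      exact isOpen_set_pi Set.finite_univ fun _ _ => isOpen_Ioi) ⟨fun _ => 1, fun _ => one_pos⟩
  set x := ∑ a ∈ F, l a • K.v a with hxdef
  have hev : ∀ᶠ t in nhds (0 : ℝ), ∀ G ∈ (Finset.powersetCard d Finset.univ).erase F,
      0 < K.D G (x + t • K.v m) * K.D G x := by
    rw [Filter.eventually_all_finset]
    intro G hG
    have hc : Continuous (fun t : ℝ => K.D G (x + t • K.v m) * K.D G x) :=
      ((hcont G).comp (by fun_prop)).mul continuous_const
    apply hc.continuousAt.eventually_mem (isOpen_Ioi.mem_nhds _)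
    simpa using (hlG G hG)
  obtain ⟨δ, hδ, hd⟩ := Metric.eventually_nhds_iff.1 hev
  have hDF : ∀ t : ℝ, K.D F (x + t • K.v m) = t * K.D F (K.v m) := by
    intro t
    rw [map_add, map_smul, hxdef, map_sum, Finset.sum_eq_zero, zero_add, smul_eq_mul]
    intro a ha
    rw [map_smul, K.hD0 F hF a ha, smul_zero]
  have hDm := K.hD1 F hF m hm
  have hgen : ∀ t : ℝ, |t| < δ → t ≠ 0 → K.Gen (x + t • K.v m) := by
    intro t ht ht0 G hG
    by_cases hGF : G = F
    · subst hGF; rw [hDF]; exact mul_ne_zero ht0 hDm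
    · have := hd (y := t) (by simpa using ht) G (by simp [hGF, hG])
      exact left_ne_zero_of_mul this.ne'
  have hInF : ∀ t : ℝ, |t| < δ → ∀ j ∉ F,
      (K.In (insert j F) (x + t • K.v m) ↔ 0 < t * K.D F (K.v m) / K.D F (K.v j)) := by
    intro t ht j hj
    have hc : (insert j F).card = d + 1 := by rw [Finset.card_insert_of_notMem hj, hF]
    unfold In
    rw [Finset.forall_mem_insert]
    have e1 : K.co (insert j F) j (x + t • K.v m) = t * K.D F (K.v m) / K.D F (K.v j) := by
      unfold co; rw [Finset.erase_insert hj, hDF]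
    rw [e1]
    refine and_iff_left ?_
    intro a ha
    have haj : j ≠ a := by rintro rfl; exact hj ha
    have haA : a ∈ insert j F := Finset.mem_insert_of_mem ha
    have hGc := card_erase hc haA
    have hGF : (insert j F).erase a ≠ F := by
      intro h
      have h' := Finset.notMem_erase a (insert j F)
      rw [h] at h'
      exact h' ha
    have h1 := hd (y := t) (by simpa using ht) _ (Finset.mem_erase.2 ⟨hGF, by simp only [Finset.mem_powersetCard_univ]; exact hGc⟩)
    have h2 : K.D ((insert j F).erase a) x = l a * K.D ((insert j F).erase a) (K.v a) := by
      rw [hxdef, map_sum, Finset.sum_eq_single_of_mem a ha]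
      · simp
      · intro b hb hba
        rw [map_smul, K.hD0 _ hGc b (by simp [hb, hba]), smul_zero]
    unfold co
    rw [div_pos_congr h1, h2, mul_div_cancel_right₀ _ (K.D_ne hc haA)]
    exact hl a
  have hp : |δ / 2| < δ := by rw [abs_of_pos (by positivity)]; linarith
  have hn : |-(δ / 2)| < δ := by rwa [abs_neg]
  have hδ2 : 0 < δ / 2 := by positivity
  have f1 := hf _ (hgen (δ / 2) hp hδ2.ne')
  have f2 := hf _ (hgen (-(δ / 2)) hn (by linarith))
  have hdiff : ∑ A ∈ Finset.powersetCard (d + 1) Finset.univ, c A * (K.ind A (x + (δ / 2) • K.v m)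
      - K.ind A (x + (-(δ / 2)) • K.v m)) = 0 := by
    simp only [mul_sub, Finset.sum_sub_distrib]
    unfold f at f1 f2
    rw [f1, f2, sub_zero]
  rw [← Finset.sum_subset (s₁ := Fᶜ.image (fun j => insert j F)), Finset.sum_image] at hdiff
  · have e : ∀ j ∈ Fᶜ, c (insert j F) * (K.ind (insert j F) (x + (δ / 2) • K.v m)
      - K.ind (insert j F) (x + (-(δ / 2)) • K.v m)) =
        sg (K.D F (K.v m)) * (sg (K.D F (K.v j)) * c (insert j F)) := by
      intro j hj
      have hj := Finset.mem_compl.1 hj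
      have hDj := K.hD1 F hF j hj
      have h0 := sg_div hDm hDj
      have hq : K.D F (K.v m) / K.D F (K.v j) ≠ 0 := div_ne_zero hDm hDj
      have : K.ind (insert j F) (x + (δ / 2) • K.v m)
        - K.ind (insert j F) (x + (-(δ / 2)) • K.v m) = sg (K.D F (K.v m) / K.D F (K.v j)) := by
        unfold ind
        rw [if_congr (hInF _ hp j hj) rfl rfl, if_congr (hInF _ hn j hj) rfl rfl, mul_div_assoc,
          mul_div_assoc]
        unfold sg
        rcases lt_or_gt_of_ne hq with h | h
        · rw [if_neg, if_pos, if_neg h.le.not_gt]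
          · norm_num
          · nlinarith
          · nlinarith
        · rw [if_pos, if_neg, if_pos h]
          · norm_num
          · nlinarith
          · nlinarith
      rw [this, h0]; ring
    rw [Finset.sum_congr rfl e, ← Finset.mul_sum] at hdiff
    have hs := sg_sq (K.D F (K.v m))
    unfold bd
    rcases mul_eq_zero.1 hdiff with h | h
    · rw [h] at hs; norm_num at hs
    · exact h
  · intro i hi j hj hij
    simp only [Finset.coe_compl, Set.mem_compl_iff, Finset.mem_coe] at hi hj
    have : i ∈ insert j F := by
      have h : i ∈ insert i F := Finset.mem_insert_self _ _
      simpa [hij] using h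
    exact (Finset.mem_insert.1 this).resolve_right hi
  · intro A hA
    obtain ⟨j, hj, rfl⟩ := Finset.mem_image.1 hA
    rw [Finset.mem_powersetCard_univ, Finset.card_insert_of_notMem (Finset.mem_compl.1 hj), hF]
  · intro A hA hAF
    rw [Finset.mem_powersetCard_univ] at hA
    have : K.In A (x + (δ / 2) • K.v m) ↔ K.In A (x + (-(δ / 2)) • K.v m) := by
      unfold In
      refine forall₂_congr fun a ha => ?_
      have hGF : A.erase a ≠ F := by
        intro h
        apply hAF
        refine Finset.mem_image.2 ⟨a, ?_, ?_⟩
        · rw [← h]; simp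
        · rw [← h, Finset.insert_erase ha]
      have hmem : A.erase a ∈ (Finset.powersetCard d Finset.univ).erase F :=
        Finset.mem_erase.2 ⟨hGF, by rw [Finset.mem_powersetCard_univ]; exact card_erase hA ha⟩
      have h1 := hd (y := δ / 2) (by rw [Real.dist_eq, sub_zero]; exact hp) _ hmem
      have h2 := hd (y := -(δ / 2)) (by rw [Real.dist_eq, sub_zero]; exact hn) _ hmem
      unfold co
      rw [div_pos_congr h1, div_pos_congr h2]
    unfold ind
    rw [if_congr this rfl rfl, sub_self, mul_zero]

end Cfg

namespace Cfg
variable {d n : ℕ} (K : Cfg d n)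

open Classical in
lemma f_pred (P : Finset (Fin n) → Prop) (x) : K.f (fun A => if P A then 1 else 0) x =
    ((Finset.powersetCard (d + 1) Finset.univ).filter (fun A => P A ∧ K.In A x)).card := by
  unfold f ind
  rw [Finset.card_filter]
  push_cast
  refine Finset.sum_congr rfl fun A _ => ?_
  by_cases h1 : P A <;> by_cases h2 : K.In A x <;> simp [h1, h2]

open Classical in
lemma f_one (P : Finset (Fin n) → Prop) (hP : ∀ A, P A → A.card = d + 1) (x) :
    K.f (fun A => if P A then 1 else 0) x = 1 ↔ ∃! A, P A ∧ K.In A x := by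
  rw [f_pred, Nat.cast_eq_one, Finset.card_eq_one]
  constructor
  · rintro ⟨A, hA⟩
    have h := fun B => Finset.ext_iff.1 hA B
    simp only [Finset.mem_filter, Finset.mem_powersetCard_univ, Finset.mem_singleton] at h
    exact ⟨A, ((h A).2 rfl).2, fun B hB => (h B).1 ⟨hP B hB.1, hB⟩⟩
  · rintro ⟨A, hA, hu⟩
    refine ⟨A, ?_⟩
    ext B
    simp only [Finset.mem_filter, Finset.mem_powersetCard_univ, Finset.mem_singleton]
    exact ⟨fun h => hu B h.2, fun h => h ▸ ⟨hP A hA.1, hA⟩⟩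

lemma f_sub (c e : Finset (Fin n) → ℤ) (x) : K.f (fun A => c A - e A) x = K.f c x - K.f e x := by
  simp only [f, sub_mul, Finset.sum_sub_distrib]

lemma T_one (m : Fin n) {x} (hx : K.Gen x) {A0 : Finset (Fin n)} (hA0 : A0.card = d + 1)
    (hin0 : K.In A0 x) : ∃! A, (A.card = d + 1 ∧ K.isT m A) ∧ K.In A x := by
  obtain ⟨A, h1, h2, h3⟩ := K.T_exists m hx hA0 hin0
  exact ⟨A, ⟨⟨h1, h2⟩, h3⟩, fun B hB => K.T_unique m hB.1.1 h1 hB.1.2 h2 hB.2 h3⟩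

lemma In_smul {t : ℝ} (ht : 0 < t) (A : Finset (Fin n)) (x) : K.In A (t • x) ↔ K.In A x := by
  unfold In co
  refine forall₂_congr fun a _ => ?_
  rw [map_smul, smul_eq_mul, mul_div_assoc, mul_pos_iff_of_pos_left ht]

theorem transfer (L : Cfg d n) (hdn : d < n)
    (hsg : ∀ F : Finset (Fin n), F.card = d → ∀ j ∉ F, sg (K.D F (K.v j)) = sg (L.D F (L.v j)))
    (S : Set (Finset (Fin n))) (hS : ∀ A ∈ S, A.card = d + 1)
    (hK : ∀ x, x 0 = 1 → K.Gen x → ∀ A0 : Finset (Fin n), A0.card = d + 1 → K.In A0 x →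
      ∃! A, A ∈ S ∧ K.In A x)
    (x) (hx : L.Gen x) (A0 : Finset (Fin n)) (hA0 : A0.card = d + 1) (hin : L.In A0 x) :
      ∃! A, A ∈ S ∧ L.In A x := by
  classical
  have hK' : ∀ x, K.Gen x → ∀ A0 : Finset (Fin n), A0.card = d + 1 → K.In A0 x →
      ∃! A, A ∈ S ∧ K.In A x := by
    intro x hx A0 hA0 hin
    have h0 : 0 < x 0 := by
      rw [K.expand0 hA0 x]
      exact Finset.sum_pos hin (Finset.card_pos.1 (by omega))
    have := hK ((x 0)⁻¹ • x) (by simp [h0.ne']) (fun F hF => by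
      rw [map_smul]; exact smul_ne_zero (inv_ne_zero h0.ne') (hx F hF)) A0 hA0
      ((K.In_smul (inv_pos.2 h0) _ _).2 hin)
    simpa only [K.In_smul (inv_pos.2 h0)] using this
  let m : Fin n := ⟨0, by omega⟩
  have hT : ∀ A : Finset (Fin n), (A.card = d + 1 ∧ K.isT m A) ↔ (A.card = d + 1 ∧ L.isT m A) := by
    intro A
    refine and_congr_right fun hA => and_congr_right fun hm => ?_
    refine forall₂_congr fun j hj => ?_
    rw [hsg _ (card_erase hA hm) j (fun h => hj (Finset.mem_of_mem_erase h)),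
      hsg _ (card_erase hA hm) m (Finset.notMem_erase _ _)]
  obtain ⟨P, hP⟩ : ∃ P : Finset (Fin n) → Prop, ∀ A, P A ↔ (A.card = d + 1 ∧ K.isT m A) :=
    ⟨_, fun _ => Iff.rfl⟩
  set cS : Finset (Fin n) → ℤ := fun A => if A ∈ S then 1 else 0 with hcS
  set cT : Finset (Fin n) → ℤ := fun A => if P A then 1 else 0 with hcT
  have hf : ∀ x, K.Gen x → K.f (fun A => cS A - cT A) x = 0 := by
    intro x hx
    by_cases h : ∃ A0 : Finset (Fin n), A0.card = d + 1 ∧ K.In A0 x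
    · obtain ⟨A0, hA0, hin⟩ := h
      rw [f_sub, (K.f_one (fun A => A ∈ S) hS x).2 (hK' x hx A0 hA0 hin),
        (K.f_one P (fun A h => ((hP A).1 h).1) x).2
          (by simpa only [hP] using K.T_one m hx hA0 hin), sub_self]
    · push Not at h
      unfold f
      apply Finset.sum_eq_zero
      intro A hA
      rw [Finset.mem_powersetCard_univ] at hA
      simp [ind, h A hA]
  have hb : ∀ F : Finset (Fin n), F.card = d → L.bd (fun A => cS A - cT A) F = 0 := by
    intro F hF
    rw [← K.bd_zero hdn _ hf F hF]
    unfold bd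
    refine Finset.sum_congr rfl fun j hj => ?_
    rw [hsg F hF j (Finset.mem_compl.1 hj)]
  have hL : L.f (fun A => cS A - cT A) x = 0 := by
    rw [L.f_eq _ m hx]
    apply Finset.sum_eq_zero
    intro F hF
    rw [hb F (by simpa using (Finset.mem_filter.1 hF).1), mul_zero]
  have hLT : L.f cT x = 1 := by
    exact (L.f_one P (fun A h => ((hP A).1 h).1) x).2
          (by simpa only [hP, hT] using L.T_one m hx hA0 hin)
  rw [f_sub, hLT] at hL
  exact (L.f_one (fun A => A ∈ S) hS x).1 (by linarith)

/-- lift to height one -/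
def lift (y : Fin d → ℝ) : Fin (d + 1) → ℝ := Fin.cons 1 y

lemma lift_comb {ι : Type*} (s : Finset ι) (w : ι → ℝ) (p : ι → Fin d → ℝ)
    (hw : ∑ i ∈ s, w i = 1) : lift (∑ i ∈ s, w i • p i) = ∑ i ∈ s, w i • lift (p i) := by
  funext k
  refine Fin.cases ?_ (fun k => ?_) k
  · simp [lift, Finset.sum_apply, hw]
  · simp [lift, Finset.sum_apply]

lemma lift_comb2 (y p : Fin d → ℝ) (a b : ℝ) (h : a + b = 1) :
    lift (a • y + b • p) = a • lift y + b • lift p := by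
  funext k
  refine Fin.cases ?_ (fun k => ?_) k
  · simp [lift, h]
  · simp [lift]

lemma continuous_lift : Continuous (lift : (Fin d → ℝ) → _) := by
  refine continuous_pi fun k => ?_
  refine Fin.cases ?_ (fun k => ?_) k
  · simp only [lift, Fin.cons_zero]; fun_prop
  · simp only [lift, Fin.cons_succ]; fun_prop

variable (p : Fin n → Fin d → ℝ) (hp : ∀ a, K.v a = lift (p a))
include hp

lemma mem_hull {A : Finset (Fin n)} (hA : A.card = d + 1) (y : Fin d → ℝ) :
    y ∈ convexHull ℝ (p '' A) ↔ ∀ a ∈ A, 0 ≤ K.co A a (lift y) := by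
  constructor
  · intro hy
    have : convexHull ℝ (p '' A) ⊆ {y | ∀ a ∈ A, 0 ≤ K.co A a (lift y)} := by
      apply convexHull_min
      · rintro _ ⟨b, hb, rfl⟩ a ha
        rw [← hp]
        unfold co
        by_cases hab : b = a
        · subst hab; rw [div_self (K.D_ne hA ha)]; exact zero_le_one
        · rw [K.hD0 _ (card_erase hA ha) b (Finset.mem_erase.2 ⟨hab, hb⟩), zero_div]
      · intro y hy z hz s t hs ht hst a ha
        have h1 := hy a ha
        have h2 := hz a ha
        rw [lift_comb2 _ _ _ _ hst]
        have : K.co A a (s • lift y + t • lift z) =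
            s * K.co A a (lift y) + t * K.co A a (lift z) := by
          simp only [co, map_add, map_smul, smul_eq_mul]; ring
        rw [this]; positivity
    exact this hy
  · intro h
    have h1 := K.expand0 hA (lift y)
    have h2 := K.expand hA (lift y)
    have h3 : y = ∑ a ∈ A, K.co A a (lift y) • p a := by
      simp only [hp] at h2
      rw [← lift_comb _ _ _ (by rw [← h1]; rfl)] at h2
      have := congrArg Fin.tail h2
      simpa [lift] using this
    rw [h3]
    refine (convex_convexHull ℝ _).sum_mem h (by rw [← h1]; rfl) fun a ha => ?_
    exact subset_convexHull ℝ _ ⟨a, ha, rfl⟩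

lemma In_interior {A : Finset (Fin n)} (hA : A.card = d + 1) (y : Fin d → ℝ)
    (h : K.In A (lift y)) : y ∈ interior (convexHull ℝ (p '' A)) := by
  rw [mem_interior]
  refine ⟨⋂ a ∈ A, {y | 0 < K.co A a (lift y)}, fun z hz => ?_, ?_, ?_⟩
  · rw [K.mem_hull p hp hA]
    intro a ha
    exact le_of_lt (Set.mem_iInter₂.1 hz a ha)
  · refine isOpen_biInter_finset fun a _ => ?_
    refine isOpen_lt continuous_const ?_
    exact ((LinearMap.continuous_of_finiteDimensional (K.D (A.erase a))).comp
      continuous_lift).div_const _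
  · exact Set.mem_iInter₂.2 h

lemma In_of_mem {A : Finset (Fin n)} (hA : A.card = d + 1) (y : Fin d → ℝ)
    (hy : y ∈ convexHull ℝ (p '' A)) (hg : K.Gen (lift y)) : K.In A (lift y) := by
  rw [K.mem_hull p hp hA] at hy
  exact fun a ha => lt_of_le_of_ne (hy a ha) (K.co_gen_ne hA ha hg).symm

lemma exists_In (hdn : d < n) (y : Fin d → ℝ) (hy : y ∈ convexHull ℝ (Set.range p))
    (hg : K.Gen (lift y)) : ∃ A : Finset (Fin n), A.card = d + 1 ∧ K.In A (lift y) := by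
  classical
  rw [convexHull_eq_union] at hy
  simp only [Set.mem_iUnion] at hy
  obtain ⟨t, ht, hai, hyt⟩ := hy
  have hcard : t.card ≤ d + 1 := by
    have := hai.card_le_finrank_succ
    rw [Fintype.card_coe] at this
    refine this.trans ?_
    have := Submodule.finrank_le (vectorSpan ℝ (Set.range ((↑) : t → (Fin d → ℝ))))
    simp at this ⊢
    exact this
  have hs : Set.SurjOn p Set.univ (t : Set (Fin d → ℝ)) := by
    intro z hz; obtain ⟨a, ha⟩ := ht hz; exact ⟨a, trivial, ha⟩
  obtain ⟨u, -, hinj, himg⟩ := Finset.exists_subset_injOn_image_eq_of_surjOn _ t hs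
  have hu : u.card ≤ d + 1 := by
    rw [← Finset.card_image_of_injOn hinj, himg]; exact hcard
  obtain ⟨A, huA, hA⟩ := Finset.exists_superset_card_eq hu (by simpa using hdn)
  refine ⟨A, hA, K.In_of_mem p hp hA y (convexHull_mono ?_ hyt) hg⟩
  rw [← himg, Finset.coe_image]
  exact Set.image_mono huA

lemma exists_gen (hdn : d < n) (U : Set (Fin d → ℝ)) (hU : IsOpen U) (hne : U.Nonempty) :
    ∃ y ∈ U, K.Gen (lift y) := by
  obtain ⟨y, hy, h⟩ := exists_generic (Finset.powersetCard d Finset.univ)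
    (fun F y => K.D F (lift y))
    (fun F _ => (LinearMap.continuous_of_finiteDimensional (K.D F)).comp continuous_lift)
    (fun F _ y q t => by
      have : y + t • (q - y) = (1 - t) • y + t • q := by module
      rw [this, lift_comb2 _ _ _ _ (by ring)]
      simp)
    (fun F hF => by
      rw [Finset.mem_powersetCard_univ] at hF
      obtain ⟨m, hm⟩ : ∃ m, m ∉ F := by
        by_contra h
        push Not at h
        have : F = Finset.univ := Finset.eq_univ_iff_forall.2 h
        rw [this, Finset.card_univ, Fintype.card_fin] at hF
        omega
      exact ⟨p m, by rw [← hp]; exact K.hD1 F hF m hm⟩) U hU hne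
  exact ⟨y, hy, fun F hF => h F (by simpa using hF)⟩

lemma interior_ne (hdn : d < n) : (interior (convexHull ℝ (Set.range p))).Nonempty := by
  obtain ⟨A, -, hA⟩ := Finset.exists_superset_card_eq (s := (∅ : Finset (Fin n))) (n := d + 1)
    (by simp) (by simpa using hdn)
  refine ⟨∑ a ∈ A, ((d : ℝ) + 1)⁻¹ • p a, ?_⟩
  refine interior_mono (convexHull_mono (Set.image_subset_range p A))
    (K.In_interior p hp hA _ ?_)
  have h0 : (0 : ℝ) < (d : ℝ) + 1 := by positivity
  rw [lift_comb _ _ _ (by simp [hA, h0.ne'])]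
  intro a ha
  simp only [← hp]
  unfold co
  rw [K.D_sum hA (fun _ => ((d : ℝ) + 1)⁻¹) ha, mul_div_cancel_right₀ _ (K.D_ne hA ha)]
  positivity

end Cfg

theorem tile_transfer {d n : ℕ} (K L : Cfg d n) (hdn : d < n)
    (hsg : ∀ F : Finset (Fin n), F.card = d → ∀ j ∉ F, sg (K.D F (K.v j)) = sg (L.D F (L.v j)))
    (S : Set (Finset (Fin n))) (hS : ∀ A ∈ S, A.card = d + 1)
    (p q : Fin n → Fin d → ℝ) (hp : ∀ a, K.v a = Cfg.lift (p a)) (hq : ∀ a, L.v a = Cfg.lift (q a))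
    (hcover : (⋃ A ∈ S, convexHull ℝ (p '' ↑A)) = convexHull ℝ (Set.range p))
    (hdisj : ∀ A ∈ S, ∀ B ∈ S, A ≠ B →
      interior (convexHull ℝ (p '' ↑A)) ∩ interior (convexHull ℝ (p '' ↑B)) = ∅) :
    (⋃ A ∈ S, convexHull ℝ (q '' ↑A)) = convexHull ℝ (Set.range q) ∧
    ∀ A ∈ S, ∀ B ∈ S, A ≠ B →
      interior (convexHull ℝ (q '' ↑A)) ∩ interior (convexHull ℝ (q '' ↑B)) = ∅ := by
  have hL := K.transfer L hdn hsg S hS (by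
    intro x hx0 hx A0 hA0 hin
    obtain ⟨y, rfl⟩ : ∃ y, x = Cfg.lift y := by
      refine ⟨Fin.tail x, ?_⟩
      rw [Cfg.lift, ← hx0, Fin.cons_self_tail]
    have hy : y ∈ convexHull ℝ (Set.range p) :=
      convexHull_mono (Set.image_subset_range p A0)
        (interior_subset (K.In_interior p hp hA0 y hin))
    rw [← hcover] at hy
    simp only [Set.mem_iUnion] at hy
    obtain ⟨A, hA, hyA⟩ := hy
    refine ⟨A, ⟨hA, K.In_of_mem p hp (hS A hA) y hyA hx⟩, fun B hB => ?_⟩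
    by_contra hne
    have h := hdisj B hB.1 A hA hne
    have h2 : y ∈ interior (convexHull ℝ (p '' ↑B)) ∩ interior (convexHull ℝ (p '' ↑A)) :=
      ⟨K.In_interior p hp (hS B hB.1) y hB.2, K.In_interior p hp (hS A hA) y
        (K.In_of_mem p hp (hS A hA) y hyA hx)⟩
    rw [h] at h2
    exact h2)
  constructor
  · apply Set.Subset.antisymm
    · exact Set.iUnion₂_subset fun A _ => convexHull_mono (Set.image_subset_range q A)
    · have hcl : IsClosed (⋃ A ∈ S, convexHull ℝ (q '' ↑A)) :=
        S.toFinite.isClosed_biUnion fun A _ =>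
          ((A.finite_toSet.image q).isCompact_convexHull ℝ).isClosed
      refine (subset_closure).trans ?_
      rw [← (convex_convexHull ℝ _).closure_interior_eq_closure_of_nonempty_interior
        (L.interior_ne q hq hdn)]
      refine closure_minimal ?_ hcl
      by_contra hn
      obtain ⟨y0, hy0, hy0'⟩ := Set.not_subset.1 hn
      obtain ⟨y, hy, hg⟩ := L.exists_gen q hq hdn
        (interior (convexHull ℝ (Set.range q)) ∩ (⋃ A ∈ S, convexHull ℝ (q '' ↑A))ᶜ)
        (isOpen_interior.inter hcl.isOpen_compl) ⟨y0, hy0, hy0'⟩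
      obtain ⟨A0, hA0, hin⟩ := L.exists_In q hq hdn y (interior_subset hy.1) hg
      obtain ⟨A, hA, -⟩ := hL _ hg A0 hA0 hin
      exact hy.2 (Set.mem_iUnion₂.2 ⟨A, hA.1,
        interior_subset (L.In_interior q hq (hS A hA.1) y hA.2)⟩)
  · intro A hA B hB hne
    by_contra h
    obtain ⟨y, hy, hg⟩ := L.exists_gen q hq hdn _ (isOpen_interior.inter isOpen_interior)
      (Set.nonempty_iff_ne_empty.2 h)
    have h1 := L.In_of_mem q hq (hS A hA) y (interior_subset hy.1) hg
    have h2 := L.In_of_mem q hq (hS B hB) y (interior_subset hy.2) hg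
    exact hne ((hL _ hg A (hS A hA) h1).unique ⟨hA, h1⟩ ⟨hB, h2⟩)

noncomputable def D0 {d n : ℕ} (v : Fin n → Fin (d + 1) → ℝ) (F : Finset (Fin n)) :
    (Fin (d + 1) → ℝ) →ₗ[ℝ] ℝ :=
  if h : F.card = d then
    (Matrix.detRowAlternating (R := ℝ) (n := Fin (d + 1))).toMultilinearMap.toLinearMap
      (Fin.cons 0 (fun i => v (F.orderEmbOfFin h i))) 0
  else 0

lemma D0_apply {d n : ℕ} (v : Fin n → Fin (d + 1) → ℝ) (F : Finset (Fin n)) (h : F.card = d)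
    (j : Fin n) : D0 v F (v j) =
      Matrix.det (Matrix.of fun i => v ((Fin.cons j (F.orderEmbOfFin h) : Fin (d + 1) → Fin n) i)) := by
  unfold D0
  rw [dif_pos h]
  change Matrix.det (Function.update _ _ _) = _
  rw [Fin.update_cons_zero]
  congr 1
  funext i
  refine Fin.cases ?_ (fun k => ?_) i
  · rfl
  · rfl

lemma D0_zero {d n : ℕ} (v : Fin n → Fin (d + 1) → ℝ) (F : Finset (Fin n)) (h : F.card = d)
    (j : Fin n) (hj : j ∈ F) : D0 v F (v j) = 0 := by
  rw [D0_apply v F h]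
  have : j ∈ Set.range (F.orderEmbOfFin h) := by simpa using hj
  obtain ⟨k, hk⟩ := this
  refine Matrix.det_zero_of_row_eq (i := 0) (j := k.succ) (Fin.succ_ne_zero k).symm ?_
  change v j = v (F.orderEmbOfFin h k)
  rw [hk]

lemma D0_sign {d n : ℕ} (F : Finset (Fin n)) (h : F.card = d) (j : Fin n) (hj : j ∉ F) :
    ∃ e : ℤˣ, ∀ V : Matrix (Fin d) (Fin n) ℝ, AffinelyPositive V →
      0 < ((e : ℤ) : ℝ) * D0 (fun a i => affExt V i a) F (affExt V · j) := by
  set g : Fin (d + 1) → Fin n := Fin.cons j (F.orderEmbOfFin h) with hg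
  have hinj : Function.Injective g := by
    rw [hg, Fin.cons_injective_iff]
    exact ⟨by simpa using hj, (F.orderEmbOfFin h).injective⟩
  set σ := Tuple.sort g
  have hmono : StrictMono (g ∘ σ) :=
    (Tuple.monotone_sort g).strictMono_of_injective (hinj.comp σ.injective)
  refine ⟨Equiv.Perm.sign σ, fun V hV => ?_⟩
  have h1 := hV (d + 1) id (g ∘ σ) strictMono_id hmono
  rw [D0_apply (fun a i => affExt V i a) F h j, ← Matrix.det_permute σ]
  rw [← Matrix.det_transpose] at h1
  exact h1

noncomputable def mkCfg {d n : ℕ} (V : Matrix (Fin d) (Fin n) ℝ) (hV : AffinelyPositive V) :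
    Cfg d n where
  v := fun a i => affExt V i a
  D := D0 (fun a i => affExt V i a)
  hD0 := fun F hF a ha => D0_zero (fun a i => affExt V i a) F hF a ha
  hD1 := fun F hF a ha => by
    obtain ⟨e, he⟩ := D0_sign F hF a ha
    exact right_ne_zero_of_mul (he V hV).ne'
  h1 := fun a => rfl

theorem stmt_10 (d n : ℕ) (hd : 1 ≤ d) (hdn : d < n)
    (S : Set (Finset (Fin n))) (hS : ∀ A ∈ S, A.card = d + 1)
    (W : Matrix (Fin d) (Fin n) ℝ) (hW : AffinelyPositive W)
    (hcover : (⋃ A ∈ S, convexHull ℝ ((fun a => fun i => W i a) '' ↑A)) =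
      convexHull ℝ (Set.range fun a => fun i => W i a))
    (hdisj : ∀ A ∈ S, ∀ B ∈ S, A ≠ B →
      interior (convexHull ℝ ((fun a => fun i => W i a) '' ↑A)) ∩
        interior (convexHull ℝ ((fun a => fun i => W i a) '' ↑B)) = ∅) :
    ∀ V : Matrix (Fin d) (Fin n) ℝ, AffinelyPositive V →
      ((⋃ A ∈ S, convexHull ℝ ((fun a => fun i => V i a) '' ↑A)) =
        convexHull ℝ (Set.range fun a => fun i => V i a)) ∧
      ∀ A ∈ S, ∀ B ∈ S, A ≠ B →
        interior (convexHull ℝ ((fun a => fun i => V i a) '' ↑A)) ∩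
          interior (convexHull ℝ ((fun a => fun i => V i a) '' ↑B)) = ∅ := by
  intro V hV
  refine tile_transfer (mkCfg W hW) (mkCfg V hV) hdn ?_ S hS _ _ ?_ ?_ hcover hdisj
  · intro F hF j hj
    obtain ⟨e, he⟩ := D0_sign F hF j hj
    have h1 := he W hW
    have h2 := he V hV
    change sg (D0 (fun a i => affExt W i a) F (affExt W · j)) =
      sg (D0 (fun a i => affExt V i a) F (affExt V · j))
    unfold sg
    rcases Int.units_eq_one_or e with rfl | rfl
    · simp only [Units.val_one, Int.cast_one, one_mul] at h1 h2
      rw [if_pos h1, if_pos h2]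
    · simp only [Units.val_neg, Units.val_one, Int.cast_neg, Int.cast_one, neg_mul, one_mul] at h1 h2
      rw [if_neg (by linarith), if_neg (by linarith)]
  · intro a
    funext i
    refine Fin.cases ?_ (fun k => ?_) i <;> rfl
  · intro a
    funext i
    refine Fin.cases ?_ (fun k => ?_) i <;> rfl
end

section
/- Let 1 ≤ d < n, let R = r(a_1,…,a_{d+1}) be a snug rectangle in the d-element subsets of [n−1], and let X = {x_1 < x_2 < … < x_{d+1}} be a (d+1)-element subset of [n−1] with d-packet P. Then the intersection R ∩ P is one of the following: the empty set, the singleton {X∖{x_1}}, the singleton {X∖{x_{d+1}}}, or a pair {X∖{x_i}, X∖{x_{i+1}}} for some 1 ≤ i ≤ d. -/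
/-- The snug rectangle `r(a₁,…,a_{k+1})`: all `k`-element subsets `{y₁<…<y_k}`
with `aᵢ ≤ yᵢ ≤ a_{i+1} - 1`. -/
def snugRect {k : ℕ} (a : Fin (k + 1) → ℕ) : Set (Finset ℕ) :=
  {Y | ∃ y : Fin k → ℕ,
    (∀ i : Fin k, a i.castSucc ≤ y i ∧ y i + 1 ≤ a i.succ) ∧
    Y = Finset.image y Finset.univ}

def QQ {d : ℕ} (a x : Fin (d + 1) → ℕ) (i : Fin (d + 1)) : Prop :=
  ∀ j : Fin d, a j.castSucc ≤ x (i.succAbove j) ∧ x (i.succAbove j) + 1 ≤ a j.succ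

lemma erase_eq {d : ℕ} (x : Fin (d + 1) → ℕ) (hx : StrictMono x) (i : Fin (d + 1)) :
    (Finset.image x Finset.univ).erase (x i) =
      Finset.image (x ∘ i.succAbove) Finset.univ := by
  ext y
  simp only [Finset.mem_erase, Finset.mem_image, Finset.mem_univ, true_and, Function.comp]
  constructor
  · rintro ⟨h, k, rfl⟩
    have hk : k ≠ i := fun e => h (by rw [e])
    obtain ⟨j, rfl⟩ := Fin.exists_succAbove_eq hk
    exact ⟨j, rfl⟩
  · rintro ⟨j, rfl⟩
    exact ⟨fun e => Fin.succAbove_ne i j (hx.injective e), _, rfl⟩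

lemma mem_iff {d : ℕ} (a x : Fin (d + 1) → ℕ) (ha : StrictMono a) (hx : StrictMono x)
    (Y : Finset ℕ) :
    Y ∈ snugRect a ∩ {Y : Finset ℕ | Y ⊆ Finset.image x Finset.univ ∧ Y.card = d} ↔
      ∃ i, QQ a x i ∧ Y = (Finset.image x Finset.univ).erase (x i) := by
  have hc : (Finset.image x Finset.univ).card = d + 1 := by
    rw [Finset.card_image_of_injective _ hx.injective]; simp
  constructor
  · rintro ⟨⟨y, hy, hY⟩, hs, hcard⟩
    have hex : ∃ i, Y = (Finset.image x Finset.univ).erase (x i) := by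
      have h1 : (Finset.image x Finset.univ \ Y).card = 1 := by
        rw [Finset.card_sdiff_of_subset hs]; omega
      obtain ⟨z, hz⟩ := Finset.card_eq_one.mp h1
      have hz1 : z ∈ Finset.image x Finset.univ \ Y := by rw [hz]; simp
      rw [Finset.mem_sdiff] at hz1
      obtain ⟨i, -, rfl⟩ := Finset.mem_image.mp hz1.1
      refine ⟨i, Finset.eq_of_subset_of_card_le ?_ ?_⟩
      · intro w hw
        exact Finset.mem_erase.mpr ⟨fun e => hz1.2 (e ▸ hw), hs hw⟩
      · rw [Finset.card_erase_of_mem hz1.1]; omega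
    obtain ⟨i, hi⟩ := hex
    refine ⟨i, ?_, hi⟩
    have hym : StrictMono y := by
      intro p q hpq
      have h1 := (hy p).2
      have h2 := (hy q).1
      have h3 : a p.succ ≤ a q.castSucc := ha.monotone (by
        rw [Fin.le_def]; simp; exact hpq)
      omega
    have hxm : StrictMono (x ∘ i.succAbove) := hx.comp (Fin.strictMono_succAbove i)
    have hr : y = x ∘ i.succAbove := by
      apply (StrictMono.range_inj hym hxm).mp
      have := hY.symm.trans (hi.trans (erase_eq x hx i))
      have h2 := congrArg (fun s : Finset ℕ => (s : Set ℕ)) this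
      simp only [Finset.coe_image, Finset.coe_univ, Set.image_univ] at h2
      exact h2
    intro j
    have := hy j
    rw [hr] at this
    exact this
  · rintro ⟨i, hq, rfl⟩
    refine ⟨⟨x ∘ i.succAbove, hq, erase_eq x hx i⟩, Finset.erase_subset _ _, ?_⟩
    rw [Finset.card_erase_of_mem (by simp), hc]; rfl

lemma QQ_iff {d : ℕ} (a x : Fin (d + 1) → ℕ) (i : Fin (d + 1)) :
    QQ a x i ↔ ∀ j : Fin d,
      (j.val < i.val → a j.castSucc ≤ x j.castSucc ∧ x j.castSucc + 1 ≤ a j.succ) ∧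
      (i.val ≤ j.val → a j.castSucc ≤ x j.succ ∧ x j.succ + 1 ≤ a j.succ) := by
  unfold QQ
  refine forall_congr' fun j => ?_
  by_cases h : j.val < i.val
  · rw [Fin.succAbove_of_castSucc_lt _ _ (by rw [Fin.lt_def]; exact h)]
    simp [h]
  · rw [Fin.succAbove_of_le_castSucc _ _ (by rw [Fin.le_def]; simpa using h)]
    simp [h]; omega

lemma QQ_adj {d : ℕ} (a x : Fin (d + 1) → ℕ) {i k : Fin (d + 1)}
    (hi : QQ a x i) (hk : QQ a x k) (h : i < k) :
    ∃ j : Fin d, i = j.castSucc ∧ k = j.succ := by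
  rw [QQ_iff] at hi hk
  rw [Fin.lt_def] at h
  have hkd := k.isLt
  refine ⟨⟨i.val, by omega⟩, by ext; simp, ?_⟩
  by_contra hne
  have hne' : k.val ≠ i.val + 1 := fun e => hne (by ext; simpa using e)
  have h1 := ((hi ⟨i.val, by omega⟩).2 le_rfl).2
  have h2 := ((hk ⟨i.val + 1, by omega⟩).1 (by simp; omega)).1
  simp only [Fin.succ_mk, Fin.castSucc_mk] at h1 h2
  omega

lemma QQ_ext {d : ℕ} (a x : Fin (d + 1) → ℕ) (hx : StrictMono x) {i : Fin (d + 1)}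
    (hi : QQ a x i) (h0 : i ≠ 0) (hl : i ≠ Fin.last d) :
    ∃ j : Fin d, QQ a x j.castSucc ∧ QQ a x j.succ := by
  have hid := i.isLt
  have h0' : i.val ≠ 0 := fun e => h0 (by ext; simpa using e)
  have hl' : i.val ≠ d := fun e => hl (by ext; simpa using e)
  obtain ⟨m, hm⟩ : ∃ m, i.val = m + 1 := ⟨i.val - 1, by omega⟩
  have hi' := (QQ_iff a x i).mp hi
  have h1 := (hi' ⟨m, by omega⟩).1 (by simp; omega)
  have h2 := (hi' ⟨m + 1, by omega⟩).2 (by simp; omega)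
  have x1 : x ⟨m, by omega⟩ < x ⟨m + 1, by omega⟩ := hx (by simp)
  have x2 : x ⟨m + 1, by omega⟩ < x ⟨m + 1 + 1, by omega⟩ := hx (by simp)
  simp only [Fin.succ_mk, Fin.castSucc_mk] at h1 h2
  by_cases hc : x ⟨m + 1, by omega⟩ < a ⟨m + 1, by omega⟩
  · refine ⟨⟨m, by omega⟩, ?_, ?_⟩
    · rw [QQ_iff]
      intro j
      refine ⟨fun hj => (hi' j).1 (by simp at hj; omega), fun hj => ?_⟩
      simp at hj
      by_cases e : j.val = m
      · have hmd : m < d := by omega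
        have ej : j = ⟨m, hmd⟩ := Fin.ext e
        rw [ej]
        simp only [Fin.succ_mk, Fin.castSucc_mk]
        omega
      · exact (hi' j).2 (by omega)
    · convert hi using 1
      ext; simp [hm]
  · refine ⟨⟨m + 1, by omega⟩, ?_, ?_⟩
    · convert hi using 1
      ext; simp [hm]
    · rw [QQ_iff]
      intro j
      refine ⟨fun hj => ?_, fun hj => (hi' j).2 (by simp at hj; omega)⟩
      simp at hj
      by_cases e : j.val = m + 1
      · have hmd : m + 1 < d := by omega
        have ej : j = ⟨m + 1, hmd⟩ := Fin.ext e
        rw [ej]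
        simp only [Fin.succ_mk, Fin.castSucc_mk]
        omega
      · exact (hi' j).1 (by omega)

theorem stmt_12 (d n : ℕ) (hd : 1 ≤ d) (hdn : d < n)
    (a : Fin (d + 1) → ℕ) (ha : StrictMono a) (hab : ∀ i, 1 ≤ a i ∧ a i ≤ n)
    (x : Fin (d + 1) → ℕ) (hx : StrictMono x)
    (hxb : ∀ i, 1 ≤ x i ∧ x i ≤ n - 1) :
    snugRect a ∩
      {Y : Finset ℕ | Y ⊆ Finset.image x Finset.univ ∧ Y.card = d} = ∅ ∨
    snugRect a ∩
      {Y : Finset ℕ | Y ⊆ Finset.image x Finset.univ ∧ Y.card = d} =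
        {(Finset.image x Finset.univ).erase (x 0)} ∨
    snugRect a ∩
      {Y : Finset ℕ | Y ⊆ Finset.image x Finset.univ ∧ Y.card = d} =
        {(Finset.image x Finset.univ).erase (x (Fin.last d))} ∨
    ∃ i : Fin d,
      snugRect a ∩
        {Y : Finset ℕ | Y ⊆ Finset.image x Finset.univ ∧ Y.card = d} =
          {(Finset.image x Finset.univ).erase (x i.castSucc),
            (Finset.image x Finset.univ).erase (x i.succ)} := by
  have key := mem_iff a x ha hx
  by_cases hp : ∃ j : Fin d, QQ a x j.castSucc ∧ QQ a x j.succ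
  · obtain ⟨j, hj1, hj2⟩ := hp
    refine Or.inr (Or.inr (Or.inr ⟨j, ?_⟩))
    ext Y
    rw [key]
    simp only [Set.mem_insert_iff, Set.mem_singleton_iff]
    constructor
    · rintro ⟨i, hi, rfl⟩
      have : i = j.castSucc ∨ i = j.succ := by
        rcases lt_trichotomy i j.castSucc with h | h | h
        · obtain ⟨k, hk1, hk2⟩ := QQ_adj a x hi hj2 (h.trans Fin.castSucc_lt_succ)
          have : k = j := (Fin.succ_injective _ hk2).symm
          subst this; exact Or.inl hk1
        · exact Or.inl h
        · obtain ⟨k, hk1, hk2⟩ := QQ_adj a x hj1 hi h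
          have : k = j := (Fin.castSucc_injective _ hk1).symm
          subst this; exact Or.inr hk2
      rcases this with rfl | rfl
      · exact Or.inl rfl
      · exact Or.inr rfl
    · rintro (rfl | rfl)
      · exact ⟨_, hj1, rfl⟩
      · exact ⟨_, hj2, rfl⟩
  · by_cases he : ∃ i, QQ a x i
    · obtain ⟨i, hi⟩ := he
      have huniq : ∀ k, QQ a x k → k = i := by
        intro k hk
        rcases lt_trichotomy k i with h | h | h
        · obtain ⟨j, rfl, rfl⟩ := QQ_adj a x hk hi h
          exact absurd ⟨j, hk, hi⟩ hp
        · exact h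
        · obtain ⟨j, rfl, rfl⟩ := QQ_adj a x hi hk h
          exact absurd ⟨j, hi, hk⟩ hp
      have hS : snugRect a ∩
          {Y : Finset ℕ | Y ⊆ Finset.image x Finset.univ ∧ Y.card = d} =
          {(Finset.image x Finset.univ).erase (x i)} := by
        ext Y
        rw [key, Set.mem_singleton_iff]
        constructor
        · rintro ⟨k, hk, rfl⟩
          rw [huniq k hk]
        · rintro rfl
          exact ⟨i, hi, rfl⟩
      by_cases h0 : i = 0
      · subst h0; exact Or.inr (Or.inl hS)
      · by_cases hl : i = Fin.last d
        · subst hl; exact Or.inr (Or.inr (Or.inl hS))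
        · exact absurd (QQ_ext a x hx hi h0 hl) hp
    · left
      ext Y
      rw [key]
      simp only [Set.mem_empty_iff_false, iff_false]
      rintro ⟨i, hi, -⟩
      exact he ⟨i, hi⟩
end

section
/- Let 1 ≤ d < n, let W be a snug partition of the d-element subsets of [n−1], and let X = {x_1 < x_2 < … < x_{d+1}} be a (d+1)-element subset of [n−1]. Then exactly one of the following holds: (A) X∖{x_j} and X∖{x_{j−1}} lie in the same block of W for every j with 2 ≤ j ≤ d+1 and j ≡ d+1 (mod 2), and every other element of the d-packet of X lies in a block of W containing no other element of the packet; or (B) X∖{x_j} and X∖{x_{j−1}} lie in the same block of W for every j with 2 ≤ j ≤ d and j ≡ d (mod 2), and every other element of the d-packet of X (in particular X∖{x_{d+1}}) lies in a block of W containing no other element of the packet. -/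
/-- `B` is a snug rectangle of `k`-subsets of `[n-1]`, with parameters in `[n]`. -/
def IsSnugRect (n k : ℕ) (B : Set (Finset ℕ)) : Prop :=
  ∃ a : Fin (k + 1) → ℕ, StrictMono a ∧ (∀ i, 1 ≤ a i ∧ a i ≤ n) ∧ B = snugRect a

/-- A snug partition of the `k`-element subsets of `[n-1] = {1,…,n-1}`. -/
def SnugPartition (n k : ℕ) (W : Set (Set (Finset ℕ))) : Prop :=
  (∀ B ∈ W, IsSnugRect n k B) ∧
  ∀ Y : Finset ℕ, Y ⊆ Finset.Icc 1 (n - 1) → Y.card = k →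
    ∃! B, B ∈ W ∧ Y ∈ B

/-- `Y` and `Z` lie in a common block of `W`. -/
def SameBlock (W : Set (Set (Finset ℕ))) (Y Z : Finset ℕ) : Prop :=
  ∃ B ∈ W, Y ∈ B ∧ Z ∈ B

/-- `Y` lies in a block of `W` containing no other element of the `d`-packet
of `X`. -/
def AloneInPacket (d : ℕ) (W : Set (Set (Finset ℕ))) (X Y : Finset ℕ) : Prop :=
  ∀ B ∈ W, Y ∈ B → ∀ Z, Z ⊆ X → Z.card = d → Z ∈ B → Z = Y

/-- The `(d+1)`-set `{x 1, …, x (d+1)}` (1-based indexing). -/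
def stdX (x : ℕ → ℕ) (d : ℕ) : Finset ℕ :=
  Finset.image x (Finset.Icc 1 (d + 1))

def zsel (x : ℕ → ℕ) (i k : ℕ) : ℕ := x (if k < i then k else k + 1)

theorem zsel_image (d : ℕ) (x : ℕ → ℕ)
    (hx : ∀ i j, 1 ≤ i → i < j → j ≤ d + 1 → x i < x j) (i : ℕ) (hi : 1 ≤ i) (hi' : i ≤ d + 1) :
    (stdX x d).erase (x i) = Finset.image (fun k : Fin d => zsel x i (k.val + 1)) Finset.univ := by
  have hinj : ∀ p q, 1 ≤ p → p ≤ d + 1 → 1 ≤ q → q ≤ d + 1 → x p = x q → p = q := by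
    intro p q h1 h2 h3 h4 h
    rcases lt_trichotomy p q with h5 | h5 | h5
    · have := hx p q h1 h5 h4; omega
    · exact h5
    · have := hx q p h3 h5 h2; omega
  ext v
  simp only [stdX, zsel, Finset.mem_erase, Finset.mem_image, Finset.mem_Icc, Finset.mem_univ,
    true_and]
  constructor
  · rintro ⟨hne, m, ⟨h1, h2⟩, rfl⟩
    have hm : m ≠ i := fun h => hne (by rw [h])
    rcases lt_or_gt_of_ne hm with h | h
    · refine ⟨⟨m - 1, by omega⟩, ?_⟩
      have : m - 1 + 1 = m := by omega
      simp [this, h]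
    · refine ⟨⟨m - 2, by omega⟩, ?_⟩
      have : m - 2 + 1 = m - 1 := by omega
      have h' : ¬ (m - 1 < i) := by omega
      have h'' : m - 1 + 1 = m := by omega
      simp [this, h', h'']
  · rintro ⟨⟨k, hk⟩, rfl⟩
    dsimp only
    split_ifs with h
    · refine ⟨fun h' => ?_, k + 1, ⟨by omega, by omega⟩, rfl⟩
      have := hinj _ _ (by omega) (by omega) (by omega) (by omega) h'
      omega
    · refine ⟨fun h' => ?_, k + 1 + 1, ⟨by omega, by omega⟩, rfl⟩
      have := hinj _ _ (by omega) (by omega) (by omega) (by omega) h'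
      omega

theorem snug_mem_iff (d : ℕ) (x : ℕ → ℕ)
    (hx : ∀ i j, 1 ≤ i → i < j → j ≤ d + 1 → x i < x j) (n : ℕ) (B : Set (Finset ℕ))
    (hB : IsSnugRect n d B) :
    ∃ b : ℕ → ℕ, ∀ i, 1 ≤ i → i ≤ d + 1 → ((stdX x d).erase (x i) ∈ B ↔
      ∀ k, 1 ≤ k → k ≤ d → b k ≤ zsel x i k ∧ zsel x i k < b (k + 1)) := by
  obtain ⟨a, ha, -, rfl⟩ := hB
  refine ⟨fun k => if h : k - 1 < d + 1 then a ⟨k - 1, h⟩ else 0, fun i hi hi' => ?_⟩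
  rw [zsel_image d x hx i hi hi']
  have key : ∀ y : Fin d → ℕ, (∀ i : Fin d, a i.castSucc ≤ y i ∧ y i + 1 ≤ a i.succ) →
      StrictMono y := by
    intro y hy p q hpq
    have h1 := (hy p).2
    have h2 := (hy q).1
    have h3 : a p.succ ≤ a q.castSucc := ha.monotone (by
      rw [Fin.le_def]; simpa using hpq)
    omega
  have hz : StrictMono (fun k : Fin d => zsel x i (k.val + 1)) := by
    intro p q hpq
    have hpq' : p.val < q.val := hpq
    have := q.2
    simp only [zsel]
    apply hx <;> split_ifs <;> omega
  constructor
  · rintro ⟨y, hy, hyz⟩ k hk hk'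
    have e : (fun k : Fin d => zsel x i (k.val + 1)) = y := by
      apply (StrictMono.range_inj hz (key y hy)).1
      have := congrArg (fun s : Finset ℕ => (s : Set ℕ)) hyz
      simpa using this
    subst e
    have := hy ⟨k - 1, by omega⟩
    have e1 : k - 1 + 1 = k := by omega
    simp only [Fin.castSucc_mk, Fin.succ_mk, e1] at this
    have h1 : k - 1 < d + 1 := by omega
    have h2 : k < d + 1 := by omega
    simp only [Nat.add_sub_cancel, h1, h2, dif_pos]
    omega
  · intro h
    refine ⟨_, fun k => ?_, rfl⟩
    have := h (k.val + 1) (by omega) (by omega)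
    have h1 : k.val + 1 - 1 < d + 1 := by omega
    have h2 : k.val + 1 + 1 - 1 < d + 1 := by omega
    simp only [h1, h2, dif_pos] at this
    exact ⟨this.1, this.2⟩

theorem stmt_13 (d n : ℕ) (hd : 1 ≤ d) (hdn : d < n)
    (W : Set (Set (Finset ℕ))) (hW : SnugPartition n d W)
    (x : ℕ → ℕ)
    (hx : ∀ i j, 1 ≤ i → i < j → j ≤ d + 1 → x i < x j)
    (hxb : ∀ i, 1 ≤ i → i ≤ d + 1 → 1 ≤ x i ∧ x i ≤ n - 1) :
    Xor'
      ((∀ j, 2 ≤ j → j ≤ d + 1 → j % 2 = (d + 1) % 2 →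
          SameBlock W ((stdX x d).erase (x j)) ((stdX x d).erase (x (j - 1)))) ∧
        ∀ i, 1 ≤ i → i ≤ d + 1 →
          (¬∃ j, 2 ≤ j ∧ j ≤ d + 1 ∧ j % 2 = (d + 1) % 2 ∧ (i = j ∨ i = j - 1)) →
          AloneInPacket d W (stdX x d) ((stdX x d).erase (x i)))
      ((∀ j, 2 ≤ j → j ≤ d → j % 2 = d % 2 →
          SameBlock W ((stdX x d).erase (x j)) ((stdX x d).erase (x (j - 1)))) ∧
        ∀ i, 1 ≤ i → i ≤ d + 1 →
          (¬∃ j, 2 ≤ j ∧ j ≤ d ∧ j % 2 = d % 2 ∧ (i = j ∨ i = j - 1)) →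
          AloneInPacket d W (stdX x d) ((stdX x d).erase (x i))) := by
  have hYsub : ∀ i, 1 ≤ i → i ≤ d + 1 → (stdX x d).erase (x i) ⊆ Finset.Icc 1 (n - 1) := by
    intro i _ _ v hv
    have hv := Finset.mem_of_mem_erase hv
    simp only [stdX, Finset.mem_image, Finset.mem_Icc] at hv
    obtain ⟨m, ⟨h1, h2⟩, rfl⟩ := hv
    exact Finset.mem_Icc.2 (hxb m h1 h2)
  have hXcard : (stdX x d).card = d + 1 := by
    unfold stdX
    rw [Finset.card_image_of_injOn]
    · simp
    · intro p hp q hq h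
      simp only [Finset.coe_Icc, Set.mem_Icc] at hp hq
      rcases lt_trichotomy p q with h5 | h5 | h5
      · have := hx p q hp.1 h5 hq.2; omega
      · exact h5
      · have := hx q p hq.1 h5 hp.2; omega
  have hmemX : ∀ i, 1 ≤ i → i ≤ d + 1 → x i ∈ stdX x d := fun i h1 h2 =>
    Finset.mem_image_of_mem x (Finset.mem_Icc.2 ⟨h1, h2⟩)
  have hYcard : ∀ i, 1 ≤ i → i ≤ d + 1 → ((stdX x d).erase (x i)).card = d := by
    intro i h1 h2
    rw [Finset.card_erase_of_mem (hmemX i h1 h2), hXcard]; rfl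
  have hZ : ∀ Z, Z ⊆ stdX x d → Z.card = d →
      ∃ k, 1 ≤ k ∧ k ≤ d + 1 ∧ Z = (stdX x d).erase (x k) := by
    intro Z hZ hc
    have : (stdX x d \ Z).card = 1 := by
      rw [Finset.card_sdiff_of_subset hZ, hXcard, hc]; omega
    obtain ⟨v, hv⟩ := Finset.card_eq_one.1 this
    have hvm : v ∈ stdX x d \ Z := by rw [hv]; simp
    have hvX := (Finset.mem_sdiff.1 hvm)
    have hvX' := hvX.1
    simp only [stdX, Finset.mem_image, Finset.mem_Icc] at hvX'
    obtain ⟨k, ⟨h1, h2⟩, rfl⟩ := hvX'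
    refine ⟨k, h1, h2, Finset.eq_of_subset_of_card_le ?_ ?_⟩
    · intro w hw
      refine Finset.mem_erase.2 ⟨?_, hZ hw⟩
      rintro rfl
      exact hvX.2 hw
    · rw [hYcard k h1 h2, hc]
  have hex := fun i h1 h2 => (hW.2 _ (hYsub i h1 h2) (hYcard i h1 h2))
  have huniq : ∀ i, 1 ≤ i → i ≤ d + 1 → ∀ B ∈ W, ∀ C ∈ W, (stdX x d).erase (x i) ∈ B →
      (stdX x d).erase (x i) ∈ C → B = C := fun i h1 h2 B hB C hC hb hc =>
    (hex i h1 h2).unique ⟨hB, hb⟩ ⟨hC, hc⟩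
  have F3 : ∀ B ∈ W, ∀ i k, 1 ≤ i → i < k → k ≤ d + 1 → (stdX x d).erase (x i) ∈ B →
      (stdX x d).erase (x k) ∈ B → k = i + 1 := by
    intro B hB i k hi hik hk h1 h2
    by_contra hne
    obtain ⟨b, hb⟩ := snug_mem_iff d x hx n B (hW.1 B hB)
    have e1 := ((hb i hi (by omega)).1 h1 i hi (by omega)).2
    have e2 := ((hb k (by omega) hk).1 h2 (i + 1) (by omega) (by omega)).1
    have c : i + 1 < k := by omega
    simp only [zsel, lt_irrefl, if_false] at e1
    simp only [zsel, c, if_true] at e2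
    omega
  have F1 : ∀ i, 2 ≤ i → i ≤ d →
      SameBlock W ((stdX x d).erase (x i)) ((stdX x d).erase (x (i - 1))) ∨
      SameBlock W ((stdX x d).erase (x (i + 1))) ((stdX x d).erase (x i)) := by
    intro i hi hi'
    obtain ⟨B, ⟨hB, hm⟩, -⟩ := hex i (by omega) (by omega)
    obtain ⟨b, hb⟩ := snug_mem_iff d x hx n B (hW.1 B hB)
    have e := (hb i (by omega) (by omega)).1 hm
    by_cases hc : b i ≤ x i
    · right
      refine ⟨B, hB, ?_, hm⟩
      rw [hb (i + 1) (by omega) (by omega)]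
      intro k hk hk'
      have ek := e k hk hk'
      by_cases hki : k = i
      · subst hki
        have := hx k (k + 1) hk (by omega) (by omega)
        simp only [zsel, lt_irrefl, if_false] at ek
        simp only [zsel, Nat.lt_succ_self, if_true]
        omega
      · have : (k < i + 1) = (k < i) := by apply propext; omega
        simp only [zsel, this]
        exact ek
    · left
      refine ⟨B, hB, hm, ?_⟩
      rw [hb (i - 1) (by omega) (by omega)]
      intro k hk hk'
      have ek := e k hk hk'
      by_cases hki : k = i - 1
      · have hi2 : i = k + 1 := by omega
        subst hi2
        have := hx k (k + 1) hk (by omega) (by omega)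
        simp only [zsel, Nat.lt_succ_self, if_true] at ek
        simp only [zsel, Nat.add_sub_cancel, lt_irrefl, if_false]
        omega
      · have : (k < i - 1) = (k < i) := by apply propext; omega
        simp only [zsel, this]
        exact ek
  have F2 : ∀ i, 2 ≤ i → i ≤ d →
      SameBlock W ((stdX x d).erase (x i)) ((stdX x d).erase (x (i - 1))) →
      SameBlock W ((stdX x d).erase (x (i + 1))) ((stdX x d).erase (x i)) → False := by
    rintro i hi hi' ⟨B, hB, h1, h2⟩ ⟨C, hC, h3, h4⟩
    have := huniq i (by omega) (by omega) B hB C hC h1 h4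
    subst this
    have := F3 B hB (i - 1) (i + 1) (by omega) (by omega) (by omega) h2 h3
    omega
  have F4 : ∀ i, 1 ≤ i → i ≤ d + 1 →
      (2 ≤ i → ¬ SameBlock W ((stdX x d).erase (x i)) ((stdX x d).erase (x (i - 1)))) →
      (i ≤ d → ¬ SameBlock W ((stdX x d).erase (x (i + 1))) ((stdX x d).erase (x i))) →
      AloneInPacket d W (stdX x d) ((stdX x d).erase (x i)) := by
    intro i hi hi' hl hr B hB hm Z hZs hZc hZm
    obtain ⟨k, hk, hk', rfl⟩ := hZ Z hZs hZc
    rcases lt_trichotomy i k with h | h | h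
    · have := F3 B hB i k hi h hk' hm hZm
      subst this
      exact absurd ⟨B, hB, hZm, hm⟩ (hr (by omega))
    · rw [h]
    · have := F3 B hB k i hk h hi' hZm hm
      subst this
      exact absurd ⟨B, hB, hm, hZm⟩ (hl (by omega))
  have F5 : ¬ (SameBlock W ((stdX x d).erase (x (d + 1))) ((stdX x d).erase (x d)) ∧
      AloneInPacket d W (stdX x d) ((stdX x d).erase (x (d + 1)))) := by
    rintro ⟨⟨B, hB, h1, h2⟩, h⟩
    have := h B hB h1 _ (Finset.erase_subset _ _) (hYcard d hd (by omega)) h2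
    have hlt := hx d (d + 1) hd (by omega) le_rfl
    have hm : x d ∈ (stdX x d).erase (x (d + 1)) :=
      Finset.mem_erase.2 ⟨by omega, hmemX d hd (by omega)⟩
    rw [← this] at hm
    simp at hm
  -- abstract the pair relation
  generalize hQ : (fun j => SameBlock W ((stdX x d).erase (x j)) ((stdX x d).erase (x (j - 1)))) = Q
    at *
  have hQ' : ∀ j, SameBlock W ((stdX x d).erase (x j)) ((stdX x d).erase (x (j - 1))) = Q j :=
    fun j => by rw [← hQ]
  have hQ'' : ∀ j, SameBlock W ((stdX x d).erase (x (j + 1))) ((stdX x d).erase (x j)) = Q (j + 1) :=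
    fun j => by rw [← hQ]; rfl
  simp only [hQ', hQ''] at F1 F2 F4 F5 ⊢
  have par : ∀ m, m + 2 ≤ d + 1 → (Q (d + 1 - m) ↔ (Q (d + 1) ↔ m % 2 = 0)) := by
    intro m
    induction m with
    | zero => intro _; simp
    | succ m ih =>
      intro hm
      have ih := ih (by omega)
      have e : d + 1 - (m + 1) + 1 = d + 1 - m := by omega
      have f1 := F1 (d + 1 - (m + 1)) (by omega) (by omega)
      have f2 := F2 (d + 1 - (m + 1)) (by omega) (by omega)
      rw [e] at f1 f2
      have hpar : (m + 1) % 2 = 0 ↔ ¬ (m % 2 = 0) := by omega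
      rw [hpar]
      tauto
  have par' : ∀ j, 2 ≤ j → j ≤ d + 1 → (Q j ↔ (Q (d + 1) ↔ j % 2 = (d + 1) % 2)) := by
    intro j h1 h2
    have := par (d + 1 - j) (by omega)
    have e : d + 1 - (d + 1 - j) = j := by omega
    rw [e] at this
    rw [this]
    have : (d + 1 - j) % 2 = 0 ↔ j % 2 = (d + 1) % 2 := by omega
    rw [this]
  by_cases hq : Q (d + 1)
  · left
    refine ⟨⟨fun j h1 h2 h3 => (par' j h1 h2).2 (by tauto), fun i h1 h2 h3 => ?_⟩, ?_⟩
    · refine F4 i h1 h2 (fun h h' => h3 ⟨i, h, h2, ?_, Or.inl rfl⟩)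
        (fun h h' => h3 ⟨i + 1, by omega, by omega, ?_, Or.inr rfl⟩)
      · exact ((par' i h h2).1 h').1 hq
      · exact ((par' (i + 1) (by omega) (by omega)).1 h').1 hq
    · rintro ⟨-, h⟩
      refine F5 ⟨hq, h (d + 1) (by omega) le_rfl ?_⟩
      rintro ⟨j, h1, h2, h3, h4⟩
      omega
  · right
    refine ⟨⟨fun j h1 h2 h3 => (par' j h1 (by omega)).2 ⟨fun h => absurd h hq, fun h => by omega⟩,
      fun i h1 h2 h3 => ?_⟩, fun h => hq (h.1 (d + 1) (by omega) le_rfl rfl)⟩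
    have hne : ∀ j, 2 ≤ j → j ≤ d + 1 → Q j → j ≤ d ∧ j % 2 = d % 2 := by
      intro j h1 h2 h
      have h4 : ¬ (j % 2 = (d + 1) % 2) := fun h5 => hq (((par' j h1 h2).1 h).2 h5)
      have : j ≠ d + 1 := by rintro rfl; exact h4 rfl
      omega
    refine F4 i h1 h2 (fun h h' => h3 ⟨i, h, ?_, ?_, Or.inl rfl⟩)
        (fun h h' => h3 ⟨i + 1, by omega, ?_, ?_, Or.inr rfl⟩)
    · exact (hne i h h2 h').1
    · exact (hne i h h2 h').2
    · exact (hne (i + 1) (by omega) (by omega) h').1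
    · exact (hne (i + 1) (by omega) (by omega) h').2
end

section
/- Let 1 ≤ d < n and let W be a snug partition of the d-element subsets of [n−1]. Define the inversion set I(W) to be the set of all (d+1)-element subsets X = {x_1 < … < x_{d+1}} of [n−1] such that X∖{x_{d+1}} and X∖{x_d} lie in the same block of W. Then I(W) is superconsistent: for every (d+2)-element subset J of [n−1], the intersection of I(W) with the (d+1)-packet of J, ordered lexicographically, is either empty, the whole packet, an initial segment of odd length, or a final segment whose length is congruent to d modulo 2. -/
/-- The inversion set of a snug partition `W`: the `(d+1)`-element subsets
`X = {x₁<…<x_{d+1}}` of `[n-1]` such that `X \ {x_{d+1}}` and `X \ {x_d}`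
(erase the largest, resp. second largest, element) lie in the same block. -/
def InvSetP (n d : ℕ) (W : Set (Set (Finset ℕ))) : Set (Finset ℕ) :=
  {X | X ⊆ Finset.Icc 1 (n - 1) ∧ X.card = d + 1 ∧
    SameBlock W (X.erase (X.sup id)) (X.erase ((X.erase (X.sup id)).sup id))}

/-- Lexicographic comparison of finite sets via their increasingly sorted lists. -/
def lexLtN (A B : Finset ℕ) : Prop :=
  List.Lex (· < ·) (A.sort (· ≤ ·)) (B.sort (· ≤ ·))

namespace Snug

def dl (k : ℕ) (x : ℕ → ℕ) : ℕ → ℕ := fun t => x (if t < k then t else t + 1)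

def V (n d : ℕ) (y : ℕ → ℕ) : Prop := StrictMono y ∧ ∀ t < d, 1 ≤ y t ∧ y t ≤ n - 1

def C (d : ℕ) (y : ℕ → ℕ) : Finset ℕ := (Finset.range d).image y

def In (d : ℕ) (a y : ℕ → ℕ) : Prop := ∀ t < d, a t ≤ y t ∧ y t + 1 ≤ a (t + 1)

theorem V_dl {n d : ℕ} {x : ℕ → ℕ} (h : V n (d + 1) x) (k : ℕ) : V n d (dl k x) := by
  refine ⟨?_, ?_⟩
  · intro s t hst
    apply h.1
    split_ifs <;> omega
  · intro t ht
    apply h.2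
    split_ifs <;> omega

theorem dl_dl (x : ℕ → ℕ) (i k : ℕ) (h : i < k + 1) :
    dl i (dl (k + 1) x) = dl k (dl i x) := by
  funext t
  unfold dl
  congr 1
  split_ifs <;> omega

theorem C_erase {d k : ℕ} {x : ℕ → ℕ} (hx : StrictMono x) (hk : k ≤ d) :
    (C (d + 1) x).erase (x k) = C d (dl k x) := by
  ext v
  simp only [C, Finset.mem_erase, Finset.mem_image, Finset.mem_range, dl]
  constructor
  · rintro ⟨hv, t, ht, rfl⟩
    have htk : t ≠ k := fun h => hv (by rw [h])
    by_cases h : t < k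
    · exact ⟨t, by omega, by rw [if_pos h]⟩
    · refine ⟨t - 1, by omega, ?_⟩
      rw [if_neg (by omega)]
      congr 1
      omega
  · rintro ⟨t, ht, rfl⟩
    refine ⟨?_, _, ?_, rfl⟩
    · intro h
      have := hx.injective h
      split_ifs at this <;> omega
    · split_ifs <;> omega

theorem C_sup {d : ℕ} {x : ℕ → ℕ} (hx : StrictMono x) : (C (d + 1) x).sup id = x d := by
  apply le_antisymm
  · apply Finset.sup_le
    intro v hv
    simp only [C, Finset.mem_image, Finset.mem_range] at hv
    obtain ⟨t, ht, rfl⟩ := hv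
    exact hx.monotone (by omega)
  · exact Finset.le_sup (f := id) (Finset.mem_image_of_mem _ (by simp))

theorem C_card {d : ℕ} {x : ℕ → ℕ} (hx : StrictMono x) : (C d x).card = d := by
  rw [C, Finset.card_image_of_injective _ hx.injective, Finset.card_range]

theorem C_sub {n d : ℕ} {x : ℕ → ℕ} (hx : V n d x) : C d x ⊆ Finset.Icc 1 (n - 1) := by
  intro v hv
  simp only [C, Finset.mem_image, Finset.mem_range] at hv
  obtain ⟨t, ht, rfl⟩ := hv
  exact Finset.mem_Icc.2 (hx.2 t ht)

theorem mem_rect {d : ℕ} (a : Fin (d + 1) → ℕ) :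
    ∃ a' : ℕ → ℕ, ∀ y : ℕ → ℕ, StrictMono y → (C d y ∈ snugRect a ↔ In d a' y) := by
  refine ⟨fun t => if h : t < d + 1 then a ⟨t, h⟩ else 0, ?_⟩
  intro y hy
  have hC : C d y = Finset.image (fun i : Fin d => y i) Finset.univ := by
    ext v
    simp only [C, Finset.mem_image, Finset.mem_range, Finset.mem_univ, true_and]
    constructor
    · rintro ⟨t, ht, rfl⟩; exact ⟨⟨t, ht⟩, rfl⟩
    · rintro ⟨t, rfl⟩; exact ⟨t, t.2, rfl⟩
  constructor
  · rintro ⟨z, hz, he⟩ t ht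
    have hzm : StrictMono z := by
      have : ∀ (i j : ℕ) (hi : i < d) (hj : j < d), i < j → z ⟨i, hi⟩ < z ⟨j, hj⟩ := by
        intro i j hi hj hij
        induction j, hij using Nat.le_induction with
        | base =>
          have h1 := (hz ⟨i, hi⟩).2
          have h2 := (hz ⟨i + 1, hj⟩).1
          simp only [Fin.succ_mk, Fin.castSucc_mk] at h1 h2
          change z ⟨i, hi⟩ < z ⟨i + 1, hj⟩
          omega
        | succ j hij ih =>
          have h0 := ih (by omega)
          have h1 := (hz ⟨j, by omega⟩).2
          have h2 := (hz ⟨j + 1, hj⟩).1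
          simp only [Fin.succ_mk, Fin.castSucc_mk] at h1 h2
          omega
      intro i j hij
      exact this i j i.2 j.2 hij
    have hcard : (C d y).card = d := C_card hy
    have e1 : (fun i : Fin d => y i) = (C d y).orderEmbOfFin hcard :=
      Finset.orderEmbOfFin_unique hcard (fun i => by rw [hC]; exact Finset.mem_image_of_mem _ (Finset.mem_univ _)) (fun i j h => hy h)
    have e2 : z = (C d y).orderEmbOfFin hcard :=
      Finset.orderEmbOfFin_unique hcard (fun i => by rw [he]; exact Finset.mem_image_of_mem _ (Finset.mem_univ _)) hzm
    have e : y t = z ⟨t, ht⟩ := congrFun (e1.trans e2.symm) ⟨t, ht⟩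
    have := hz ⟨t, ht⟩
    beta_reduce
    rw [e, dif_pos (by omega), dif_pos (by omega)]
    exact this
  · intro h
    refine ⟨fun i => y i, ?_, hC⟩
    intro i
    have := h i i.2
    beta_reduce at this
    rw [dif_pos (by omega), dif_pos (by omega)] at this
    exact this

/-- abstract same-block relation -/
def S (d : ℕ) (W : Set (Set (Finset ℕ))) (y z : ℕ → ℕ) : Prop := SameBlock W (C d y) (C d z)

section
variable {n d : ℕ} {W : Set (Set (Finset ℕ))}

theorem key (hW : SnugPartition n d W) {y : ℕ → ℕ} (hy : V n d y) :
    ∃ a : ℕ → ℕ, In d a y ∧ ∀ z, V n d z → (S d W y z ↔ In d a z) := by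
  obtain ⟨B, ⟨hB, hyB⟩, hu⟩ := hW.2 (C d y) (C_sub hy) (C_card hy.1)
  obtain ⟨a, -, -, rfl⟩ := hW.1 B hB
  obtain ⟨a', ha'⟩ := mem_rect a
  refine ⟨a', (ha' y hy.1).1 hyB, ?_⟩
  intro z hz
  rw [← ha' z hz.1]
  constructor
  · rintro ⟨B', h1, h2, h3⟩
    have := hu B' ⟨h1, h2⟩
    rwa [this] at h3
  · intro h
    exact ⟨_, hB, hyB, h⟩

theorem S_symm {y z : ℕ → ℕ} (h : S d W y z) : S d W z y := by
  obtain ⟨B, h1, h2, h3⟩ := h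
  exact ⟨B, h1, h3, h2⟩

theorem S_trans (hW : SnugPartition n d W) {y z w : ℕ → ℕ} (hz : V n d z)
    (h : S d W y z) (h' : S d W z w) : S d W y w := by
  obtain ⟨B, h1, h2, h3⟩ := h
  obtain ⟨B', h1', h2', h3'⟩ := h'
  have := (hW.2 (C d z) (C_sub hz) (C_card hz.1)).unique ⟨h1, h3⟩ ⟨h1', h2'⟩
  subst this
  exact ⟨B, h1, h2, h3'⟩

theorem square (hW : SnugPartition n d W) {y z u w : ℕ → ℕ} (hy : V n d y) (hz : V n d z)
    (hu : V n d u) (hw : V n d w)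
    (h1 : S d W y z) (h2 : S d W y u) (h : ∀ t, w t = y t ∨ w t = z t ∨ w t = u t) :
    S d W y w := by
  obtain ⟨a, ha, hS⟩ := key hW hy
  rw [hS _ hz] at h1
  rw [hS _ hu] at h2
  rw [hS _ hw]
  intro t ht
  rcases h t with h | h | h <;> rw [h]
  · exact ha t ht
  · exact h1 t ht
  · exact h2 t ht

def E (d : ℕ) (W : Set (Set (Finset ℕ))) (x : ℕ → ℕ) (i : ℕ) : Prop :=
  S d W (dl i x) (dl (i + 1) x)

theorem alt (hW : SnugPartition n d W) {x : ℕ → ℕ} (hx : V n (d + 1) x) {i : ℕ}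
    (hi : i + 1 < d) : E d W x i ↔ ¬ E d W x (i + 1) := by
  obtain ⟨a, ha, hS⟩ := key hW (V_dl hx (i + 1))
  have e1 : E d W x i ↔ In d a (dl i x) := by
    rw [← hS _ (V_dl hx i)]
    exact ⟨S_symm, S_symm⟩
  have e2 : E d W x (i + 1) ↔ In d a (dl (i + 2) x) := hS _ (V_dl hx (i + 2))
  rw [e1, e2]
  have hxx : x i < x (i + 1) := hx.1 (by omega)
  have hxy : x (i + 1) < x (i + 1 + 1) := hx.1 (by omega)
  have a1 := ha i (by omega)
  have a2 := ha (i + 1) (by omega)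
  constructor
  · intro h h'
    have b1 := h i (by omega)
    have b2 := h' (i + 1) (by omega)
    simp [dl] at b1 b2
    omega
  · intro h
    by_contra h'
    apply h
    have hlt : a (i + 1) ≤ x (i + 1) := by
      by_contra hc
      apply h'
      intro t ht
      rcases eq_or_ne t i with rfl | hti
      · simp [dl] at a1 a2 ⊢
        omega
      · have : dl i x t = dl (i + 1) x t := by
          unfold dl
          congr 1
          split_ifs <;> omega
        rw [this]
        exact ha t ht
    intro t ht
    rcases eq_or_ne t (i + 1) with rfl | hti
    · simp [dl] at a1 a2 ⊢
      omega
    · have : dl (i + 2) x t = dl (i + 1) x t := by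
        unfold dl
        congr 1
        split_ifs <;> omega
      rw [this]
      exact ha t ht

theorem parity (hW : SnugPartition n d W) {x : ℕ → ℕ} (hx : V n (d + 1) x) (r : ℕ) :
    ∀ i, i + r + 1 = d → (E d W x i ↔ (E d W x (d - 1) ↔ Even r)) := by
  induction r with
  | zero => intro i hi; subst hi; simp
  | succ r ih =>
    intro i hi
    rw [alt hW hx (by omega), ih (i + 1) (by omega), Nat.even_add_one]
    tauto

def ep (d : ℕ) (W : Set (Set (Finset ℕ))) (j : ℕ → ℕ) (k : ℕ) : Prop := E d W (dl k j) (d - 1)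

theorem eq_of (hW : SnugPartition n d W) {j : ℕ → ℕ} (hj : V n (d + 2) j) {k l r : ℕ}
    (hr : r < d) (h : E d W (dl k j) r ↔ E d W (dl l j) r) : ep d W j k ↔ ep d W j l := by
  have h1 := parity hW (V_dl hj k) (d - 1 - r) r (by omega)
  have h2 := parity hW (V_dl hj l) (d - 1 - r) r (by omega)
  unfold ep
  tauto

theorem F2a (hW : SnugPartition n d W) {j : ℕ → ℕ} (hj : V n (d + 2) j) {k i : ℕ}
    (hki : k < i + 1) (hi : i < d) (h : E d W (dl k j) i) :
    ep d W j (i + 1) ↔ ep d W j (i + 2) := by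
  have v := fun a b => V_dl (V_dl hj a) b
  apply eq_of hW hj (r := k) (by omega)
  unfold E at h ⊢
  rw [← dl_dl j k i (by omega), ← dl_dl j k (i + 1) (by omega)] at h
  rcases eq_or_ne k i with rfl | hne
  · -- adjacent
    rw [dl_dl j (k + 1) (k + 1) (by omega)]
    constructor
    · intro h'
      exact S_trans hW (v _ _) (S_symm h) h'
    · intro h'
      exact S_trans hW (v _ _) h h'
  · constructor
    · intro h'
      refine S_trans hW (v _ _) (S_symm h) (square hW (v _ _) (v _ _) (v _ _) (v _ _) h h' ?_)
      intro t
      by_cases ht : t ≤ k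
      · right; right; unfold dl; congr 1; split_ifs <;> omega
      · right; left; unfold dl; congr 1; split_ifs <;> omega
    · intro h'
      refine S_trans hW (v _ _) h (square hW (v _ _) (v _ _) (v _ _) (v _ _) (S_symm h) h' ?_)
      intro t
      by_cases ht : t ≤ k
      · right; right; unfold dl; congr 1; split_ifs <;> omega
      · right; left; unfold dl; congr 1; split_ifs <;> omega

theorem F2b (hW : SnugPartition n d W) {j : ℕ → ℕ} (hj : V n (d + 2) j) {k i : ℕ}
    (hki : i < k) (hi : k < d + 1) (h : E d W (dl (k + 1) j) i) :
    ep d W j i ↔ ep d W j (i + 1) := by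
  have v := fun a b => V_dl (V_dl hj a) b
  apply eq_of hW hj (r := k - 1) (by omega)
  obtain ⟨k, rfl⟩ : ∃ k', k = k' + 1 := ⟨k - 1, by omega⟩
  simp only [Nat.add_sub_cancel]
  unfold E at h ⊢
  rw [dl_dl j i (k + 1) (by omega), dl_dl j (i + 1) (k + 1) (by omega)] at h
  rcases eq_or_ne k i with rfl | hne
  · rw [dl_dl j k k (by omega)]
    constructor
    · intro h'
      exact S_trans hW (v _ _) h' h
    · intro h'
      exact S_trans hW (v _ _) h' (S_symm h)
  · constructor
    · intro h'
      refine S_symm (S_trans hW (v _ _) (S_symm h) (square hW (v _ _) (v _ _) (v _ _) (v _ _) h (S_symm h') ?_))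
      intro t
      by_cases ht : t ≤ i
      · right; left; unfold dl; congr 1; split_ifs <;> omega
      · right; right; unfold dl; congr 1; split_ifs <;> omega
    · intro h'
      refine S_symm (S_trans hW (v _ _) h (square hW (v _ _) (v _ _) (v _ _) (v _ _) (S_symm h) (S_symm h') ?_))
      intro t
      by_cases ht : t ≤ i
      · right; left; unfold dl; congr 1; split_ifs <;> omega
      · right; right; unfold dl; congr 1; split_ifs <;> omega

theorem F3 {W : Set (Set (Finset ℕ))} (hW : SnugPartition n 1 W) {j : ℕ → ℕ} (hj : V n 3 j)
    (h : ep 1 W j 1) : ep 1 W j 0 := by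
  have v := fun a b => V_dl (d := 1) (V_dl (d := 2) hj a) b
  unfold ep E at h ⊢
  obtain ⟨a, ha, hS⟩ := key hW (v 1 0)
  rw [hS _ (v _ _)] at h
  have h2 : S 1 W (dl 0 (dl 1 j)) (dl 1 (dl 0 j)) := by
    rw [hS _ (v _ _)]
    have a1 := ha 0 (by omega)
    have a2 := h 0 (by omega)
    have : j 0 < j 1 := hj.1 (by omega)
    have : j 1 < j 2 := hj.1 (by omega)
    intro t ht
    obtain rfl : t = 0 := by omega
    simp [dl] at a1 a2 ⊢
    omega
  have e : dl 0 (dl 1 j) = dl 0 (dl 0 j) := dl_dl j 0 0 (by omega)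
  rw [e] at h2
  exact h2

theorem comb (hd : 1 ≤ d) (hW : SnugPartition n d W) {j : ℕ → ℕ} (hj : V n (d + 2) j) :
    (∀ k < d + 2, ¬ ep d W j k) ∨ (∀ k < d + 2, ep d W j k) ∨
    ∃ i ≤ d, (∀ k ≤ i, (ep d W j k ↔ Odd (d - i))) ∧
      (∀ k < d + 2, i < k → (ep d W j k ↔ ¬ Odd (d - i))) := by
  have G1 : ∀ i ≤ d, ¬ (ep d W j i ↔ ep d W j (i + 1)) → ∀ k < i, (ep d W j k ↔ Odd (d - i)) := by
    intro i hi hne k hk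
    obtain ⟨i, rfl⟩ : ∃ i', i = i' + 1 := ⟨i - 1, by omega⟩
    have h1 : ¬ E d W (dl k j) i := fun h => hne (F2a hW hj hk (by omega) h)
    have h2 := parity hW (V_dl hj k) (d - (i + 1)) i (by omega)
    rw [← Nat.not_even_iff_odd]
    unfold ep
    tauto
  have G2 : ∀ i ≤ d, ¬ (ep d W j i ↔ ep d W j (i + 1)) → ∀ k < d + 2, i + 1 < k →
      (ep d W j k ↔ ¬ Odd (d - i)) := by
    intro i hi hne k hk hik
    obtain ⟨k, rfl⟩ : ∃ i', k = i' + 1 := ⟨k - 1, by omega⟩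
    have h1 : ¬ E d W (dl (k + 1) j) i := fun h => hne (F2b hW hj (by omega) (by omega) h)
    have h2 := parity hW (V_dl hj (k + 1)) (d - (i + 1)) i (by omega)
    have h3 : Odd (d - i) ↔ Even (d - (i + 1)) := by
      rw [show d - i = (d - (i + 1)) + 1 by omega, Nat.odd_add_one, Nat.not_odd_iff_even]
    rw [h3]
    unfold ep
    tauto
  have G3 : d = 1 → ep d W j 1 → ep d W j 0 := by
    intro h; subst h; exact F3 hW hj
  generalize ep d W j = e at G1 G2 G3
  have odd_succ : ∀ i < d, (Odd (d - i) ↔ ¬ Odd (d - (i + 1))) := by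
    intro i hi
    rw [show d - i = (d - (i + 1)) + 1 by omega, Nat.odd_add_one]
  by_cases hex : ∃ i ≤ d, ¬ (e i ↔ e (i + 1))
  · right; right
    obtain ⟨i, hi, hne⟩ := hex
    have hmain : e i ↔ Odd (d - i) := by
      by_contra hc
      have hc1 : e (i + 1) ↔ Odd (d - i) := by grind
      have A : ∀ i' , i = i' + 1 → ¬ (e i' ↔ e (i' + 1)) := by
        rintro i' rfl
        have := G1 _ hi hne i' (by omega)
        grind
      have B : i + 1 ≤ d → ¬ (e (i + 1) ↔ e (i + 1 + 1)) := by
        intro h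
        have := G2 _ hi hne (i + 2) (by omega) (by omega)
        grind
      by_cases h1 : i + 1 ≤ d
      · have B' := B h1
        have b1 := odd_succ i (by omega)
        by_cases h2 : i + 2 ≤ d
        · have g1 := G2 _ h1 B' (i + 3) (by omega) (by omega)
          have g2 := G2 _ hi hne (i + 3) (by omega) (by omega)
          grind
        · -- i + 1 = d
          rcases i with _ | i
          · obtain rfl : d = 1 := by omega
            have := G3 rfl
            simp at *
            grind
          · have g1 := G1 _ h1 B' i (by omega)
            have g2 := G1 _ hi hne i (by omega)
            grind
      · -- i = d
        obtain rfl : i = d := by omega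
        obtain ⟨i, rfl⟩ : ∃ i', i = i' + 1 := ⟨i - 1, by omega⟩
        have A' := A i rfl
        have b1 := odd_succ i (by omega)
        have g1 := G2 _ (by omega) A' (i + 2) (by omega) (by omega)
        rcases i with _ | i
        · have := G3 rfl
          simp at *
          grind
        · have g2 := G1 _ (by omega) A' i (by omega)
          have g3 := G1 _ hi hne i (by omega)
          grind
    refine ⟨i, hi, ?_, ?_⟩
    · intro k hk
      rcases hk.lt_or_eq with h | rfl
      · exact G1 i hi hne k h
      · exact hmain
    · intro k hk hik
      rcases eq_or_ne k (i + 1) with rfl | h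
      · grind
      · exact G2 i hi hne k hk (by omega)
  · push Not at hex
    have : ∀ k < d + 2, (e k ↔ e 0) := by
      intro k
      induction k with
      | zero => simp
      | succ k ih =>
        intro hk
        rw [← hex k (by omega)]
        exact ih (by omega)
    by_cases h0 : e 0
    · right; left; intro k hk; rw [this k hk]; exact h0
    · left; intro k hk; rw [this k hk]; exact h0

theorem inv_iff (hd : 1 ≤ d) {x : ℕ → ℕ} (hx : V n (d + 1) x) :
    C (d + 1) x ∈ InvSetP n d W ↔ E d W x (d - 1) := by
  obtain ⟨d, rfl⟩ : ∃ i', d = i' + 1 := ⟨d - 1, by omega⟩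
  have h1 : (C (d + 1 + 1) x).erase ((C (d + 1 + 1) x).sup id) = C (d + 1) (dl (d + 1) x) := by
    rw [C_sup hx.1, C_erase hx.1 le_rfl]
  have h2 : (C (d + 1) (dl (d + 1) x)).sup id = x d := by
    rw [C_sup (V_dl hx _).1]; simp [dl]
  unfold InvSetP
  simp only [Set.mem_setOf_eq]
  rw [h1, h2, C_erase hx.1 (by omega)]
  simp only [C_sub hx, C_card hx.1, true_and]
  exact ⟨S_symm, S_symm⟩

end

theorem lex_map (m : ℕ) : ∀ f g : ℕ → ℕ,
    List.Lex (· < ·) ((List.range m).map f) ((List.range m).map g) → ∃ t < m, f t < g t := by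
  induction m with
  | zero => intro f g h; simp at h
  | succ m ih =>
    intro f g h
    rw [List.range_succ_eq_map] at h
    simp only [List.map_cons, List.map_map] at h
    rcases List.cons_lex_cons_iff.1 h with h | ⟨-, h⟩
    · exact ⟨0, by omega, h⟩
    · obtain ⟨t, ht, hlt⟩ := ih _ _ h
      exact ⟨t + 1, by omega, hlt⟩

theorem C_sort {d : ℕ} {x : ℕ → ℕ} (hx : StrictMono x) :
    (C d x).sort (· ≤ ·) = (List.range d).map x := by
  have hp : ((List.range d).map x).Pairwise (· < ·) :=
    List.Pairwise.map x (fun a b h => hx h) List.pairwise_lt_range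
  have hn : ((List.range d).map x).Nodup := hp.imp (fun h => ne_of_lt h)
  have e : C d x = ((List.range d).map x).toFinset := by
    ext v; simp [C]
  rw [e]
  exact (List.toFinset_sort _ hn).2 (hp.imp le_of_lt)

theorem lex_imp {d k l : ℕ} {j : ℕ → ℕ} (hj : StrictMono j)
    (h : lexLtN (C (d + 1) (dl k j)) (C (d + 1) (dl l j))) : l < k := by
  have hs : ∀ k, StrictMono (dl k j) := by
    intro k s t hst
    apply hj
    split_ifs <;> omega
  unfold lexLtN at h
  rw [C_sort (hs _), C_sort (hs _)] at h
  obtain ⟨t, ht, h⟩ := lex_map _ _ _ h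
  unfold dl at h
  have := hj.lt_iff_lt.1 h
  split_ifs at this <;> omega

theorem exists_enum {n m : ℕ} {J : Finset ℕ} (hJ : J ⊆ Finset.Icc 1 (n - 1)) (hc : J.card = m) :
    ∃ j, V n m j ∧ J = C m j := by
  have hJ' : J = C m (fun k => if h : k < m then J.orderEmbOfFin hc ⟨k, h⟩ else n + k) := by
    ext v
    simp only [C, Finset.mem_image, Finset.mem_range]
    constructor
    · intro hv
      rw [← Finset.mem_coe, ← Finset.range_orderEmbOfFin J hc] at hv
      obtain ⟨t, rfl⟩ := hv
      exact ⟨t, t.2, by simp⟩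
    · rintro ⟨t, ht, rfl⟩
      rw [dif_pos ht]
      exact Finset.orderEmbOfFin_mem _ _ _
  have hb : ∀ t, J.orderEmbOfFin hc t ∈ Finset.Icc 1 (n - 1) := fun t =>
    hJ (Finset.orderEmbOfFin_mem _ _ _)
  refine ⟨_, ⟨?_, ?_⟩, hJ'⟩
  · intro s t hst
    dsimp only
    split_ifs with h1 h2 h2
    · exact (J.orderEmbOfFin hc).strictMono hst
    · have := Finset.mem_Icc.1 (hb ⟨s, h1⟩)
      omega
    · omega
    · omega
  · intro t ht
    rw [dif_pos ht]
    exact Finset.mem_Icc.1 (hb _)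

theorem packet {d : ℕ} {j : ℕ → ℕ} (hj : StrictMono j) (Y : Finset ℕ) :
    (Y ⊆ C (d + 2) j ∧ Y.card = d + 1) ↔ ∃ k < d + 2, Y = C (d + 1) (dl k j) := by
  constructor
  · rintro ⟨h1, h2⟩
    have h3 : (C (d + 2) j \ Y).card = 1 := by
      rw [Finset.card_sdiff_of_subset h1, C_card hj, h2]; omega
    obtain ⟨v, hv⟩ := Finset.card_eq_one.1 h3
    have hvm : v ∈ C (d + 2) j := (Finset.mem_sdiff.1 (hv ▸ Finset.mem_singleton_self v)).1
    obtain ⟨k, hk, rfl⟩ := Finset.mem_image.1 hvm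
    have hk := Finset.mem_range.1 hk
    refine ⟨k, hk, ?_⟩
    rw [← C_erase hj (by omega), Finset.erase_eq, ← hv, Finset.sdiff_sdiff_eq_self h1]
  · rintro ⟨k, hk, rfl⟩
    have hm : j k ∈ C (d + 2) j := Finset.mem_image_of_mem _ (by simpa using hk)
    rw [← C_erase hj (by omega)]
    refine ⟨Finset.erase_subset _ _, ?_⟩
    rw [Finset.card_erase_of_mem hm, C_card hj]
    omega

theorem pk_inj {d : ℕ} {j : ℕ → ℕ} (hj : StrictMono j) {k l : ℕ} (hk : k < d + 2)
    (hl : l < d + 2) (h : C (d + 1) (dl k j) = C (d + 1) (dl l j)) : k = l := by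
  rw [← C_erase hj (by omega), ← C_erase hj (by omega)] at h
  have hm : j k ∈ C (d + 2) j := Finset.mem_image_of_mem _ (by simpa using hk)
  exact hj.injective (Finset.erase_injOn _ hm (Finset.mem_image_of_mem _ (by simpa using hl)) h)

end Snug

open Snug in
theorem stmt_14 (d n : ℕ) (hd : 1 ≤ d) (hdn : d < n)
    (W : Set (Set (Finset ℕ))) (hW : SnugPartition n d W) :
    ∀ J : Finset ℕ, J ⊆ Finset.Icc 1 (n - 1) → J.card = d + 2 →
      InvSetP n d W ∩ {Y : Finset ℕ | Y ⊆ J ∧ Y.card = d + 1} = ∅ ∨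
      {Y : Finset ℕ | Y ⊆ J ∧ Y.card = d + 1} ⊆ InvSetP n d W ∨
      ((∀ Y, Y ⊆ J → Y.card = d + 1 → ∀ Z, Z ⊆ J → Z.card = d + 1 →
          Z ∈ InvSetP n d W → lexLtN Y Z → Y ∈ InvSetP n d W) ∧
        Odd (InvSetP n d W ∩ {Y : Finset ℕ | Y ⊆ J ∧ Y.card = d + 1}).ncard) ∨
      ((∀ Y, Y ⊆ J → Y.card = d + 1 → ∀ Z, Z ⊆ J → Z.card = d + 1 →
          Z ∈ InvSetP n d W → lexLtN Z Y → Y ∈ InvSetP n d W) ∧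
        (InvSetP n d W ∩ {Y : Finset ℕ | Y ⊆ J ∧ Y.card = d + 1}).ncard % 2
          = d % 2) := by
  intro J hJ hc
  obtain ⟨j, hj, rfl⟩ := exists_enum hJ hc
  have hinv : ∀ k, C (d + 1) (dl k j) ∈ InvSetP n d W ↔ ep d W j k := fun k =>
    inv_iff hd (V_dl hj k)
  have hset : InvSetP n d W ∩ {Y : Finset ℕ | Y ⊆ C (d + 2) j ∧ Y.card = d + 1} =
      (fun k => C (d + 1) (dl k j)) '' {k | k < d + 2 ∧ ep d W j k} := by
    ext Y
    simp only [Set.mem_inter_iff, Set.mem_setOf_eq, packet hj.1, Set.mem_image]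
    constructor
    · rintro ⟨h, k, hk, rfl⟩
      exact ⟨k, ⟨hk, (hinv k).1 h⟩, rfl⟩
    · rintro ⟨k, ⟨hk, h⟩, rfl⟩
      exact ⟨(hinv k).2 h, k, hk, rfl⟩
  have hcard : (InvSetP n d W ∩ {Y : Finset ℕ | Y ⊆ C (d + 2) j ∧ Y.card = d + 1}).ncard =
      {k | k < d + 2 ∧ ep d W j k}.ncard := by
    rw [hset]
    exact Set.ncard_image_of_injOn (fun k hk l hl h => pk_inj hj.1 hk.1 hl.1 h)
  rw [hcard]
  rcases comb hd hW hj with h | h | ⟨i, hi, h1, h2⟩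
  · left
    rw [hset]
    simp only [Set.image_eq_empty]
    ext k
    simp only [Set.mem_setOf_eq, Set.mem_empty_iff_false, iff_false, not_and]
    exact h k
  · right; left
    intro Y hY
    obtain ⟨k, hk, rfl⟩ := (packet hj.1 Y).1 hY
    exact (hinv k).2 (h k hk)
  · right; right
    by_cases ho : Odd (d - i)
    · right
      constructor
      · intro Y hY hY' Z hZ hZ' hZI hlt
        obtain ⟨k, hk, rfl⟩ := (packet hj.1 Y).1 ⟨hY, hY'⟩
        obtain ⟨l, hl, rfl⟩ := (packet hj.1 Z).1 ⟨hZ, hZ'⟩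
        have hkl := lex_imp hj.1 hlt
        rw [hinv] at hZI ⊢
        have : l ≤ i := by
          by_contra hc
          exact (h2 l hl (by omega)).1 hZI ho
        exact (h1 k (by omega)).2 ho
      · have : {k | k < d + 2 ∧ ep d W j k} = ((Finset.range (i + 1) : Finset ℕ) : Set ℕ) := by
          ext k
          simp only [Set.mem_setOf_eq, Finset.coe_range, Set.mem_Iio]
          constructor
          · rintro ⟨hk, h⟩
            by_contra hc
            exact (h2 k hk (by omega)).1 h ho
          · intro hk
            exact ⟨by omega, (h1 k (by omega)).2 ho⟩
        rw [this, Set.ncard_coe_finset, Finset.card_range]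
        rw [Nat.odd_iff] at ho
        omega
    · left
      constructor
      · intro Y hY hY' Z hZ hZ' hZI hlt
        obtain ⟨k, hk, rfl⟩ := (packet hj.1 Y).1 ⟨hY, hY'⟩
        obtain ⟨l, hl, rfl⟩ := (packet hj.1 Z).1 ⟨hZ, hZ'⟩
        have hkl := lex_imp hj.1 hlt
        rw [hinv] at hZI ⊢
        have : i < l := by
          by_contra hc
          exact ho ((h1 l (by omega)).1 hZI)
        exact (h2 k hk (by omega)).2 ho
      · have : {k | k < d + 2 ∧ ep d W j k} = ((Finset.Ico (i + 1) (d + 2) : Finset ℕ) : Set ℕ) := by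
          ext k
          simp only [Set.mem_setOf_eq, Finset.coe_Ico, Set.mem_Ico]
          constructor
          · rintro ⟨hk, h⟩
            refine ⟨?_, hk⟩
            by_contra hc
            exact ho ((h1 k (by omega)).1 h)
          · rintro ⟨hk, hk'⟩
            exact ⟨hk', (h2 k hk' (by omega)).2 ho⟩
        rw [this, Set.ncard_coe_finset, Nat.card_Ico]
        rw [Nat.odd_iff] at ho ⊢
        omega
end
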